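/- arXiv:math/9909009 — 2 statements merged into one kernel-verified Lean document; each statement's English description precedes it below -/
import Mathlib

section
/- (Proposition 5.4) Assume the hypotheses of Theorem 1.18: 𝔽_q has characteristic p; f ∈ 𝔽_q[x_1,…,x_n] has degree δ with highest homogeneous part f^{(δ)} and second-highest homogeneous part f^{(δ')}; f^{(δ)} = f_1^{a_1} ⋯ f_r^{a_r} with each f_i homogeneous; for every nonempty subset {i_1,…,i_k} ⊆ {1,…,r} the system f_{i_1} = ⋯ = f_{i_k} = 0 defines a smooth complete intersection of codimension k in P^{n-1}, and if k ≥ 2, or k = 1 and a_{i_1} > 1, the system f^{(δ')} = f_{i_1} = ⋯ = f_{i_k} = 0 defines a smooth complete intersection of codimension k+1 in P^{n-1}; and p ∤ δ δ' a_1 ⋯ a_r. Let k < n and let ω ∈ Ω^k be a homogeneous k-form with df^{(δ)} ∧ ω = 0. Then there exist homogeneous forms α_{i_1⋯i_l} ∈ Ω^{k-1-l}, for 0 ≤ l ≤ k-1 and 1 ≤ i_1 < ⋯ < i_l ≤ r, such that in the module of differential forms over the localization R[1/(f_1⋯f_r)] one has ω = Θ ∧ ( Σ_{l=0}^{k-1}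 Σ_{1 ≤ i_1 < ⋯ < i_l ≤ r} Ω_{i_1⋯i_l} ∧ α_{i_1⋯i_l} ). -/
set_option synthInstance.maxHeartbeats 1000000
set_option maxHeartbeats 1000000
open MvPolynomial

/-- The polynomial ring `𝔽_q[x_1,…,x_n]`. -/
abbrev PolyRing (F : Type) [Field F] (n : ℕ) : Type := MvPolynomial (Fin n) F

/-- The exterior algebra over `R = F[x_1,…,x_n]` of the free module on `dx_1,…,dx_n`;
the module of differential `k`-forms `Ω^k` is its degree-`k` part. -/
abbrev FormAlgebra (F : Type) [Field F] (n : ℕ) : Type :=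
  ExteriorAlgebra (PolyRing F n) (Fin n → PolyRing F n)

/-- `dg = Σ_i (∂g/∂x_i) dx_i` as an element of the exterior algebra. -/
noncomputable def dform {F : Type} [Field F] {n : ℕ} (g : PolyRing F n) : FormAlgebra F n :=
  ExteriorAlgebra.ι (PolyRing F n) (fun j => MvPolynomial.pderiv j g)

/-- `c · dx_{s 0} ∧ ⋯ ∧ dx_{s (k-1)}`. -/
noncomputable def wedgeMonomial {F : Type} [Field F] {n : ℕ} (k : ℕ) (s : Fin k → Fin n)
    (c : PolyRing F n) : FormAlgebra F n :=
  c • (List.ofFn fun i => ExteriorAlgebra.ι (PolyRing F n)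
        (Pi.single (s i) (1 : PolyRing F n))).prod

/-- `ω` is a differential `k`-form, i.e. an `R`-linear combination of `k`-fold wedge
products of the `dx_i`. -/
def IsForm {F : Type} [Field F] {n : ℕ} (k : ℕ) (ω : FormAlgebra F n) : Prop :=
  ω ∈ AddSubgroup.closure {x | ∃ (s : Fin k → Fin n) (c : PolyRing F n), x = wedgeMonomial k s c}

/-- `ω` is a homogeneous `k`-form whose coefficients are homogeneous polynomials of degree `d`. -/
def IsHomogeneousForm {F : Type} [Field F] {n : ℕ} (k d : ℕ) (ω : FormAlgebra F n) : Prop :=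
  ω ∈ AddSubgroup.closure {x | ∃ (s : Fin k → Fin n) (c : PolyRing F n),
    c.IsHomogeneous d ∧ x = wedgeMonomial k s c}

/-- The system of homogeneous equations `g i = 0` defines a smooth complete intersection
in `P^{n-1}`: over an algebraic closure, the only common zero of the `g i` in affine
`n`-space at which the differentials `d(g i)` are linearly dependent is the origin. -/
def IsSmoothCI {F : Type} [Field F] {n : ℕ} {ι : Type} (g : ι → PolyRing F n) : Prop :=
  ∀ x : Fin n → AlgebraicClosure F,
    (∀ i, MvPolynomial.eval x
      (MvPolynomial.map (algebraMap F (AlgebraicClosure F)) (g i)) = 0) →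
    ¬ LinearIndependent (AlgebraicClosure F)
      (fun i => fun j : Fin n => MvPolynomial.eval x
        (MvPolynomial.map (algebraMap F (AlgebraicClosure F)) (MvPolynomial.pderiv j (g i)))) →
    x = 0

/-- `df_{i_1} ∧ ⋯ ∧ df_{i_l}` for the increasing enumeration `i_1 < ⋯ < i_l` of `s`. -/
noncomputable def dWedge {F : Type} [Field F] {n : ℕ} {r : ℕ} (g : Fin r → PolyRing F n)
    (s : Finset (Fin r)) : FormAlgebra F n :=
  ((s.sort (· ≤ ·)).map fun i => dform (g i)).prod

/-- The polynomial form `(Σ_i a_i (∏_j f_j^{expo j}) df_i/f_i) ∧ Ω_{i_1⋯i_l}`, where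
`Ω_{i_1⋯i_l} = (df_{i_1}/f_{i_1}) ∧ ⋯ ∧ (df_{i_l}/f_{i_l})` and `s = {i_1 < ⋯ < i_l}`;
all denominators cancel provided `expo j ≥ 1` for all `j`. -/
noncomputable def clearedThetaOmega {F : Type} [Field F] {n : ℕ} {r : ℕ}
    (g : Fin r → PolyRing F n) (a : Fin r → ℕ) (expo : Fin r → ℕ) (s : Finset (Fin r)) :
    FormAlgebra F n :=
  ∑ i ∈ sᶜ, ((a i : PolyRing F n) *
      ∏ j, g j ^ (expo j - (if j ∈ insert i s then 1 else 0))) • (dform (g i) * dWedge g s)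

section Depth

variable {R : Type*} [CommRing R]

/-- Multiplication by `c` is injective modulo the ideal `K`. -/
def RegularMod (c : R) (K : Ideal R) : Prop := ∀ u, c * u ∈ K → u ∈ K

/-- There is a regular sequence of length `d` on `R ⧸ K` consisting of elements of `I`
(the quotient by the sequence may vanish). -/
def DepthGE (I : Ideal R) : ℕ → Ideal R → Prop
  | 0, _ => True
  | d + 1, K => ∃ c ∈ I, RegularMod c K ∧ DepthGE I d (K ⊔ Ideal.span {c})

theorem mem_sup_span_singleton_iff {K : Ideal R} {c u : R} :
    u ∈ K ⊔ Ideal.span {c} ↔ ∃ v, u - c * v ∈ K := by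
  rw [sup_comm, Ideal.mem_span_singleton_sup]
  constructor
  · rintro ⟨v, k, hk, rfl⟩
    exact ⟨v, by convert hk using 1; ring⟩
  · rintro ⟨v, hv⟩
    exact ⟨v, _, hv, by ring⟩

theorem regularMod_top (c : R) : RegularMod c ⊤ := fun _ _ ↦ trivial

theorem RegularMod.mul {K : Ideal R} {b c : R} (hb : RegularMod b K) (hc : RegularMod c K) :
    RegularMod (b * c) K := fun u hu ↦ hc u (hb _ (by rwa [← mul_assoc]))

theorem RegularMod.pow {K : Ideal R} {c : R} (hc : RegularMod c K) (N : ℕ) :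
    RegularMod (c ^ N) K := by
  induction N with
  | zero => intro u hu; simpa using hu
  | succ N ih => rw [pow_succ]; exact ih.mul hc

theorem RegularMod.swap {K : Ideal R} {b c : R} (hb : RegularMod b K)
    (hc : RegularMod c (K ⊔ Ideal.span {b})) : RegularMod b (K ⊔ Ideal.span {c}) := by
  intro u hu
  obtain ⟨v, hv⟩ := mem_sup_span_singleton_iff.1 hu
  have h1 : c * v ∈ K ⊔ Ideal.span {b} := by
    refine mem_sup_span_singleton_iff.2 ⟨u, ?_⟩
    rw [← neg_sub]; exact K.neg_mem hv
  obtain ⟨t, ht⟩ := mem_sup_span_singleton_iff.1 (hc v h1)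
  refine mem_sup_span_singleton_iff.2 ⟨t, hb _ ?_⟩
  have := K.add_mem hv (K.mul_mem_left c ht)
  convert this using 1; ring

theorem depthGE_top (I : Ideal R) (d : ℕ) : DepthGE I d ⊤ := by
  induction d with
  | zero => trivial
  | succ d ih => exact ⟨0, I.zero_mem, regularMod_top 0, by simpa using ih⟩

theorem DepthGE.of_succ {I : Ideal R} {d : ℕ} {K : Ideal R} (h : DepthGE I (d + 1) K) :
    DepthGE I d K := by
  induction d generalizing K with
  | zero => trivial
  | succ d ih => obtain ⟨c, hc, h1, h2⟩ := h; exact ⟨c, hc, h1, ih h2⟩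

theorem DepthGE.mono {I : Ideal R} {d e : ℕ} {K : Ideal R} (h : DepthGE I e K) (hde : d ≤ e) :
    DepthGE I d K := by
  induction e, hde using Nat.le_induction with
  | base => exact h
  | succ e _ ih => exact ih h.of_succ

theorem exists_regularMod [IsNoetherianRing R] (I : Ideal R) (S : Set (Ideal R)) (hS : S.Finite)
    (h : ∀ K ∈ S, ∀ u, (∀ y ∈ I, y * u ∈ K) → u ∈ K) : ∃ c ∈ I, ∀ K ∈ S, RegularMod c K := by
  have hfin : (⋃ K ∈ S, associatedPrimes R (R ⧸ K)).Finite :=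
    hS.biUnion fun K _ ↦ associatedPrimes.finite R (R ⧸ K)
  have hnot : ¬ ((I : Set R) ⊆ ⋃ P ∈ ⋃ K ∈ S, associatedPrimes R (R ⧸ K), (P : Set R)) := by
    intro hsub
    obtain ⟨P, hP, hIP⟩ := (I.subset_union_prime_finite hfin (f := id) 0 0 (by
      intro P hP _ _
      obtain ⟨K, _, hPK⟩ := Set.mem_iUnion₂.1 hP
      exact hPK.isPrime)).1 hsub
    obtain ⟨K, hK, hPK⟩ := Set.mem_iUnion₂.1 hP
    obtain ⟨hprime, x, hx⟩ := isAssociatedPrime_iff.1 hPK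
    obtain ⟨u, rfl⟩ := Ideal.Quotient.mk_surjective x
    have key : ∀ y : R, y ∈ P ↔ y * u ∈ K := by
      intro y
      rw [hx, Submodule.mem_colon_singleton, Submodule.mem_bot, ← Ideal.Quotient.eq_zero_iff_mem]
      rfl
    have hu : u ∈ K := h K hK u fun y hy ↦ (key y).1 (hIP hy)
    exact hprime.ne_top ((Ideal.eq_top_iff_one _).2 ((key 1).2 (by simpa using hu)))
  obtain ⟨c, hcI, hc⟩ := Set.not_subset.1 hnot
  refine ⟨c, hcI, fun K hK u hu ↦ ?_⟩
  by_contra hu'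
  have hz : c ∈ ⋃ p ∈ associatedPrimes R (R ⧸ K), (p : Set R) := by
    rw [biUnion_associatedPrimes_eq_zero_divisors]
    refine ⟨Ideal.Quotient.mk K u, fun h0 ↦ hu' (Ideal.Quotient.eq_zero_iff_mem.1 h0), ?_⟩
    exact Ideal.Quotient.eq_zero_iff_mem.2 hu
  obtain ⟨P, hP, hcP⟩ := Set.mem_iUnion₂.1 hz
  exact hc (Set.mem_iUnion₂.2 ⟨P, Set.mem_iUnion₂.2 ⟨K, hK, hP⟩, hcP⟩)

theorem DepthGE.sup_span_singleton [IsNoetherianRing R] {I : Ideal R} {d : ℕ} {K : Ideal R}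
    {b : R} (h : DepthGE I (d + 1) K) (hbI : b ∈ I) (hb : RegularMod b K) :
    DepthGE I d (K ⊔ Ideal.span {b}) := by
  induction d generalizing K b with
  | zero => trivial
  | succ d ih =>
    obtain ⟨c₁, hc₁I, hc₁, c₂, hc₂I, hc₂, h3⟩ := h
    have hd : DepthGE I (d + 1) (K ⊔ Ideal.span {c₁}) := ⟨c₂, hc₂I, hc₂, h3⟩
    obtain ⟨c, hcI, hc⟩ := exists_regularMod I
      {K, K ⊔ Ideal.span {b}, K ⊔ Ideal.span {c₁}} (Set.toFinite _) (by
      rintro L (rfl | rfl | rfl) u hu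
      · exact hc₁ u (hu _ hc₁I)
      · obtain ⟨v, hv⟩ := mem_sup_span_singleton_iff.1 (hu _ hc₁I)
        have hv' : v ∈ K ⊔ Ideal.span {c₁} := by
          refine hc₂ v (mem_sup_span_singleton_iff.2 ?_)
          obtain ⟨v', hv'⟩ := mem_sup_span_singleton_iff.1 (hu _ hc₂I)
          refine ⟨v', hb _ ?_⟩
          have := K.sub_mem (K.mul_mem_left c₁ hv') (K.mul_mem_left c₂ hv)
          convert this using 1; ring
        obtain ⟨t, ht⟩ := mem_sup_span_singleton_iff.1 hv'
        refine mem_sup_span_singleton_iff.2 ⟨t, hc₁ _ ?_⟩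
        have := K.add_mem hv (K.mul_mem_left b ht)
        convert this using 1; ring
      · exact hc₂ u (hu _ hc₂I))
    have hcK := hc K (by simp)
    have hcb := hc (K ⊔ Ideal.span {b}) (by simp)
    have hcc := hc (K ⊔ Ideal.span {c₁}) (by simp)
    have h4 : DepthGE I (d + 1) (K ⊔ Ideal.span {c}) :=
      ⟨c₁, hc₁I, hc₁.swap hcc, by
        have := ih hd hcI hcc
        rwa [sup_right_comm] at this⟩
    exact ⟨c, hcI, hcb, by
      have := ih h4 hbI (hb.swap hcb)
      rwa [sup_right_comm] at this⟩

theorem exists_mem_colon_not_mem [IsNoetherianRing R] {m K : Ideal R} [m.IsPrime] {c : R}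
    (hcm : c ∈ m) (hc : RegularMod c K) (P : Ideal R) (u : R) (hPu : ∀ y ∈ P, y * u ∈ K)
    (hu : ∀ s, s * u ∈ K → s ∈ m) :
    ∃ v, (∀ y ∈ P, y * v ∈ K) ∧ ∀ s, s * v ∈ K ⊔ Ideal.span {c} → s ∈ m := by
  by_contra! hcon
  let A : R → Ideal (Localization.AtPrime m) :=
    fun v ↦ (K ⊔ Ideal.span {v}).map (algebraMap R (Localization.AtPrime m))
  have hA : ∀ v t, algebraMap R (Localization.AtPrime m) t ∈ A v ↔
      ∃ s ∉ m, s * t ∈ K ⊔ Ideal.span {v} := by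
    intro v t
    exact IsLocalization.algebraMap_mem_map_algebraMap_iff m.primeCompl _ _ _
  let S : Set (Ideal (Localization.AtPrime m)) :=
    {B | ∃ v, B = A v ∧ (∀ y ∈ P, y * v ∈ K) ∧ ∀ s, s * v ∈ K → s ∈ m}
  obtain ⟨B, ⟨v, rfl, hv1, hv2⟩, hmax⟩ :=
    set_has_maximal_iff_noetherian.2 (inferInstance : IsNoetherianRing (Localization.AtPrime m))
      S ⟨A u, u, rfl, hPu, hu⟩
  obtain ⟨s, hs, hsm⟩ := hcon v hv1
  obtain ⟨t, ht⟩ := mem_sup_span_singleton_iff.1 hs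
  have htS : A t ∈ S := by
    refine ⟨t, rfl, fun y hy ↦ hc _ ?_, fun s' hs' ↦ ?_⟩
    · have := K.sub_mem (K.mul_mem_left s (hv1 y hy)) (K.mul_mem_left y ht)
      convert this using 1; ring
    · have h1 : s' * s ∈ m := hv2 _ (by
        have := K.add_mem (K.mul_mem_left s' ht) (K.mul_mem_left c hs')
        convert this using 1; ring)
      exact ((Ideal.IsPrime.mem_or_mem ‹_› h1).resolve_right hsm)
  have hle : A v ≤ A t := by
    refine Ideal.map_le_iff_le_comap.2 (sup_le ?_ ?_)
    · exact le_trans le_sup_left Ideal.le_comap_map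
    · rw [Ideal.span_singleton_le_iff_mem, Ideal.mem_comap, hA]
      exact ⟨s, hsm, mem_sup_span_singleton_iff.2 ⟨c, by rwa [mul_comm t]⟩⟩
  have heq : A v = A t := by
    by_contra hne
    exact hmax _ htS (lt_of_le_of_ne hle hne)
  have htv : algebraMap R (Localization.AtPrime m) t ∈ A v := by
    rw [heq]
    exact Ideal.mem_map_of_mem _
      (Ideal.mem_sup_right (Ideal.mem_span_singleton_self t))
  obtain ⟨s', hs', hst⟩ := (hA v t).1 htv
  obtain ⟨y, hy⟩ := mem_sup_span_singleton_iff.1 hst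
  have h1 : s * s' - c * y ∈ m := hv2 _ (by
    have := K.add_mem (K.mul_mem_left s' ht) (K.mul_mem_left c hy)
    convert this using 1; ring)
  have h2 : s * s' ∈ m := by
    have := m.add_mem h1 (m.mul_mem_right y hcm)
    rwa [sub_add_cancel] at this
  exact (Ideal.IsPrime.mem_or_mem ‹_› h2).elim hsm hs'

theorem DepthGE.height_add_le [IsNoetherianRing R] {m : Ideal R} [hm : m.IsPrime] {d : ℕ}
    {K P : Ideal R} (h : DepthGE m d K) [hP : P.IsPrime] (hPm : P ≤ m) (u : R)
    (hu : ∀ y, y ∈ P ↔ y * u ∈ K) : P.height + d ≤ m.height := by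
  induction d generalizing K P u with
  | zero => simpa using Ideal.height_mono hPm
  | succ d ih =>
    obtain ⟨c, hcm, hc, hd⟩ := h
    obtain ⟨v, hv1, hv2⟩ := exists_mem_colon_not_mem hcm hc P u (fun y hy ↦ (hu y).1 hy)
      fun s hs ↦ hPm ((hu s).2 hs)
    let L : Ideal R := (K ⊔ Ideal.span {c} : Ideal R).colon {v}
    have hL : ∀ y, y ∈ L ↔ y * v ∈ K ⊔ Ideal.span {c} := fun y ↦
      Submodule.mem_colon_singleton
    have hLm : L ≤ m := fun y hy ↦ hv2 y ((hL y).1 hy)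
    obtain ⟨Q, hQ, hQm⟩ := Ideal.exists_minimalPrimes_le hLm
    obtain ⟨v', hv'⟩ := Submodule.exists_eq_colon_of_mem_minimalPrimes (x := v) hQ
    have hQp : Q.IsPrime := hQ.1.1
    have hLQ : L ≤ Q := hQ.1.2
    have hcP : c ∉ P := fun hcP ↦ hP.ne_top ((Ideal.eq_top_iff_one _).2
      ((hu 1).2 (by simpa using hc u ((hu c).1 hcP))))
    have hPQ : P < Q := by
      refine lt_of_le_of_ne (fun y hy ↦ hLQ ((hL y).2 (Ideal.mem_sup_left (hv1 y hy)))) ?_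
      rintro rfl
      exact hcP (hLQ ((hL c).2 (Ideal.mul_mem_right _ _
        (Ideal.mem_sup_right (Ideal.mem_span_singleton_self c)))))
    have h1 := ih hd hQm v' fun y ↦ by rw [hv', Submodule.mem_colon_singleton]; rfl
    have h2 := Ideal.height_add_one_le_of_lt_of_isPrime hPQ
    calc P.height + (d + 1 : ℕ) = P.height + 1 + d := by push_cast; ring
      _ ≤ Q.height + d := by gcongr
      _ ≤ _ := h1

end Depth

section PolynomialRing

variable {F : Type*} [Field F] {n : ℕ}

theorem mem_idealOfVars_iff (p : MvPolynomial (Fin n) F) :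
    p ∈ idealOfVars (Fin n) F ↔ constantCoeff p = 0 := by
  have := mem_pow_idealOfVars_iff' (σ := Fin n) 1 p
  rw [pow_one] at this
  rw [this]
  simp [Finsupp.degree_eq_zero_iff, constantCoeff_eq]

instance idealOfVars_isPrime : (idealOfVars (Fin n) F).IsPrime := by
  have : idealOfVars (Fin n) F = RingHom.ker (constantCoeff (R := F) (σ := Fin n)) := by
    ext p; rw [mem_idealOfVars_iff, RingHom.mem_ker]
  rw [this]; exact RingHom.ker_isPrime _

theorem height_idealOfVars_le : (idealOfVars (Fin n) F).height ≤ n := by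
  refine (Ideal.height_le_spanFinrank _ idealOfVars_isPrime.ne_top).trans ?_
  have h := Submodule.spanFinrank_span_le_ncard_of_finite
    (R := MvPolynomial (Fin n) F) (Set.finite_range (X (R := F) (σ := Fin n)))
  have h2 : (Set.range (X (R := F) (σ := Fin n))).ncard ≤ n := by
    rw [← Set.image_univ]
    exact (Set.ncard_image_le Set.finite_univ).trans (by simp)
  exact_mod_cast h.trans h2

theorem X_regularMod (j : Fin n) :
    RegularMod (X j : MvPolynomial (Fin n) F) (Ideal.span (X '' {i | i < j})) := by
  intro u hu
  rw [mem_ideal_span_X_image] at hu ⊢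
  intro a ha
  obtain ⟨i, hi, h⟩ := hu (Finsupp.single j 1 + a) (by
    rw [mem_support_iff] at ha ⊢
    rwa [coeff_X_mul])
  refine ⟨i, hi, ?_⟩
  have hij : j ≠ i := ne_of_gt hi
  simpa [Finsupp.single_apply, hij] using h

theorem depthGE_idealOfVars_span (d : ℕ) (hd : d ≤ n) :
    DepthGE (idealOfVars (Fin n) F) d (Ideal.span (X '' {i : Fin n | i.val < n - d})) := by
  induction d with
  | zero => trivial
  | succ d ih =>
    refine ⟨X ⟨n - (d + 1), by omega⟩, Ideal.subset_span ⟨_, rfl⟩, X_regularMod _, ?_⟩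
    have := ih (by omega)
    rw [← Ideal.span_union, ← Set.image_singleton, ← Set.image_union]
    convert this using 4
    ext i
    simp only [Set.mem_union, Set.mem_ofPred_eq, Set.mem_singleton_iff, Fin.ext_iff]
    omega

theorem depthGE_idealOfVars_bot : DepthGE (idealOfVars (Fin n) F) n ⊥ := by
  simpa using depthGE_idealOfVars_span (F := F) n le_rfl

theorem homogeneousComponent_mul_of_isHomogeneous {g : MvPolynomial (Fin n) F} {d : ℕ}
    (hg : g.IsHomogeneous d) (e : ℕ) (u : MvPolynomial (Fin n) F) :
    homogeneousComponent (d + e) (g * u) = g * homogeneousComponent e u := by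
  conv_lhs => rw [← sum_homogeneousComponent u, Finset.mul_sum, map_sum]
  rw [Finset.sum_congr rfl fun i _ ↦ homogeneousComponent_of_mem
    ((mem_homogeneousSubmodule _ _).2 (hg.mul (homogeneousComponent_isHomogeneous i u)))]
  simp only [add_right_inj, Finset.sum_ite_eq, Finset.mem_range]
  split_ifs with h
  · rfl
  · rw [homogeneousComponent_eq_zero _ _ (by omega), mul_zero]

attribute [local instance] MvPolynomial.gradedAlgebra

theorem isHomogeneous_span_image {r : ℕ} {g : Fin r → MvPolynomial (Fin n) F} {dg : Fin r → ℕ}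
    (hgh : ∀ i, (g i).IsHomogeneous (dg i)) (T : Set (Fin r)) :
    (Ideal.span (g '' T)).IsHomogeneous (homogeneousSubmodule (Fin n) F) := by
  refine Ideal.homogeneous_span _ _ ?_
  rintro _ ⟨i, _, rfl⟩
  exact ⟨dg i, hgh i⟩

theorem exists_submatrix_det_ne_zero {κ : Type*} [Field κ] {ι : Type*} [Fintype ι] [DecidableEq ι]
    {σ : Type*} [Finite σ] (A : ι → σ → κ) (hA : LinearIndependent κ A) :
    ∃ e : ι → σ, Matrix.det (Matrix.of fun i j ↦ A i (e j)) ≠ 0 := by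
  cases nonempty_fintype σ
  obtain ⟨τ, e, he, hspan, hli⟩ := exists_linearIndependent' κ (Matrix.of A).col
  have : Finite τ := Finite.of_injective e he
  cases nonempty_fintype τ
  have hr : (Matrix.of A).rank = Fintype.card ι := hA.rank_matrix
  rw [Matrix.rank_eq_finrank_span_cols, ← hspan, finrank_span_eq_card hli] at hr
  obtain ⟨φ⟩ := Fintype.card_eq.1 hr
  refine ⟨e ∘ φ.symm, ?_⟩
  have h3 : LinearIndependent κ (((Matrix.of A).col ∘ e) ∘ φ.symm) :=
    hli.comp _ φ.symm.injective
  have h4 := Matrix.linearIndependent_cols_iff_isUnit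
    (A := Matrix.of fun i j ↦ A i ((e ∘ φ.symm) j)) |>.1 h3
  exact ((Matrix.isUnit_iff_isUnit_det _).1 h4).ne_zero

/-- The polynomials `a` for which the gradients of the `g i` admit dual vectors up to the
factor `a`. -/
def dualIdeal {ι : Type*} [DecidableEq ι] (g : ι → MvPolynomial (Fin n) F) :
    Ideal (MvPolynomial (Fin n) F) where
  carrier := {a | ∃ d : ι → Fin n → MvPolynomial (Fin n) F,
    ∀ i j, ∑ k, d i k * pderiv k (g j) = if i = j then a else 0}
  add_mem' := by
    rintro a b ⟨d, hd⟩ ⟨e, he⟩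
    refine ⟨d + e, fun i j ↦ ?_⟩
    simp only [Pi.add_apply, add_mul, Finset.sum_add_distrib, hd, he]
    split_ifs <;> simp
  zero_mem' := ⟨0, fun i j ↦ by simp⟩
  smul_mem' := by
    rintro c a ⟨d, hd⟩
    refine ⟨fun i k ↦ c * d i k, fun i j ↦ ?_⟩
    simp only [mul_assoc, ← Finset.mul_sum, hd]
    split_ifs <;> simp

theorem det_mem_dualIdeal {ι : Type*} [Fintype ι] [DecidableEq ι]
    (g : ι → MvPolynomial (Fin n) F) (e : ι → Fin n) :
    Matrix.det (Matrix.of fun i j ↦ pderiv (e j) (g i)) ∈ dualIdeal g := by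
  set M : Matrix ι ι (MvPolynomial (Fin n) F) := Matrix.of fun i j ↦ pderiv (e j) (g i)
  refine ⟨fun i v ↦ ∑ k, if e k = v then M.adjugate k i else 0, fun i j ↦ ?_⟩
  have h := congrFun (congrFun (M.mul_adjugate) j) i
  rw [Matrix.mul_apply] at h
  simp only [Finset.sum_mul, ite_mul, zero_mul]
  rw [Finset.sum_comm]
  simp only [Finset.sum_ite_eq, Finset.mem_univ, if_true]
  calc _ = ∑ k, M j k * M.adjugate k i := by
        refine Finset.sum_congr rfl fun k _ ↦ ?_
        rw [mul_comm]; rfl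
    _ = _ := by
        rw [h]; simp [Matrix.smul_apply, Matrix.one_apply, eq_comm]

end PolynomialRing

section Smooth

variable {F : Type} [Field F] {n : ℕ}

theorem exists_pow_eq_of_isSmoothCI {ι : Type} [Fintype ι] [DecidableEq ι]
    {g : ι → MvPolynomial (Fin n) F} (h : IsSmoothCI g) {c : MvPolynomial (Fin n) F}
    (hc : c ∈ idealOfVars (Fin n) F) :
    ∃ N : ℕ, c ^ N ∈ dualIdeal g ⊔ Ideal.span (Set.range g) := by
  change c ∈ Ideal.radical _
  rw [← vanishingIdeal_zeroLocus_eq_radical (K := AlgebraicClosure F), mem_vanishingIdeal_iff]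
  intro x hx
  rw [mem_zeroLocus_iff] at hx
  have hev : ∀ q : MvPolynomial (Fin n) F,
      eval x (map (algebraMap F (AlgebraicClosure F)) q) = aeval x q := fun q ↦ by
    rw [eval_map, aeval_def]
  have hx0 : x = 0 := by
    refine h x (fun i ↦ ?_) (fun hli ↦ ?_)
    · rw [hev]
      exact hx _ (Ideal.mem_sup_right (Ideal.subset_span ⟨i, rfl⟩))
    · obtain ⟨e, he⟩ := exists_submatrix_det_ne_zero _ hli
      apply he
      have h1 := hx _ (Ideal.mem_sup_left (det_mem_dualIdeal g e))
      rw [AlgHom.map_det] at h1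
      rw [← h1]
      congr 1
      ext i j
      simp [hev]
  rw [hx0, aeval_zero, (mem_idealOfVars_iff c).1 hc, map_zero]

theorem isSmoothCI_list {r : ℕ} {g : Fin r → MvPolynomial (Fin n) F} {T : Finset (Fin r)}
    (h : IsSmoothCI (fun i : T ↦ g i)) {c : MvPolynomial (Fin n) F}
    (hc : c ∈ idealOfVars (Fin n) F) :
    ∃ (N : ℕ) (a κ : MvPolynomial (Fin n) F) (d : Fin r → Fin n → MvPolynomial (Fin n) F),
      c ^ N = a + κ ∧ κ ∈ Ideal.span (g '' T) ∧
      ∀ i ∈ T, ∀ j ∈ T, ∑ k, d i k * pderiv k (g j) = if i = j then a else 0 := by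
  obtain ⟨N, hN⟩ := exists_pow_eq_of_isSmoothCI h hc
  obtain ⟨a, ⟨d, hd⟩, κ, hκ, h'⟩ := Submodule.mem_sup.1 hN
  refine ⟨N, a, κ, fun i ↦ if hi : i ∈ T then d ⟨i, hi⟩ else 0, h'.symm, ?_, ?_⟩
  · convert hκ using 2
    ext x; simp
  · intro i hi j hj
    simp only [hi, dif_pos]
    rw [hd ⟨i, hi⟩ ⟨j, hj⟩]
    simp

theorem card_le_height_of_dual {ι : Type} [Fintype ι] [DecidableEq ι]
    {g : ι → MvPolynomial (Fin n) F} {P : Ideal (MvPolynomial (Fin n) F)} [hP : P.IsPrime]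
    (hgP : ∀ i, g i ∈ P) {a : MvPolynomial (Fin n) F} (ha : a ∈ dualIdeal g) (haP : a ∉ P) :
    (Fintype.card ι : ℕ∞) ≤ P.height := by
  obtain ⟨d, hd⟩ := ha
  let A := Localization.AtPrime P
  have hreg : IsRegularLocalRing A := IsRegularRing.isRegularLocalRing_localization P
  have hdim := IsRegularLocalRing.iff_finrank_cotangentSpace A |>.1 hreg
  rw [IsLocalization.AtPrime.ringKrullDim_eq_height P A] at hdim
  have hmem : ∀ q, q ∈ P → algebraMap (MvPolynomial (Fin n) F) A q ∈ IsLocalRing.maximalIdeal A := by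
    intro q hq
    exact (IsLocalization.AtPrime.to_map_mem_maximal_iff A P q).2 hq
  let v : ι → IsLocalRing.CotangentSpace A := fun i ↦
    (IsLocalRing.maximalIdeal A).toCotangent ⟨_, hmem _ (hgP i)⟩
  have hD : ∀ j (x : MvPolynomial (Fin n) F), x ∈ P ^ 2 → ∑ k, d j k * pderiv k x ∈ P := by
    intro j x hx
    rw [pow_two] at hx
    refine Submodule.mul_induction_on hx ?_ ?_
    · intro y hy z hz
      refine P.sum_mem fun k _ ↦ P.mul_mem_left _ ?_
      rw [Derivation.leibniz]
      exact P.add_mem (P.mul_mem_right _ hy) (P.mul_mem_right _ hz)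
    · intro y z hy hz
      simp only [map_add, mul_add, Finset.sum_add_distrib]
      exact P.add_mem hy hz
  have hli : LinearIndependent (IsLocalRing.ResidueField A) v := by
    rw [Fintype.linearIndependent_iff]
    intro c hc
    choose b hb using fun i ↦ IsLocalRing.residue_surjective (c i)
    obtain ⟨s, hs⟩ := IsLocalization.exist_integer_multiples_of_finite P.primeCompl b
    choose y hy using hs
    have hsum : ∑ i, y i * g i ∈ P ∧ ∃ t ∉ P, t * ∑ i, y i * g i ∈ P ^ 2 := by
      refine ⟨P.sum_mem fun i _ ↦ P.mul_mem_left _ (hgP i), ?_⟩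
      have h1 : (∑ i, b i * algebraMap _ A (g i)) ∈ (IsLocalRing.maximalIdeal A) ^ 2 := by
        have h2 : (IsLocalRing.maximalIdeal A).toCotangent
            (∑ i, b i • ⟨_, hmem _ (hgP i)⟩) = 0 := by
          rw [map_sum, ← hc]
          refine Finset.sum_congr rfl fun i _ ↦ ?_
          rw [map_smul, ← hb]
          rfl
        rw [Ideal.toCotangent_eq_zero] at h2
        simpa using h2
      have h3 : algebraMap _ A (∑ i, y i * g i) ∈ (P ^ 2).map (algebraMap _ A) := by
        rw [Ideal.map_pow, Localization.AtPrime.map_eq_maximalIdeal]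
        have := Ideal.mul_mem_left _ (algebraMap _ A (s : MvPolynomial (Fin n) F)) h1
        convert this using 1
        rw [map_sum, Finset.mul_sum]
        refine Finset.sum_congr rfl fun i _ ↦ ?_
        rw [map_mul, hy, Algebra.smul_def, mul_assoc]
      exact (IsLocalization.algebraMap_mem_map_algebraMap_iff P.primeCompl A _ _).1 h3
    obtain ⟨-, t, ht, htm⟩ := hsum
    have hy' : ∀ j, y j ∈ P := by
      intro j
      have h1 := hD j _ htm
      let D : Derivation F (MvPolynomial (Fin n) F) (MvPolynomial (Fin n) F) :=
        ∑ k, d j k • pderiv k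
      have hDapp : ∀ x, ∑ k, d j k * pderiv k x = D x := by
        intro x
        rw [← Derivation.coeFnAddMonoidHom_apply, map_sum, Finset.sum_apply]
        rfl
      have hDg : ∀ i, D (g i) = if j = i then a else 0 := fun i ↦ by rw [← hDapp, hd]
      rw [hDapp, Derivation.leibniz, map_sum] at h1
      simp only [Derivation.leibniz, smul_eq_mul, hDg, Finset.sum_add_distrib, mul_ite, mul_zero,
        Finset.sum_ite_eq, Finset.mem_univ, if_true, mul_add, add_assoc] at h1
      have h4 : t * (y j * a) ∈ P := by
        refine (Ideal.add_mem_iff_left P ?_).1 h1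
        refine P.add_mem (P.mul_mem_left _ (P.sum_mem fun i _ ↦ P.mul_mem_right _ (hgP i)))
          (P.mul_mem_right _ (P.sum_mem fun i _ ↦ P.mul_mem_left _ (hgP i)))
      exact ((hP.mem_or_mem ((hP.mem_or_mem h4).resolve_left ht)).resolve_right haP)
    intro j
    rw [← hb j, IsLocalRing.residue_eq_zero_iff]
    have h5 := hmem _ (hy' j)
    rw [hy, Algebra.smul_def] at h5
    refine ((Ideal.IsPrime.mem_or_mem inferInstance h5).resolve_left ?_)
    rw [IsLocalization.AtPrime.to_map_mem_maximal_iff A P]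
    exact s.2
  have hcard := hli.fintype_card_le_finrank
  have h6 : ((Fintype.card ι : ℕ∞) : WithBot ℕ∞) ≤ (P.height : WithBot ℕ∞) := by
    rw [← hdim]
    exact_mod_cast hcard
  exact_mod_cast h6

end Smooth

section Sequence

variable {F : Type} [Field F] {n r : ℕ} {g : Fin r → MvPolynomial (Fin n) F} {dg : Fin r → ℕ}

attribute [local instance] MvPolynomial.gradedAlgebra

theorem regularMod_span_image (hgh : ∀ i, (g i).IsHomogeneous (dg i))
    (hCI : ∀ s : Finset (Fin r), s.Nonempty → IsSmoothCI (fun i : s ↦ g i))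
    {T : Finset (Fin r)} {i : Fin r} (hi : i ∉ T) (hT : T.card + 1 ≤ n)
    (hd : DepthGE (idealOfVars (Fin n) F) (n - T.card) (Ideal.span (g '' T))) :
    RegularMod (g i) (Ideal.span (g '' T)) := by
  set K := Ideal.span (g '' T) with hKdef
  set m := idealOfVars (Fin n) F with hm
  have hK : K.IsHomogeneous (homogeneousSubmodule (Fin n) F) := isHomogeneous_span_image hgh _
  intro u hu
  rw [mem_iff_homogeneousComponent_mem hK]
  intro e
  by_contra hue
  set w := homogeneousComponent e u
  have hw : w.IsHomogeneous e := homogeneousComponent_isHomogeneous e u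
  have hgw : g i * w ∈ K := by
    rw [← homogeneousComponent_mul_of_isHomogeneous (hgh i)]
    exact homogeneousComponent_mem_of_mem hK hu _
  let L : Ideal (MvPolynomial (Fin n) F) := (K : Ideal _).colon {w}
  have hL : ∀ y, y ∈ L ↔ y * w ∈ K := fun y ↦ Submodule.mem_colon_singleton
  have hLm : L ≤ m := by
    intro y hy
    rw [mem_idealOfVars_iff]
    by_contra hy0
    have h1 := homogeneousComponent_mem_of_mem hK ((hL y).1 hy) e
    rw [mul_comm, ← add_zero e, homogeneousComponent_mul_of_isHomogeneous hw,
      homogeneousComponent_zero, ← constantCoeff_eq] at h1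
    apply hue
    have h2 := K.mul_mem_right (C (constantCoeff y)⁻¹) h1
    rwa [mul_assoc, ← C_mul, mul_inv_cancel₀ hy0, C_1, mul_one] at h2
  obtain ⟨P, hP, hPm⟩ := Ideal.exists_minimalPrimes_le hLm
  obtain ⟨v, hv⟩ := Submodule.exists_eq_colon_of_mem_minimalPrimes (x := w) hP
  have hPp : P.IsPrime := hP.1.1
  have hLP : L ≤ P := hP.1.2
  have hht := hd.height_add_le hPm v fun y ↦ by rw [hv, Submodule.mem_colon_singleton]; rfl
  have hmn : m.height ≤ n := height_idealOfVars_le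
  have hPne : P ≠ m := by
    intro hPm'
    rw [← hPm'] at hht hmn
    have hfin : P.height ≠ ⊤ := fun h ↦ by rw [h] at hmn; simp at hmn
    obtain ⟨a, ha⟩ := ENat.ne_top_iff_exists.1 hfin
    rw [← ha] at hht
    have : a + (n - T.card) ≤ a := by exact_mod_cast hht
    omega
  have hPT : P.height ≤ T.card := by
    have h1 := hht.trans hmn
    have hfin : P.height ≠ ⊤ := fun h ↦ by rw [h] at h1; simp at h1
    obtain ⟨a, ha⟩ := ENat.ne_top_iff_exists.1 hfin
    rw [← ha] at h1 ⊢
    have : a + (n - T.card) ≤ n := by exact_mod_cast h1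
    have : a ≤ T.card := by omega
    exact_mod_cast this
  obtain ⟨c, hcm, hcP⟩ := SetLike.exists_of_lt (lt_of_le_of_ne hPm hPne)
  obtain ⟨N, hN⟩ := exists_pow_eq_of_isSmoothCI (hCI (insert i T) (Finset.insert_nonempty i T)) hcm
  obtain ⟨a, ha, κ, hκ, h'⟩ := Submodule.mem_sup.1 hN
  have hgP : ∀ j : (insert i T : Finset (Fin r)), g j ∈ P := by
    rintro ⟨j, hj⟩
    apply hLP
    rcases Finset.mem_insert.1 hj with rfl | hj
    · exact (hL _).2 hgw
    · exact (hL _).2 (K.mul_mem_right _ (Ideal.subset_span ⟨j, hj, rfl⟩))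
  have hκP : κ ∈ P := by
    refine Ideal.span_le.2 ?_ hκ
    rintro _ ⟨j, rfl⟩
    exact hgP j
  have haP : a ∉ P := fun h ↦ hcP (hPp.mem_of_pow_mem N (h' ▸ P.add_mem h hκP))
  have hcard := (card_le_height_of_dual hgP ha haP).trans hPT
  rw [Fintype.card_coe, Finset.card_insert_of_notMem hi] at hcard
  have : T.card + 1 ≤ T.card := by exact_mod_cast hcard
  omega

theorem depthGE_span_image (hgh : ∀ i, (g i).IsHomogeneous (dg i))
    (hCI : ∀ s : Finset (Fin r), s.Nonempty → IsSmoothCI (fun i : s ↦ g i))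
    (T : Finset (Fin r)) (hT : T.card ≤ n) :
    DepthGE (idealOfVars (Fin n) F) (n - T.card) (Ideal.span (g '' T)) := by
  induction T using Finset.induction_on with
  | empty => simpa using depthGE_idealOfVars_bot
  | insert i T hi ih =>
    rw [Finset.card_insert_of_notMem hi] at hT ⊢
    have hd := ih (by omega)
    have hreg := regularMod_span_image hgh hCI hi hT hd
    rw [Finset.coe_insert, Set.image_insert_eq, Ideal.span_insert, sup_comm]
    by_cases hgi : g i ∈ idealOfVars (Fin n) F
    · refine DepthGE.sup_span_singleton ?_ hgi hreg
      rwa [show n - (T.card + 1) + 1 = n - T.card by omega]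
    · have htop : Ideal.span {g i} = ⊤ := by
        rw [mem_idealOfVars_iff] at hgi
        rw [Ideal.span_singleton_eq_top]
        have hd0 : dg i = 0 := by
          by_contra h0
          apply hgi
          rw [constantCoeff_eq]
          exact (hgh i).coeff_eq_zero (by simpa using Ne.symm h0)
        have h1 := homogeneousComponent_eq_self (hd0 ▸ hgh i)
        rw [homogeneousComponent_zero, ← constantCoeff_eq] at h1
        rw [← h1]
        exact (isUnit_iff_ne_zero.2 hgi).map C
      rw [htop, sup_top_eq]
      exact depthGE_top _ _

theorem regularMod_of_notMem (hgh : ∀ i, (g i).IsHomogeneous (dg i))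
    (hCI : ∀ s : Finset (Fin r), s.Nonempty → IsSmoothCI (fun i : s ↦ g i))
    {T : Finset (Fin r)} {i : Fin r} (hi : i ∉ T) (hT : T.card + 1 ≤ n) :
    RegularMod (g i) (Ideal.span (g '' T)) :=
  regularMod_span_image hgh hCI hi hT (depthGE_span_image hgh hCI T (by omega))

end Sequence

section Koszul

variable {R : Type*} [CommRing R] {M : Type*} [AddCommGroup M] [Module R M]

open ExteriorAlgebra

/-- The projection of the exterior algebra onto the sum of its parts of degree `< d`. -/
noncomputable def truncation (R : Type*) [CommRing R] (M : Type*) [AddCommGroup M] [Module R M]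
    (d : ℕ) : ExteriorAlgebra R M →ₗ[R] ExteriorAlgebra R M :=
  ∑ j ∈ Finset.range d, GradedAlgebra.proj (fun i : ℕ ↦ ⋀[R]^i M) j

theorem ι_mem_one (v : M) : ι R v ∈ (⋀[R]^1 M : Submodule R (ExteriorAlgebra R M)) := by
  simp

theorem truncation_zero (x : ExteriorAlgebra R M) : truncation R M 0 x = 0 := by
  simp [truncation]

theorem truncation_ι_mul (d : ℕ) (v : M) (x : ExteriorAlgebra R M) :
    truncation R M (d + 1) (ι R v * x) = ι R v * truncation R M d x := by
  simp only [truncation, LinearMap.sum_apply, GradedAlgebra.proj_apply, Finset.mul_sum]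
  rw [Finset.sum_range_succ',
    DirectSum.coe_decompose_mul_of_left_mem_of_not_le (fun i : ℕ ↦ ⋀[R]^i M) (ι_mem_one v)
    (by simp), add_zero]
  refine Finset.sum_congr rfl fun j _ ↦ ?_
  rw [add_comm j 1,
    DirectSum.coe_decompose_mul_add_of_left_mem (fun i : ℕ ↦ ⋀[R]^i M) (ι_mem_one v)]

theorem truncation_truncation (d : ℕ) (x : ExteriorAlgebra R M) :
    truncation R M d (truncation R M d x) = truncation R M d x := by
  simp only [truncation, LinearMap.sum_apply, map_sum]
  rw [Finset.sum_comm]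
  refine Finset.sum_congr rfl fun j hj ↦ ?_
  simp only [GradedAlgebra.proj_apply]
  rw [Finset.sum_eq_single j]
  · rw [DirectSum.decompose_of_mem_same (fun i : ℕ ↦ ⋀[R]^i M) (SetLike.coe_mem _)]
  · intro i _ hij
    rw [DirectSum.decompose_of_mem_ne (fun i : ℕ ↦ ⋀[R]^i M) (SetLike.coe_mem _) hij]
  · exact fun h ↦ (h hj).elim

theorem truncation_of_mem {k d : ℕ} (hkd : k < d) {x : ExteriorAlgebra R M}
    (hx : x ∈ (⋀[R]^k M : Submodule R (ExteriorAlgebra R M))) : truncation R M d x = x := by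
  simp only [truncation, LinearMap.sum_apply, GradedAlgebra.proj_apply]
  rw [Finset.sum_eq_single k]
  · rw [DirectSum.decompose_of_mem_same (fun i : ℕ ↦ ⋀[R]^i M) hx]
  · intro i _ hij
    rw [DirectSum.decompose_of_mem_ne (fun i : ℕ ↦ ⋀[R]^i M) hx (Ne.symm hij)]
  · exact fun h ↦ (h (Finset.mem_range.2 hkd)).elim

theorem ι_mul_ι_mul_self (v : M) (x : ExteriorAlgebra R M) : ι R v * (ι R v * x) = 0 := by
  rw [← mul_assoc, ι_sq_zero, zero_mul]

theorem ι_mul_ι_mul_swap (v w : M) (x : ExteriorAlgebra R M) :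
    ι R v * (ι R w * x) = -(ι R w * (ι R v * x)) := by
  rw [← mul_assoc, ← mul_assoc, ← neg_mul, eq_neg_of_add_eq_zero_left (ι_add_mul_swap v w)]

variable {α : Type*} (K : Ideal R) (w : α → M)

/-- The wedge product of the vectors `w i` for `i` in a list. -/
noncomputable def wedgeList (l : List α) : ExteriorAlgebra R M := (l.map fun i ↦ ι R (w i)).prod

@[simp] theorem wedgeList_nil : wedgeList (R := R) w [] = 1 := rfl

@[simp] theorem wedgeList_cons (i : α) (l : List α) :
    wedgeList (R := R) w (i :: l) = ι R (w i) * wedgeList w l := by simp [wedgeList]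

theorem wedgeList_mul_ι (l : List α) (v : M) :
    wedgeList w l * ι R v = (-1 : R) ^ l.length • (ι R v * wedgeList w l) := by
  induction l with
  | nil => simp
  | cons i l ih =>
    rw [wedgeList_cons, mul_assoc, ih, mul_smul_comm, ι_mul_ι_mul_swap, List.length_cons, pow_succ]
    simp

theorem wedgeList_mul_ι_of_mem {l : List α} {i : α} (hi : i ∈ l) :
    wedgeList w l * ι R (w i) = 0 := by
  induction l with
  | nil => simp at hi
  | cons j l ih =>
    rw [wedgeList_cons]
    rcases List.mem_cons.1 hi with rfl | hi
    · rw [mul_assoc, wedgeList_mul_ι, mul_smul_comm, ι_mul_ι_mul_self, smul_zero]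
    · rw [mul_assoc, ih hi, mul_zero]

/-- The submodule of the exterior algebra generated by the multiples of the ideal `K` and the
multiples of the vectors `w i` for `i` in a list. -/
noncomputable def vectorIdeal (l : List α) : Submodule R (ExteriorAlgebra R M) :=
  K • ⊤ ⊔ ⨆ i ∈ l, LinearMap.range (LinearMap.mulLeft R (ι R (w i)))

variable {K w}

theorem vectorIdeal_induction {l : List α} {N : Submodule R (ExteriorAlgebra R M)}
    (h0 : ∀ c ∈ K, ∀ x, c • x ∈ N) (h1 : ∀ i ∈ l, ∀ x, ι R (w i) * x ∈ N) :
    vectorIdeal K w l ≤ N := by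
  refine sup_le (Submodule.smul_le.2 fun c hc x _ ↦ h0 c hc x) (iSup₂_le fun i hi ↦ ?_)
  rintro _ ⟨x, rfl⟩
  exact h1 i hi x

theorem smul_mem_vectorIdeal {l : List α} {c : R} (hc : c ∈ K) (x : ExteriorAlgebra R M) :
    c • x ∈ vectorIdeal K w l :=
  Submodule.mem_sup_left (Submodule.smul_mem_smul hc Submodule.mem_top)

theorem ι_mul_mem_vectorIdeal {l : List α} {i : α} (hi : i ∈ l) (x : ExteriorAlgebra R M) :
    ι R (w i) * x ∈ vectorIdeal K w l :=
  Submodule.mem_sup_right (Submodule.mem_iSup_of_mem i (Submodule.mem_iSup_of_mem hi ⟨x, rfl⟩))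

theorem vectorIdeal_mono {K' : Ideal R} {l l' : List α} (hK : K ≤ K') (hl : l ⊆ l') :
    vectorIdeal K w l ≤ vectorIdeal K' w l' :=
  vectorIdeal_induction (fun _ hc x ↦ smul_mem_vectorIdeal (hK hc) x)
    fun _ hi x ↦ ι_mul_mem_vectorIdeal (hl hi) x

@[simp] theorem vectorIdeal_nil : vectorIdeal K w ([] : List α) = K • ⊤ := by
  simp [vectorIdeal]

theorem ι_mul_mem {l : List α} (v : M) {x : ExteriorAlgebra R M} (hx : x ∈ vectorIdeal K w l) :
    ι R v * x ∈ vectorIdeal K w l := by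
  suffices h : vectorIdeal K w l ≤ (vectorIdeal K w l).comap (LinearMap.mulLeft R (ι R v)) from
    h hx
  refine vectorIdeal_induction (fun c hc x ↦ ?_) fun i hi x ↦ ?_
  · simpa using smul_mem_vectorIdeal hc _
  · simpa [ι_mul_ι_mul_swap v] using ι_mul_mem_vectorIdeal hi _

theorem truncation_mem {l : List α} (d : ℕ) {x : ExteriorAlgebra R M}
    (hx : x ∈ vectorIdeal K w l) : truncation R M d x ∈ vectorIdeal K w l := by
  suffices h : vectorIdeal K w l ≤ (vectorIdeal K w l).comap (truncation R M d) from h hx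
  refine vectorIdeal_induction (fun c hc x ↦ ?_) fun i hi x ↦ ?_
  · simpa using smul_mem_vectorIdeal hc _
  · rw [Submodule.mem_comap]
    cases d with
    | zero => rw [truncation_zero]; exact zero_mem _
    | succ d => rw [truncation_ι_mul]; exact ι_mul_mem_vectorIdeal hi _

theorem mem_vectorIdeal_cons {i : α} {l : List α} {x : ExteriorAlgebra R M} :
    x ∈ vectorIdeal K w (i :: l) ↔ ∃ y, x - ι R (w i) * y ∈ vectorIdeal K w l := by
  constructor
  · have h : vectorIdeal K w (i :: l) ≤
        LinearMap.range (LinearMap.mulLeft R (ι R (w i))) ⊔ vectorIdeal K w l := by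
      refine vectorIdeal_induction
        (fun c hc x ↦ Submodule.mem_sup_right (smul_mem_vectorIdeal hc x)) fun j hj x ↦ ?_
      rcases List.mem_cons.1 hj with rfl | hj
      · exact Submodule.mem_sup_left ⟨x, rfl⟩
      · exact Submodule.mem_sup_right (ι_mul_mem_vectorIdeal hj x)
    intro hx
    obtain ⟨_, ⟨y, rfl⟩, z, hz, rfl⟩ := Submodule.mem_sup.1 (h hx)
    exact ⟨y, by simpa using hz⟩
  · rintro ⟨y, hy⟩
    have := add_mem (vectorIdeal_mono le_rfl (List.subset_cons_self i l) hy)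
      (ι_mul_mem_vectorIdeal (List.mem_cons_self (a := i) (l := l)) y)
    rwa [sub_add_cancel] at this

theorem mem_vectorIdeal_sup_span {l : List α} {b : R} {x : ExteriorAlgebra R M} :
    x ∈ vectorIdeal (K ⊔ Ideal.span {b}) w l ↔ ∃ y, x - b • y ∈ vectorIdeal K w l := by
  constructor
  · have h : vectorIdeal (K ⊔ Ideal.span {b}) w l ≤
        LinearMap.range (LinearMap.lsmul R (ExteriorAlgebra R M) b) ⊔ vectorIdeal K w l := by
      refine vectorIdeal_induction (fun c hc x ↦ ?_)
        fun j hj x ↦ Submodule.mem_sup_right (ι_mul_mem_vectorIdeal hj x)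
      obtain ⟨v, hv⟩ := mem_sup_span_singleton_iff.1 hc
      rw [← sub_add_cancel c (b * v), add_smul]
      exact add_mem (Submodule.mem_sup_right (smul_mem_vectorIdeal hv x))
        (Submodule.mem_sup_left ⟨v • x, by simp [mul_smul, smul_comm v b]⟩)
    intro hx
    obtain ⟨_, ⟨y, rfl⟩, z, hz, rfl⟩ := Submodule.mem_sup.1 (h hx)
    exact ⟨y, by simpa using hz⟩
  · rintro ⟨y, hy⟩
    have := add_mem (vectorIdeal_mono (K' := K ⊔ Ideal.span {b}) le_sup_left
      (List.Subset.refl l) hy) (smul_mem_vectorIdeal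
        (Ideal.mem_sup_right (Ideal.mem_span_singleton_self b)) y)
    rwa [sub_add_cancel] at this

theorem ι_mul_mem_of_mem_cons {i : α} {l : List α} {x : ExteriorAlgebra R M}
    (hx : x ∈ vectorIdeal K w (i :: l)) : ι R (w i) * x ∈ vectorIdeal K w l := by
  obtain ⟨y, hy⟩ := mem_vectorIdeal_cons.1 hx
  have := ι_mul_mem (w i) hy
  rwa [mul_sub, ι_mul_ι_mul_self, sub_zero] at this

theorem wedgeList_mul_mem {l : List α} {x : ExteriorAlgebra R M}
    (hx : x ∈ vectorIdeal K w l) : wedgeList w l * x ∈ K • (⊤ : Submodule R _) := by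
  suffices h : vectorIdeal K w l ≤
    (K • (⊤ : Submodule R _)).comap (LinearMap.mulLeft R (wedgeList w l)) from h hx
  refine vectorIdeal_induction (fun c hc x ↦ ?_) fun i hi x ↦ ?_
  · simpa using Submodule.smul_mem_smul hc Submodule.mem_top
  · simp [← mul_assoc, wedgeList_mul_ι_of_mem w hi]

open CliffordAlgebra in
theorem ι_mul_contractLeft_wedgeList_mul {d : Module.Dual R M} {l : List α}
    (hd : ∀ j ∈ l, d (w j) = 0) (v : M) (x : ExteriorAlgebra R M) :
    ι R v * contractLeft (Q := (0 : QuadraticForm R M)) d (wedgeList w l * x) =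
      wedgeList w l * (ι R v * contractLeft (Q := (0 : QuadraticForm R M)) d x) := by
  induction l generalizing v with
  | nil => simp
  | cons j l ih =>
    have h1 : contractLeft (Q := (0 : QuadraticForm R M)) d (wedgeList w (j :: l) * x) =
        - (ι R (w j) * contractLeft (Q := (0 : QuadraticForm R M)) d (wedgeList w l * x)) := by
      rw [wedgeList_cons, mul_assoc]
      erw [contractLeft_ι_mul]
      rw [hd j (by simp), zero_smul, zero_sub]
    rw [h1, mul_neg, ι_mul_ι_mul_swap, neg_neg, ih (fun j hj ↦ hd j (by simp [hj])),
      wedgeList_cons, mul_assoc]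

open CliffordAlgebra in
theorem pow_smul_mem_vectorIdeal [DecidableEq α] {d : α → Module.Dual R M} {a : R} {l : List α}
    (hl : l.Nodup) (hd : ∀ i ∈ l, ∀ j ∈ l, d i (w j) = if i = j then a else 0)
    {x : ExteriorAlgebra R M} (hx : wedgeList w l * x ∈ K • (⊤ : Submodule R _)) :
    a ^ l.length • x ∈ vectorIdeal K w l := by
  induction l generalizing x with
  | nil => simpa using hx
  | cons i l ih =>
    obtain ⟨hil, hl⟩ := List.nodup_cons.1 hl
    set D := contractLeft (Q := (0 : QuadraticForm R M)) (d i) with hD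
    have hstab : ∀ y ∈ K • (⊤ : Submodule R (ExteriorAlgebra R M)),
        D y ∈ K • (⊤ : Submodule R (ExteriorAlgebra R M)) := by
      intro y hy
      have : K • (⊤ : Submodule R (ExteriorAlgebra R M)) ≤
          (K • (⊤ : Submodule R (ExteriorAlgebra R M))).comap D :=
        Submodule.smul_le.2 fun c hc z _ ↦ by
          simpa using Submodule.smul_mem_smul hc Submodule.mem_top
      exact this hy
    have h1 : a • (wedgeList w l * x) - ι R (w i) * D (wedgeList w l * x) ∈
        K • (⊤ : Submodule R (ExteriorAlgebra R M)) := by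
      have := hstab _ hx
      rw [wedgeList_cons, mul_assoc] at this
      erw [contractLeft_ι_mul] at this
      rwa [hd i (by simp) i (by simp), if_pos rfl] at this
    rw [ι_mul_contractLeft_wedgeList_mul (fun j hj ↦ by
      rw [hd i (by simp) j (by simp [hj]), if_neg (by rintro rfl; exact hil hj)]),
      ← mul_smul_comm, ← mul_sub] at h1
    have h2 := ih hl (fun i hi j hj ↦ hd i (by simp [hi]) j (by simp [hj])) h1
    refine mem_vectorIdeal_cons.2 ⟨a ^ l.length • D x, ?_⟩
    rwa [smul_sub, smul_smul, ← pow_succ, ← mul_smul_comm] at h2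

theorem mem_smul_top_iff_repr {κ : Type*} {E : Type*} [AddCommGroup E] [Module R E]
    (b : Module.Basis κ R E) {x : E} :
    x ∈ K • (⊤ : Submodule R E) ↔ ∀ i, b.repr x i ∈ K := by
  constructor
  · intro hx i
    have : K • (⊤ : Submodule R E) ≤ Submodule.comap (b.coord i) K :=
      Submodule.smul_le.2 fun c hc z _ ↦ by simpa using K.mul_mem_right _ hc
    exact this hx
  · intro h
    rw [← b.linearCombination_repr x, Finsupp.linearCombination_apply]
    exact Submodule.sum_mem _ fun i _ ↦ Submodule.smul_mem_smul (h i) trivial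

theorem RegularMod.mem_smul_top {κ : Type*} {E : Type*} [AddCommGroup E] [Module R E]
    (b : Module.Basis κ R E) {c : R} (hc : RegularMod c K) {x : E}
    (hx : c • x ∈ K • (⊤ : Submodule R E)) : x ∈ K • (⊤ : Submodule R E) := by
  rw [mem_smul_top_iff_repr b] at hx ⊢
  exact fun i ↦ hc _ (by simpa using hx i)

end Koszul

section Saito

variable {R : Type*} [CommRing R] {M : Type*} [AddCommGroup M] [Module R M]
  {α : Type*} {K : Ideal R} {w : α → M}

open ExteriorAlgebra

theorem exists_truncation_of_mem_cons {d : ℕ} {i : α} {l : List α} {x : ExteriorAlgebra R M}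
    (hx : x ∈ vectorIdeal K w (i :: l)) (hd : truncation R M (d + 1) x = x) :
    ∃ y, truncation R M d y = y ∧ x - ι R (w i) * y ∈ vectorIdeal K w l := by
  obtain ⟨y, hy⟩ := mem_vectorIdeal_cons.1 hx
  refine ⟨truncation R M d y, truncation_truncation d y, ?_⟩
  have := truncation_mem (d + 1) hy
  rwa [map_sub, hd, truncation_ι_mul] at this

theorem mem_of_smul_mem {κ : Type*} (B : Module.Basis κ R (ExteriorAlgebra R M)) {b : R}
    (hb : RegularMod b K) {d : ℕ} {L : List α}
    (hS : ∀ l : List α, l.Nodup → l ⊆ L → ∀ x, truncation R M d x = x →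
      wedgeList w l * x ∈ (K ⊔ Ideal.span {b}) • (⊤ : Submodule R (ExteriorAlgebra R M)) →
      x ∈ vectorIdeal (K ⊔ Ideal.span {b}) w l)
    {l : List α} (hl : l.Nodup) (hlL : l ⊆ L) {x : ExteriorAlgebra R M}
    (hx : truncation R M (d + 1) x = x) (hbx : b • x ∈ vectorIdeal K w l) :
    x ∈ vectorIdeal K w l := by
  induction l generalizing x with
  | nil =>
    rw [vectorIdeal_nil] at hbx ⊢
    exact hb.mem_smul_top B hbx
  | cons i l ih =>
    obtain ⟨hil, hl'⟩ := List.nodup_cons.1 hl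
    obtain ⟨y, hy, hxy⟩ := exists_truncation_of_mem_cons hbx (by rw [map_smul, hx])
    have h1 : wedgeList w (i :: l) * y ∈
        (K ⊔ Ideal.span {b}) • (⊤ : Submodule R (ExteriorAlgebra R M)) := by
      have h2 : wedgeList w l * (b • x) - wedgeList w l * (b • x - ι R (w i) * y) ∈
          (K ⊔ Ideal.span {b}) • (⊤ : Submodule R (ExteriorAlgebra R M)) := by
        refine sub_mem ?_ (Submodule.smul_mono_left le_sup_left (wedgeList_mul_mem hxy))
        rw [mul_smul_comm]
        exact Submodule.smul_mem_smul
          (Ideal.mem_sup_right (Ideal.mem_span_singleton_self b)) Submodule.mem_top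
      rw [← mul_sub, sub_sub_cancel, ← mul_assoc, wedgeList_mul_ι, ← wedgeList_cons,
        smul_mul_assoc] at h2
      have h3 := Submodule.smul_mem _ ((-1 : R) ^ l.length) h2
      rwa [smul_smul, ← mul_pow, neg_one_mul, neg_neg, one_pow, one_smul] at h3
    have h4 := hS _ hl hlL y hy h1
    obtain ⟨z, hz⟩ := mem_vectorIdeal_sup_span.1 h4
    have h5 : y - b • truncation R M d z ∈ vectorIdeal K w (i :: l) := by
      have := truncation_mem d hz
      rwa [map_sub, map_smul, hy] at this
    refine mem_vectorIdeal_cons.2 ⟨truncation R M d z, ?_⟩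
    refine ih hl' (fun j hj ↦ hlL (List.mem_cons_of_mem i hj)) ?_ ?_
    · rw [map_sub, hx, truncation_ι_mul, truncation_truncation]
    · have := add_mem hxy (ι_mul_mem_of_mem_cons h5)
      rwa [mul_sub, sub_add_sub_cancel, mul_smul_comm, ← smul_sub] at this

/-- A form of small degree whose product with the `w i` vanishes modulo an ideal of large depth
belongs to the ideal of forms generated by the `w i`. -/
theorem mem_vectorIdeal_of_wedgeList_mul_mem [IsNoetherianRing R] [DecidableEq α]
    {κ : Type*} (B : Module.Basis κ R (ExteriorAlgebra R M))
    {I K₀ : Ideal R} {L : List α}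
    (hC : ∀ c ∈ I, ∃ (N : ℕ) (a k : R) (D : α → Module.Dual R M), c ^ N = a + k ∧ k ∈ K₀ ∧
      ∀ i ∈ L, ∀ j ∈ L, D i (w j) = if i = j then a else 0)
    (d : ℕ) (hK : K₀ ≤ K) (hdepth : DepthGE I d K) {l : List α} (hl : l.Nodup) (hlL : l ⊆ L)
    {x : ExteriorAlgebra R M} (hx : truncation R M d x = x)
    (hlx : wedgeList w l * x ∈ K • (⊤ : Submodule R (ExteriorAlgebra R M))) :
    x ∈ vectorIdeal K w l := by
  induction d generalizing K l x with
  | zero => rw [← hx, truncation_zero]; exact zero_mem _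
  | succ d ih =>
    obtain ⟨c, hcI, hc, -⟩ := id hdepth
    obtain ⟨N, a, k, D, hak, hk, hD⟩ := hC c hcI
    set b := c ^ (N * l.length + 1) with hbdef
    have hb : RegularMod b K := hc.pow _
    have hbI : b ∈ I := by
      rw [hbdef, pow_succ]; exact I.mul_mem_left _ hcI
    refine mem_of_smul_mem B hb (fun l' hl' hlL' y hy hly ↦ ih (hK.trans le_sup_left)
      (hdepth.sup_span_singleton hbI hb) hl' hlL' hy hly) hl hlL hx ?_
    have h1 : a ^ l.length • x ∈ vectorIdeal K w l :=
      pow_smul_mem_vectorIdeal hl (fun i hi j hj ↦ hD i (hlL hi) j (hlL hj)) hlx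
    have h2 : (c ^ N) ^ l.length - a ^ l.length ∈ K := by
      refine K.mem_of_dvd (sub_dvd_pow_sub_pow _ _ _) ?_
      rw [hak, add_sub_cancel_left]
      exact hK hk
    have h3 := Submodule.smul_mem _ c (add_mem h1 (smul_mem_vectorIdeal h2 x))
    rwa [← add_smul, add_sub_cancel, smul_smul, ← pow_mul, ← pow_succ'] at h3

end Saito

section Filtration

variable {R : Type*} [CommRing R] {M : Type*} [AddCommGroup M] [Module R M]
  {α : Type*} {g : α → R} {w : α → M}

open ExteriorAlgebra

/-- The ideal generated by the `g i` for `i` in a list. -/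
def listIdeal (g : α → R) (l : List α) : Ideal R := Ideal.span (g '' {i | i ∈ l})

theorem listIdeal_mono {l l' : List α} (h : l ⊆ l') : listIdeal g l ≤ listIdeal g l' :=
  Ideal.span_mono (Set.image_mono fun _ hi ↦ h hi)

theorem mem_listIdeal {l : List α} {i : α} (hi : i ∈ l) : g i ∈ listIdeal g l :=
  Ideal.subset_span ⟨i, hi, rfl⟩

theorem listIdeal_cons (i : α) (l : List α) :
    listIdeal g (i :: l) = listIdeal g l ⊔ Ideal.span {g i} := by
  rw [listIdeal, listIdeal, ← Ideal.span_union, ← Set.image_singleton, ← Set.image_union]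
  congr 2
  ext j
  simp

/-- The forms which are combinations of the products over `i` in the list of either `g i` or
`w i`. -/
noncomputable def mixedSubmodule (g : α → R) (w : α → M) :
    List α → Submodule R (ExteriorAlgebra R M)
  | [] => ⊤
  | i :: l => (mixedSubmodule g w l).map (LinearMap.lsmul R (ExteriorAlgebra R M) (g i)) ⊔
      (mixedSubmodule g w l).map (LinearMap.mulLeft R (ι R (w i)))

theorem mem_mixedSubmodule_cons {i : α} {l : List α} {x : ExteriorAlgebra R M} :
    x ∈ mixedSubmodule g w (i :: l) ↔ ∃ y ∈ mixedSubmodule g w l, ∃ z ∈ mixedSubmodule g w l,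
      g i • y + ι R (w i) * z = x := by
  simp only [mixedSubmodule, Submodule.mem_sup, Submodule.mem_map, exists_exists_and_eq_and]
  rfl

theorem mixedSubmodule_le {l m : List α} {i : α} (hi : i ∈ l) (him : i ∈ m) :
    mixedSubmodule g w l ≤ vectorIdeal (listIdeal g m) w m := by
  induction l with
  | nil => simp at hi
  | cons j l ih =>
    intro x hx
    obtain ⟨y, hy, z, hz, rfl⟩ := mem_mixedSubmodule_cons.1 hx
    rcases List.mem_cons.1 hi with rfl | hi
    · exact add_mem (smul_mem_vectorIdeal (mem_listIdeal him) y) (ι_mul_mem_vectorIdeal him z)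
    · exact add_mem (Submodule.smul_mem _ _ (ih hi hy)) (ι_mul_mem _ (ih hi hz))

theorem truncation_mem_mixedSubmodule (d : ℕ) {l : List α} {x : ExteriorAlgebra R M}
    (hx : x ∈ mixedSubmodule g w l) : truncation R M d x ∈ mixedSubmodule g w l := by
  induction l generalizing d x with
  | nil => trivial
  | cons i l ih =>
    cases d with
    | zero => rw [truncation_zero]; exact zero_mem _
    | succ d =>
      obtain ⟨y, hy, z, hz, rfl⟩ := mem_mixedSubmodule_cons.1 hx
      rw [map_add, map_smul, truncation_ι_mul]
      exact mem_mixedSubmodule_cons.2 ⟨_, ih _ hy, _, ih _ hz, rfl⟩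

theorem mem_vectorIdeal_listIdeal_cons {i : α} {l : List α} {x : ExteriorAlgebra R M} :
    x ∈ vectorIdeal (listIdeal g (i :: l)) w (i :: l) ↔
      ∃ y z, x - g i • y - ι R (w i) * z ∈ vectorIdeal (listIdeal g l) w l := by
  rw [listIdeal_cons, mem_vectorIdeal_sup_span]
  refine exists_congr fun y ↦ ?_
  rw [mem_vectorIdeal_cons]

theorem mem_sup_mixedSubmodule {κ : Type*} (B : Module.Basis κ R (ExteriorAlgebra R M)) {n : ℕ}
    (hreg : ∀ (i : α) (l : List α), (i :: l).Nodup → l.length + 1 ≤ n →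
      RegularMod (g i) (listIdeal g l))
    (hS : ∀ (l : List α) (d : ℕ) (x : ExteriorAlgebra R M), l ≠ [] → l.Nodup → l.length + d ≤ n →
      truncation R M d x = x →
      wedgeList w l * x ∈ listIdeal g l • (⊤ : Submodule R (ExteriorAlgebra R M)) →
      x ∈ vectorIdeal (listIdeal g l) w l)
    {S T : List α} {d : ℕ} (hST : (S ++ T).Nodup) {x : ExteriorAlgebra R M}
    (hx : truncation R M d x = x) (hn : T.length + d + 1 ≤ n)
    (hxi : ∀ i ∈ S, x ∈ vectorIdeal (listIdeal g (i :: T)) w (i :: T)) :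
    x ∈ vectorIdeal (listIdeal g T) w T ⊔ mixedSubmodule g w S := by
  induction S generalizing T d x with
  | nil => exact Submodule.mem_sup_right trivial
  | cons r S ih =>
    cases d with
    | zero => rw [← hx, truncation_zero]; exact zero_mem _
    | succ d =>
      obtain ⟨hrST, hST'⟩ := List.nodup_cons.1 hST
      change r ∉ S ++ T at hrST
      change (S ++ T).Nodup at hST'
      have hrT : r ∉ T := fun h ↦ hrST (by simp [h])
      have hrS : r ∉ S := fun h ↦ hrST (by simp [h])
      obtain ⟨y, z₀, hyz₀⟩ := mem_vectorIdeal_listIdeal_cons.1 (hxi r (by simp))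
      obtain ⟨z, hz, hyz⟩ : ∃ z, truncation R M d z = z ∧
          x - g r • truncation R M (d + 1) y - ι R (w r) * z ∈
            vectorIdeal (listIdeal g T) w T := by
        refine ⟨truncation R M d z₀, truncation_truncation _ _, ?_⟩
        have := truncation_mem (d + 1) hyz₀
        rwa [map_sub, map_sub, hx, map_smul, truncation_ι_mul] at this
      have hnodup : ∀ i ∈ S, (i :: T).Nodup ∧ (r :: i :: T).Nodup := by
        intro i hi
        have h1 : (i :: T).Nodup := by
          rw [List.nodup_append'] at hST'
          exact List.nodup_cons.2 ⟨fun h ↦ hST'.2.2 hi h, hST'.2.1⟩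
        refine ⟨h1, List.nodup_cons.2 ⟨?_, h1⟩⟩
        rw [List.mem_cons, not_or]
        exact ⟨fun h ↦ hrS (h ▸ hi), hrT⟩
      have hTi : ∀ i, vectorIdeal (listIdeal g T) w T ≤
          vectorIdeal (listIdeal g (i :: T)) w (i :: T) := fun i ↦
        vectorIdeal_mono (listIdeal_mono (List.subset_cons_self i T)) (List.subset_cons_self i T)
      have hzi : ∀ i ∈ S, z ∈ vectorIdeal (listIdeal g (i :: r :: T)) w (i :: r :: T) := by
        intro i hi
        have hsub : (r :: i :: T) ⊆ (i :: r :: T) := by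
          intro j; simp only [List.mem_cons]; tauto
        refine vectorIdeal_mono (listIdeal_mono hsub) hsub ?_
        refine hS _ d z (by simp) (hnodup i hi).2 (by simp; omega) hz ?_
        have h1 := sub_mem (hxi i (by simp [hi])) (hTi i hyz)
        rw [sub_sub, sub_sub_cancel] at h1
        have h2 := Submodule.smul_mono_left (listIdeal_mono (g := g)
          (List.subset_cons_self r (i :: T))) (wedgeList_mul_mem h1)
        have h3 : wedgeList w (i :: T) * g r • truncation R M (d + 1) y ∈
            listIdeal g (r :: i :: T) • (⊤ : Submodule R (ExteriorAlgebra R M)) := by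
          rw [mul_smul_comm]
          exact Submodule.smul_mem_smul (mem_listIdeal (by simp)) Submodule.mem_top
        have h4 := sub_mem h2 h3
        rw [mul_add, add_sub_cancel_left, ← mul_assoc, wedgeList_mul_ι, ← wedgeList_cons,
          smul_mul_assoc] at h4
        have h5 := Submodule.smul_mem _ ((-1 : R) ^ (i :: T).length) h4
        rwa [smul_smul, ← mul_pow, neg_one_mul, neg_neg, one_pow, one_smul] at h5
      have hST'' : (S ++ r :: T).Nodup :=
        (List.perm_middle (a := r) (l₁ := S) (l₂ := T)).nodup_iff.2 hST
      obtain ⟨u, hu, v, hv, huv⟩ := Submodule.mem_sup.1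
        (ih hST'' hz (by simp; omega) hzi)
      obtain ⟨s, t, hst⟩ := mem_vectorIdeal_listIdeal_cons.1 hu
      set y₁ := truncation R M (d + 1) (truncation R M (d + 1) y + ι R (w r) * s) with hy₁
      set v₁ := truncation R M d v with hv₁
      have hv₁S : v₁ ∈ mixedSubmodule g w S := truncation_mem_mixedSubmodule d hv
      have hxy₁ : x - g r • y₁ - ι R (w r) * v₁ ∈ vectorIdeal (listIdeal g T) w T := by
        have h1 := add_mem hyz (ι_mul_mem (w r) hst)
        have h2 := truncation_mem (d + 1) h1
        have h3 : x - g r • truncation R M (d + 1) y - ι R (w r) * z +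
            ι R (w r) * (u - g r • s - ι R (w r) * t) =
            x - g r • (truncation R M (d + 1) y + ι R (w r) * s) - ι R (w r) * v := by
          rw [mul_sub, ι_mul_ι_mul_self, sub_zero, ← huv, mul_sub, mul_add, mul_smul_comm, smul_add]
          abel
        rwa [h3, map_sub, map_sub, hx, map_smul, truncation_ι_mul] at h2
      have hy₁i : ∀ i ∈ S, y₁ ∈ vectorIdeal (listIdeal g (i :: T)) w (i :: T) := by
        intro i hi
        refine hS _ (d + 1) y₁ (by simp) (hnodup i hi).1 (by simp; omega)
          (truncation_truncation _ _) ?_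
        refine RegularMod.mem_smul_top B (hreg r (i :: T) (hnodup i hi).2 (by simp; omega)) ?_
        rw [← mul_smul_comm]
        refine wedgeList_mul_mem ?_
        have h1 := sub_mem (sub_mem (hxi i (by simp [hi])) (hTi i hxy₁))
          (ι_mul_mem (w r) (mixedSubmodule_le hi (by simp) hv₁S))
        convert h1 using 1
        abel
      obtain ⟨u', hu', v', hv', huv'⟩ := Submodule.mem_sup.1
        (ih hST' (truncation_truncation _ _) hn hy₁i)
      refine Submodule.mem_sup.2 ⟨_, add_mem hxy₁ (Submodule.smul_mem _ (g r) hu'), _,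
        mem_mixedSubmodule_cons.2 ⟨v', hv', v₁, hv₁S, rfl⟩, ?_⟩
      have h1 : g r • y₁ = g r • u' + g r • v' := by rw [← smul_add]; exact congrArg _ huv'.symm
      rw [h1]
      abel

end Filtration

section Concrete

variable {F : Type} [Field F] {n r : ℕ} {g : Fin r → MvPolynomial (Fin n) F} {dg : Fin r → ℕ}

/-- The gradients of a family of polynomials. -/
noncomputable def pderivVec (g : Fin r → MvPolynomial (Fin n) F) (i : Fin r) :
    Fin n → MvPolynomial (Fin n) F := fun j ↦ pderiv j (g i)

theorem listIdeal_eq_span_image (l : List (Fin r)) :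
    listIdeal g l = Ideal.span (g '' (l.toFinset : Set (Fin r))) := by
  rw [listIdeal, List.coe_toFinset]

theorem regularMod_listIdeal (hgh : ∀ i, (g i).IsHomogeneous (dg i))
    (hCI : ∀ s : Finset (Fin r), s.Nonempty → IsSmoothCI (fun i : s ↦ g i))
    (i : Fin r) (l : List (Fin r)) (hl : (i :: l).Nodup) (hn : l.length + 1 ≤ n) :
    RegularMod (g i) (listIdeal g l) := by
  obtain ⟨hil, hl'⟩ := List.nodup_cons.1 hl
  rw [listIdeal_eq_span_image]
  refine regularMod_of_notMem hgh hCI (by simpa using hil) ?_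
  rwa [List.toFinset_card_of_nodup hl']

/-- The basis of the differential forms given by the products of the `dx_i`. -/
noncomputable def formBasis (F : Type) [Field F] (n : ℕ) :
    Module.Basis (Finset (Fin n)) (MvPolynomial (Fin n) F)
      (ExteriorAlgebra (MvPolynomial (Fin n) F) (Fin n → MvPolynomial (Fin n) F)) :=
  (Pi.basisFun (MvPolynomial (Fin n) F) (Fin n)).ExteriorAlgebra

theorem mem_vectorIdeal_pderivVec (hgh : ∀ i, (g i).IsHomogeneous (dg i))
    (hCI : ∀ s : Finset (Fin r), s.Nonempty → IsSmoothCI (fun i : s ↦ g i))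
    (l : List (Fin r)) (d : ℕ)
    (x : ExteriorAlgebra (MvPolynomial (Fin n) F) (Fin n → MvPolynomial (Fin n) F))
    (hl : l ≠ []) (hl' : l.Nodup) (hn : l.length + d ≤ n)
    (hx : truncation _ _ d x = x)
    (hlx : wedgeList (pderivVec g) l * x ∈ listIdeal g l • (⊤ : Submodule (MvPolynomial (Fin n) F)
      (ExteriorAlgebra (MvPolynomial (Fin n) F) (Fin n → MvPolynomial (Fin n) F)))) :
    x ∈ vectorIdeal (listIdeal g l) (pderivVec g) l := by
  have hcard := List.toFinset_card_of_nodup hl'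
  refine mem_vectorIdeal_of_wedgeList_mul_mem (formBasis F n) (I := idealOfVars (Fin n) F)
    (K₀ := listIdeal g l) (L := l) ?_ d le_rfl ?_ hl' (List.Subset.refl l) hx hlx
  · intro c hc
    have hne : l.toFinset.Nonempty := by
      rwa [List.toFinset_nonempty_iff]
    obtain ⟨N, a, κ, D, h1, h2, h3⟩ := isSmoothCI_list (hCI _ hne) hc
    refine ⟨N, a, κ, fun i ↦ Fintype.linearCombination _ (D i), h1,
      by rwa [listIdeal_eq_span_image], fun i hi j hj ↦ ?_⟩
    rw [← h3 i (by simpa using hi) j (by simpa using hj)]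
    simp [Fintype.linearCombination_apply, pderivVec, mul_comm]
  · rw [listIdeal_eq_span_image]
    exact (depthGE_span_image hgh hCI l.toFinset (by omega)).mono (by omega)

end Concrete

section Projection

variable {F : Type} [Field F] {n : ℕ}

open ExteriorAlgebra

theorem formBasis_singleton (i : Fin n) :
    formBasis F n {i} = ι (PolyRing F n) (Pi.single i (1 : PolyRing F n)) := by
  rw [formBasis, basis_apply_ofCard _ (Finset.card_singleton i), ιMulti_family, ιMulti_apply]
  have h := Set.powersetCard.mem_range_ofFinEmbEquiv_symm_iff_mem
    (Set.powersetCard.ofCard (Finset.card_singleton i))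
  obtain ⟨j, hj⟩ := (h i).2 (Finset.mem_singleton_self i)
  rw [Subsingleton.elim j 0] at hj
  simp [hj]

theorem formBasis_empty : formBasis F n ∅ = 1 := by
  rw [formBasis, basis_apply_ofCard _ Finset.card_empty, ιMulti_family, ιMulti_apply]
  simp

theorem ι_single_mul_formBasis (i : Fin n) (S : Finset (Fin n)) :
    ∃ (T : Finset (Fin n)) (ε : ℤ), (ε = 0 ∨ T.card = S.card + 1) ∧
      ι (PolyRing F n) (Pi.single i (1 : PolyRing F n)) * formBasis F n S =
        ε • formBasis F n T := by
  rw [← formBasis_singleton]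
  let s := Set.powersetCard.ofCard (Finset.card_singleton i)
  let t := Set.powersetCard.ofCard (rfl : S.card = S.card)
  by_cases h : Disjoint s.val t.val
  · refine ⟨Set.powersetCard.disjUnion h, (Set.powersetCard.permOfDisjoint h).sign,
      Or.inr ?_, ?_⟩
    · exact (Set.powersetCard.disjUnion h).2.trans (add_comm _ _)
    · exact basis_mul_of_disjoint (Pi.basisFun (PolyRing F n) (Fin n)) s t h
  · exact ⟨∅, 0, Or.inl rfl, by
      rw [zero_smul]
      exact basis_mul_of_not_disjoint (Pi.basisFun (PolyRing F n) (Fin n)) s t h⟩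

/-- The part of form degree `k` and coefficient degree `e` of a differential form. -/
noncomputable def formProj (F : Type) [Field F] (n k e : ℕ) : FormAlgebra F n →+ FormAlgebra F n :=
  ∑ S : Finset (Fin n) with S.card = k,
    (LinearMap.toSpanSingleton (PolyRing F n) (FormAlgebra F n) (formBasis F n S)).toAddMonoidHom.comp
      ((homogeneousComponent e).toAddMonoidHom.comp ((formBasis F n).coord S).toAddMonoidHom)

theorem formProj_apply (k e : ℕ) (x : FormAlgebra F n) :
    formProj F n k e x = ∑ S : Finset (Fin n) with S.card = k,
      homogeneousComponent e ((formBasis F n).repr x S) • formBasis F n S := by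
  simp [formProj, AddMonoidHom.finsetSum_apply]

theorem formProj_smul_formBasis (k e : ℕ) (c : PolyRing F n) (S : Finset (Fin n)) :
    formProj F n k e (c • formBasis F n S) =
      if S.card = k then homogeneousComponent e c • formBasis F n S else 0 := by
  rw [formProj_apply]
  have (T : Finset (Fin n)) : homogeneousComponent e ((formBasis F n).repr (c • formBasis F n S) T)
      • formBasis F n T = if S = T then homogeneousComponent e c • formBasis F n S else 0 := by
    by_cases h : S = T
    · subst h; simp
    · simp [h]
  simp only [this, Finset.sum_ite_eq, Finset.mem_filter, Finset.mem_univ, true_and]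

theorem FormAlgebra.induction {P : FormAlgebra F n → Prop} (zero : P 0)
    (add : ∀ x y, P x → P y → P (x + y))
    (smul_basis : ∀ (c : PolyRing F n) S, P (c • formBasis F n S)) (x : FormAlgebra F n) : P x := by
  rw [← (formBasis F n).sum_repr x]
  exact Finset.sum_induction _ P add zero fun S _ ↦ smul_basis _ S

attribute [local instance] MvPolynomial.gradedAlgebra in
theorem homogeneousComponent_mul {d : ℕ} {c : PolyRing F n} (hc : c.IsHomogeneous d) (e : ℕ)
    (u : PolyRing F n) : homogeneousComponent e (c * u) =
      if d ≤ e then c * homogeneousComponent (e - d) u else 0 := by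
  split_ifs with h
  · conv_lhs => rw [← Nat.add_sub_cancel' h]
    exact homogeneousComponent_mul_of_isHomogeneous hc _ _
  · have := DirectSum.coe_decompose_mul_of_left_mem_of_not_le
      (homogeneousSubmodule (Fin n) F) (b := u) ((mem_homogeneousSubmodule d c).2 hc) h
    rwa [← decomposition.decompose'_apply]

/-- Multiplication by `y` shifts the bidegree of forms by `(j, d)`. -/
def ShiftsBidegree (j d : ℕ) (y : FormAlgebra F n) : Prop :=
  ∀ k e x, formProj F n k e (y * x) =
    if j ≤ k ∧ d ≤ e then y * formProj F n (k - j) (e - d) x else 0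

theorem ShiftsBidegree.mul {j d j' d' : ℕ} {y z : FormAlgebra F n} (hy : ShiftsBidegree j d y)
    (hz : ShiftsBidegree j' d' z) : ShiftsBidegree (j + j') (d + d') (y * z) := by
  intro k e x
  rw [mul_assoc, hy, hz]
  by_cases h : j ≤ k ∧ d ≤ e
  · by_cases h' : j' ≤ k - j ∧ d' ≤ e - d
    · rw [if_pos h, if_pos h', if_pos (by omega), mul_assoc, Nat.sub_sub, Nat.sub_sub]
    · rw [if_pos h, if_neg h', if_neg (by omega), mul_zero]
  · rw [if_neg h, if_neg (by omega)]

theorem ShiftsBidegree.add {j d : ℕ} {y z : FormAlgebra F n} (hy : ShiftsBidegree j d y)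
    (hz : ShiftsBidegree j d z) : ShiftsBidegree j d (y + z) := by
  intro k e x
  rw [add_mul, map_add, hy, hz]
  split_ifs
  · rw [add_mul]
  · rw [add_zero]

theorem ShiftsBidegree.neg {j d : ℕ} {y : FormAlgebra F n} (hy : ShiftsBidegree j d y) :
    ShiftsBidegree j d (-y) := by
  intro k e x
  rw [neg_mul, map_neg, hy]
  split_ifs
  · rw [neg_mul]
  · rw [neg_zero]

theorem shiftsBidegree_zero (j d : ℕ) : ShiftsBidegree j d (0 : FormAlgebra F n) := by
  intro k e x
  simp

theorem shiftsBidegree_one : ShiftsBidegree 0 0 (1 : FormAlgebra F n) := by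
  intro k e x
  simp

theorem ShiftsBidegree.smul {j d d' : ℕ} {c : PolyRing F n} {y : FormAlgebra F n}
    (hc : c.IsHomogeneous d) (hy : ShiftsBidegree j d' y) : ShiftsBidegree j (d + d') (c • y) := by
  have hc' : ShiftsBidegree 0 d (c • (1 : FormAlgebra F n)) := by
    intro k e x
    rw [smul_one_mul]
    induction x using FormAlgebra.induction with
    | zero => simp
    | add x x' hx hx' =>
      rw [smul_add, map_add, hx, hx']
      split_ifs
      · rw [map_add, mul_add]
      · rw [add_zero]
    | smul_basis b S =>
      rw [smul_smul, formProj_smul_formBasis, formProj_smul_formBasis, homogeneousComponent_mul hc]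
      by_cases h : S.card = k <;> by_cases h' : d ≤ e <;> simp [h, h', smul_smul, mul_comm]
  simpa using hc'.mul hy

theorem shiftsBidegree_ι_single (i : Fin n) :
    ShiftsBidegree 1 0 (ι (PolyRing F n) (Pi.single i (1 : PolyRing F n)) : FormAlgebra F n) := by
  intro k e x
  induction x using FormAlgebra.induction with
  | zero => simp
  | add x x' hx hx' =>
    rw [mul_add, map_add, hx, hx']
    split_ifs
    · rw [map_add, mul_add]
    · rw [add_zero]
  | smul_basis c S =>
    obtain ⟨T, ε, hT, h⟩ := ι_single_mul_formBasis (F := F) i S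
    rw [mul_smul_comm, h, smul_comm, map_zsmul, formProj_smul_formBasis, formProj_smul_formBasis]
    rcases hT with rfl | hT
    · by_cases h' : S.card = k - 1 <;> simp [h', h]
    · by_cases h' : T.card = k
      · have h1 : 1 ≤ k := by omega
        have h2 : S.card = k - 1 := by omega
        rw [if_pos h', if_pos ⟨h1, zero_le⟩, if_pos h2, mul_smul_comm, h, smul_comm, Nat.sub_zero]
      · have h2 : ¬ (1 ≤ k ∧ S.card = k - 1) := by omega
        rw [if_neg h', smul_zero]
        by_cases h1 : 1 ≤ k
        · rw [if_neg (fun h ↦ h2 ⟨h1, h⟩)]; simp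
        · rw [if_neg (fun h ↦ h1 h.1)]

theorem shiftsBidegree_list_prod {β : Type*} (l : List β) (y : β → FormAlgebra F n) (d : β → ℕ)
    (h : ∀ b ∈ l, ShiftsBidegree 1 (d b) (y b)) :
    ShiftsBidegree l.length (l.map d).sum (l.map y).prod := by
  induction l with
  | nil => exact shiftsBidegree_one
  | cons b l ih =>
    rw [List.length_cons, add_comm, List.map_cons, List.map_cons, List.sum_cons, List.prod_cons]
    exact (h b (by simp)).mul (ih fun b hb ↦ h b (by simp [hb]))

theorem shiftsBidegree_wedgeMonomial {k d : ℕ} (s : Fin k → Fin n) {c : PolyRing F n}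
    (hc : c.IsHomogeneous d) : ShiftsBidegree k d (wedgeMonomial k s c) := by
  rw [wedgeMonomial, List.ofFn_eq_map]
  have := shiftsBidegree_list_prod (List.finRange k) (fun i ↦ ι (PolyRing F n)
    (Pi.single (s i) (1 : PolyRing F n))) (fun _ ↦ 0) fun i _ ↦ shiftsBidegree_ι_single (s i)
  simpa using this.smul hc

theorem IsHomogeneousForm.shiftsBidegree {k d : ℕ} {y : FormAlgebra F n}
    (hy : IsHomogeneousForm k d y) : ShiftsBidegree k d y := by
  induction hy using AddSubgroup.closure_induction with
  | mem x hx =>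
    obtain ⟨s, c, hc, rfl⟩ := hx
    exact shiftsBidegree_wedgeMonomial s hc
  | zero => exact shiftsBidegree_zero k d
  | add x y _ _ hx hy => exact hx.add hy
  | neg x _ hx => exact hx.neg

theorem formProj_one : formProj F n 0 0 1 = 1 := by
  have := formProj_smul_formBasis (F := F) 0 0 1 (∅ : Finset (Fin n))
  rw [one_smul, formBasis_empty, if_pos Finset.card_empty] at this
  rw [this, homogeneousComponent_zero]
  simp

theorem IsHomogeneousForm.formProj_eq {k d : ℕ} {y : FormAlgebra F n}
    (hy : IsHomogeneousForm k d y) : formProj F n k d y = y := by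
  have := hy.shiftsBidegree k d 1
  simpa [formProj_one] using this

theorem isHomogeneousForm_formProj (k d : ℕ) (x : FormAlgebra F n) :
    IsHomogeneousForm k d (formProj F n k d x) := by
  rw [formProj_apply]
  refine AddSubgroup.sum_mem _ fun S hS ↦ AddSubgroup.subset_closure ?_
  have hS' := (Finset.mem_filter.1 hS).2
  refine ⟨Set.powersetCard.ofFinEmbEquiv.symm (Set.powersetCard.ofCard hS'), _,
    homogeneousComponent_isHomogeneous d ((formBasis F n).repr x S), ?_⟩
  rw [wedgeMonomial, formBasis, basis_apply_ofCard _ hS', ιMulti_family, ιMulti_apply]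
  simp only [Function.comp_apply, Pi.basisFun_apply]

theorem shiftsBidegree_ι {d : ℕ} {v : Fin n → PolyRing F n} (hv : ∀ i, (v i).IsHomogeneous d) :
    ShiftsBidegree 1 d (ι (PolyRing F n) v : FormAlgebra F n) := by
  rw [pi_eq_sum_univ' v, map_sum]
  refine Finset.sum_induction _ (ShiftsBidegree 1 d) (fun _ _ ↦ ShiftsBidegree.add)
    (shiftsBidegree_zero 1 d) fun i _ ↦ ?_
  rw [map_smul]
  exact (shiftsBidegree_ι_single i).smul (hv i)

end Projection

section Theta

variable {F : Type} [Field F] {n r : ℕ} {g : Fin r → PolyRing F n} {dg : Fin r → ℕ}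

open ExteriorAlgebra

theorem dform_eq_ι_pderivVec (i : Fin r) : dform (g i) = ι (PolyRing F n) (pderivVec g i) := rfl

theorem dWedge_eq_wedgeList (s : Finset (Fin r)) :
    dWedge g s = wedgeList (pderivVec g) (s.sort (· ≤ ·)) := rfl

theorem shiftsBidegree_dform {d : ℕ} {h : PolyRing F n} (hh : h.IsHomogeneous d) :
    ShiftsBidegree 1 (d - 1) (dform h) :=
  shiftsBidegree_ι fun _ ↦ hh.pderiv

theorem dform_eq_zero {h : PolyRing F n} (hh : h.IsHomogeneous 0) : dform h = 0 := by
  rw [← totalDegree_zero_iff_isHomogeneous, totalDegree_eq_zero_iff_eq_C] at hh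
  rw [dform, hh]
  simp only [pderiv_C]
  exact map_zero _

theorem dform_mul (x y : PolyRing F n) : dform (x * y) = x • dform y + y • dform x := by
  simp only [dform, ← map_smul, ← map_add]
  congr 1
  ext1 j
  simp [Derivation.leibniz]

theorem dform_pow (x : PolyRing F n) (m : ℕ) :
    dform (x ^ m) = ((m : PolyRing F n) * x ^ (m - 1)) • dform x := by
  simp only [dform, ← map_smul]
  congr 1
  ext1 j
  simp [Derivation.leibniz_pow, mul_assoc]

theorem shiftsBidegree_dWedge (hgh : ∀ i, (g i).IsHomogeneous (dg i)) (s : Finset (Fin r)) :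
    ShiftsBidegree s.card (∑ i ∈ s, (dg i - 1)) (dWedge g s) := by
  have := shiftsBidegree_list_prod (s.sort (· ≤ ·)) (fun i ↦ dform (g i)) (fun i ↦ dg i - 1)
    fun i _ ↦ shiftsBidegree_dform (hgh i)
  rw [Finset.length_sort] at this
  change ShiftsBidegree _ _ (dWedge g s) at this
  convert this using 1
  rw [← Finset.sum_map_toList, ← Multiset.sum_coe, ← Multiset.sum_coe, ← Multiset.map_coe,
    ← Multiset.map_coe, Finset.sort_eq, Finset.coe_toList]

theorem shiftsBidegree_clearedThetaOmega (hgh : ∀ i, (g i).IsHomogeneous (dg i))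
    (a : Fin r → ℕ) (s : Finset (Fin r)) :
    ShiftsBidegree (s.card + 1) (∑ i, dg i - (s.card + 1))
      (clearedThetaOmega g a (fun _ ↦ 1) s) := by
  refine Finset.sum_induction _ (ShiftsBidegree (s.card + 1) (∑ i, dg i - (s.card + 1)))
    (fun _ _ ↦ ShiftsBidegree.add) (shiftsBidegree_zero _ _) fun i hi ↦ ?_
  have his : i ∉ s := Finset.mem_compl.1 hi
  by_cases h0 : ∃ j ∈ insert i s, dg j = 0
  · obtain ⟨j, hj, hj0⟩ := h0
    have hdj : dform (g j) = 0 := dform_eq_zero (hj0 ▸ hgh j)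
    have : dform (g i) * dWedge g s = 0 := by
      rcases Finset.mem_insert.1 hj with rfl | hj
      · rw [hdj, zero_mul]
      · rw [dWedge, List.prod_eq_zero, mul_zero]
        exact List.mem_map.2 ⟨j, by simpa using hj, hdj⟩
    rw [this, smul_zero]
    exact shiftsBidegree_zero _ _
  · push Not at h0
    have h1 : ((a i : PolyRing F n) *
        ∏ j, g j ^ (1 - (if j ∈ insert i s then 1 else 0))).IsHomogeneous
          (∑ j, if j ∈ insert i s then 0 else dg j) := by
      rw [← zero_add (∑ j, _)]
      refine IsHomogeneous.mul ?_ (IsHomogeneous.prod _ _ _ fun j _ ↦ ?_)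
      · rw [← map_natCast C]
        exact isHomogeneous_C _ _
      · split_ifs
        · simpa using isHomogeneous_one (Fin n) F
        · simpa using hgh j
    have h2 := ((shiftsBidegree_dform (hgh i)).mul (shiftsBidegree_dWedge hgh s)).smul h1
    rw [← Finset.sum_insert (f := fun j ↦ dg j - 1) his, add_comm 1] at h2
    convert h2 using 1
    have h3 : ∑ j ∈ insert i s, (dg j - 1) + (insert i s).card = ∑ j ∈ insert i s, dg j := by
      rw [Finset.card_eq_sum_ones, ← Finset.sum_add_distrib]
      exact Finset.sum_congr rfl fun j hj ↦ Nat.sub_add_cancel (Nat.pos_of_ne_zero (h0 j hj))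
    have h4 : ∑ j, dg j = ∑ j ∈ insert i s, dg j +
        ∑ j, (if j ∈ insert i s then 0 else dg j) := by
      rw [← Fintype.sum_ite_mem (insert i s), ← Finset.sum_add_distrib]
      exact Finset.sum_congr rfl fun j _ ↦ by split_ifs <;> simp
    rw [Finset.card_insert_of_notMem his] at h3
    omega

/-- The polynomial form `(∏ g_i) · ∑ a_i dg_i / g_i`. -/
noncomputable def thetaForm (g : Fin r → PolyRing F n) (a : Fin r → ℕ) (s : Finset (Fin r)) :
    FormAlgebra F n :=
  ∑ i ∈ s, ((a i : PolyRing F n) * ∏ j ∈ s.erase i, g j) • dform (g i)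

theorem dform_prod_pow {a : Fin r → ℕ} (ha : ∀ i, 0 < a i) (s : Finset (Fin r)) :
    dform (∏ i ∈ s, g i ^ a i) = (∏ i ∈ s, g i ^ (a i - 1)) • thetaForm g a s := by
  induction s using Finset.induction_on with
  | empty => simp [thetaForm, dform_eq_zero (isHomogeneous_one (Fin n) F)]
  | insert b s hb ih =>
    have h1 : thetaForm g a (insert b s) =
        ((a b : PolyRing F n) * ∏ j ∈ s, g j) • dform (g b) + g b • thetaForm g a s := by
      rw [thetaForm, Finset.sum_insert hb, Finset.erase_insert hb, thetaForm, Finset.smul_sum]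
      congr 1
      refine Finset.sum_congr rfl fun i hi ↦ ?_
      have hbi : b ≠ i := fun h ↦ hb (h ▸ hi)
      rw [Finset.erase_insert_of_ne hbi, Finset.prod_insert (by simp [hb]), smul_smul]
      congr 1
      ring
    have h2 : ∏ i ∈ s, g i ^ a i = (∏ i ∈ s, g i ^ (a i - 1)) * ∏ i ∈ s, g i := by
      rw [← Finset.prod_mul_distrib]
      exact Finset.prod_congr rfl fun i _ ↦ by rw [← pow_succ, Nat.sub_add_cancel (ha i)]
    have h3 : g b ^ a b = g b ^ (a b - 1) * g b := by rw [← pow_succ, Nat.sub_add_cancel (ha b)]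
    rw [Finset.prod_insert hb, Finset.prod_insert hb, dform_mul, ih, dform_pow, h1, h2, h3,
      smul_add, smul_smul, smul_smul, smul_smul, smul_smul, add_comm]
    congr 2 <;> ring

theorem thetaForm_mul_dWedge (a : Fin r → ℕ) (s : Finset (Fin r)) :
    (∏ j ∈ sᶜ, g j) • (thetaForm g a Finset.univ * dWedge g s) =
      (∏ j, g j) • clearedThetaOmega g a (fun _ ↦ 1) s := by
  rw [thetaForm, clearedThetaOmega, Finset.sum_mul, Finset.smul_sum, Finset.smul_sum]
  rw [← Finset.sum_subset (Finset.subset_univ sᶜ)]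
  · refine Finset.sum_congr rfl fun i hi ↦ ?_
    rw [smul_mul_assoc, smul_smul, smul_smul]
    congr 1
    have h1 : ∏ j ∈ sᶜ, g j = g i * ∏ j ∈ (insert i s)ᶜ, g j := by
      rw [Finset.compl_insert, Finset.mul_prod_erase _ _ hi]
    have h2 : ∏ j, g j ^ (1 - (if j ∈ insert i s then 1 else 0)) = ∏ j ∈ (insert i s)ᶜ, g j := by
      rw [← Finset.prod_subset (Finset.subset_univ (insert i s)ᶜ)]
      · refine Finset.prod_congr rfl fun j hj ↦ ?_
        rw [if_neg (Finset.mem_compl.1 hj), Nat.sub_zero, pow_one]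
      · intro j _ hj
        rw [if_pos (not_not.1 (mt Finset.mem_compl.2 hj)), Nat.sub_self, pow_zero]
    rw [h1, h2, ← Finset.mul_prod_erase Finset.univ g (Finset.mem_univ i)]
    ring
  · intro i _ hi
    have hi' : i ∈ s := by simpa using hi
    have : dform (g i) * dWedge g s = 0 := by
      rw [dWedge_eq_wedgeList, dform_eq_ι_pderivVec]
      have h1 := wedgeList_mul_ι (R := PolyRing F n) (w := pderivVec g) (s.sort (· ≤ ·)) (pderivVec g i)
      rw [wedgeList_mul_ι_of_mem (R := PolyRing F n) (w := pderivVec g) (i := i)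
        ((Finset.mem_sort _).2 hi')] at h1
      have h2 := congrArg (fun z ↦ (-1 : PolyRing F n) ^ (s.sort (· ≤ ·)).length • z) h1
      simp only [smul_zero, smul_smul, ← mul_pow, neg_one_mul, neg_neg, one_pow, one_smul] at h2
      exact h2.symm
    rw [smul_mul_assoc, this, smul_zero, smul_zero]

theorem exists_eq_sum_of_mem_mixedSubmodule {l : List (Fin r)} (hl : l.Pairwise (· < ·))
    {x : FormAlgebra F n} (hx : x ∈ mixedSubmodule g (pderivVec g) l) :
    ∃ β : Finset (Fin r) → FormAlgebra F n,
      x = ∑ s ∈ l.toFinset.powerset, (∏ j ∈ l.toFinset \ s, g j) • (dWedge g s * β s) := by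
  induction l generalizing x with
  | nil => exact ⟨fun _ ↦ x, by simp [dWedge]⟩
  | cons i l ih =>
    obtain ⟨hil, hl'⟩ := List.pairwise_cons.1 hl
    obtain ⟨y, hy, z, hz, rfl⟩ := mem_mixedSubmodule_cons.1 hx
    obtain ⟨β, rfl⟩ := ih hl' hy
    obtain ⟨γ, rfl⟩ := ih hl' hz
    have hi : i ∉ l.toFinset := fun h ↦ (hil i (by simpa using h)).false
    refine ⟨fun s ↦ if i ∈ s then γ (s.erase i) else β s, ?_⟩
    rw [List.toFinset_cons, Finset.sum_powerset_insert hi, Finset.smul_sum, Finset.mul_sum]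
    have his : ∀ s ∈ l.toFinset.powerset, i ∉ s := fun s hs h ↦ hi (Finset.mem_powerset.1 hs h)
    congr 1 <;> refine Finset.sum_congr rfl fun s hs ↦ ?_
    · beta_reduce
      rw [if_neg (his s hs), Finset.insert_sdiff_of_notMem _ (his s hs),
        Finset.prod_insert (by simp [hi]), mul_smul]
    · beta_reduce
      rw [if_pos (Finset.mem_insert_self i s), Finset.erase_insert (his s hs),
        Finset.insert_sdiff_insert, Finset.sdiff_insert_of_notMem hi, mul_smul_comm, ← mul_assoc]
      congr 2
      rw [dWedge_eq_wedgeList, dWedge_eq_wedgeList, Finset.sort_insert _ _ (his s hs),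
        wedgeList_cons]
      exact fun j hj ↦ (hil j (by simpa using Finset.mem_powerset.1 hs hj)).le

end Theta

section Euler

variable {F : Type} [Field F] {n r : ℕ} {g : Fin r → PolyRing F n} {dg : Fin r → ℕ}

open ExteriorAlgebra CliffordAlgebra

/-- Contraction of differential forms with the Euler vector field. -/
noncomputable def eulerContraction (F : Type) [Field F] (n : ℕ) :
    FormAlgebra F n →ₗ[PolyRing F n] FormAlgebra F n :=
  contractLeft (Q := (0 : QuadraticForm (PolyRing F n) (Fin n → PolyRing F n)))
    (Fintype.linearCombination (PolyRing F n) (X : Fin n → PolyRing F n))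

theorem eulerContraction_dform_mul {d : ℕ} {h : PolyRing F n} (hh : h.IsHomogeneous d)
    (x : FormAlgebra F n) : eulerContraction F n (dform h * x) =
      ((d : PolyRing F n) * h) • x - dform h * eulerContraction F n x := by
  have h1 : Fintype.linearCombination (PolyRing F n) (X : Fin n → PolyRing F n)
      (fun j ↦ pderiv j h) = (d : PolyRing F n) * h := by
    rw [← nsmul_eq_mul, ← hh.sum_X_mul_pderiv, Fintype.linearCombination_apply]
    simp [mul_comm]
  rw [← h1]
  unfold eulerContraction dform
  erw [contractLeft_ι_mul]

theorem truncation_of_isHomogeneousForm {k d : ℕ} {x : FormAlgebra F n}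
    (hx : IsHomogeneousForm k d x) : truncation _ _ (k + 1) x = x := by
  induction hx using AddSubgroup.closure_induction with
  | mem x hx =>
    obtain ⟨s, c, -, rfl⟩ := hx
    refine truncation_of_mem (Nat.lt_succ_self k) (Submodule.smul_mem _ _ ?_)
    rw [← ιMulti_apply]
    exact ιMulti_range _ _ ⟨_, rfl⟩
  | zero => exact map_zero _
  | add x y _ _ hx hy => rw [map_add, hx, hy]
  | neg x _ hx => rw [map_neg, hx]

theorem map_mem_smul_top {R E : Type*} [CommRing R] [AddCommGroup E] [Module R E] {K : Ideal R}
    (φ : E →ₗ[R] E) {x : E} (hx : x ∈ K • (⊤ : Submodule R E)) :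
    φ x ∈ K • (⊤ : Submodule R E) := by
  have := Submodule.mem_map_of_mem (f := φ) hx
  rw [Submodule.map_smul''] at this
  exact Submodule.smul_mono le_rfl le_top this

theorem eq_of_smul_eq {c : PolyRing F n} (hc : c ≠ 0) {x y : FormAlgebra F n}
    (h : c • x = c • y) : x = y := by
  refine (formBasis F n).repr.injective (Finsupp.ext fun S ↦ mul_left_cancel₀ hc ?_)
  simpa using congrArg (fun z ↦ (formBasis F n).repr z S) h

theorem ne_zero_of_isSmoothCI (hn : 0 < n)
    (hCI : ∀ s : Finset (Fin r), s.Nonempty → IsSmoothCI (fun i : s ↦ g i)) (i : Fin r) :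
    g i ≠ 0 := by
  intro hi
  have := hCI {i} (Finset.singleton_nonempty i) 1 (fun j ↦ ?_) (fun h ↦ ?_)
  · exact one_ne_zero (congrFun this ⟨0, hn⟩)
  · have hj : (j : Fin r) = i := Finset.mem_singleton.1 j.2
    simp [hj, hi]
  · refine h.ne_zero ⟨i, Finset.mem_singleton_self i⟩ ?_
    ext j
    simp [hi]

theorem dform_mul_mem_of_thetaForm_mul_eq_zero (hn : 2 ≤ n)
    (hgh : ∀ i, (g i).IsHomogeneous (dg i))
    (hCI : ∀ s : Finset (Fin r), s.Nonempty → IsSmoothCI (fun i : s ↦ g i))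
    {a : Fin r → ℕ} (ha : ∀ i, (a i : F) ≠ 0) {ω : FormAlgebra F n}
    (hω : thetaForm g a Finset.univ * ω = 0) (i : Fin r) :
    dform (g i) * ω ∈ listIdeal g [i] • (⊤ : Submodule (PolyRing F n) (FormAlgebra F n)) := by
  have hreg : ∀ s : Finset (Fin r), i ∉ s → RegularMod (∏ j ∈ s, g j) (listIdeal g [i]) := by
    intro s hs
    refine Finset.prod_induction _ (fun c ↦ RegularMod c (listIdeal g [i]))
      (fun _ _ ↦ RegularMod.mul) (fun u hu ↦ by rwa [one_mul] at hu) fun j hj ↦ ?_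
    have hji : j ≠ i := fun h ↦ hs (h ▸ hj)
    exact regularMod_listIdeal hgh hCI j [i] (by simpa using hji) (by simpa using hn)
  refine (hreg (Finset.univ.erase i) (Finset.notMem_erase i _)).mem_smul_top (formBasis F n) ?_
  have h1 : ((a i : PolyRing F n) * ∏ j ∈ Finset.univ.erase i, g j) • (dform (g i) * ω) ∈
      listIdeal g [i] • (⊤ : Submodule (PolyRing F n) (FormAlgebra F n)) := by
    rw [thetaForm, Finset.sum_mul, ← Finset.add_sum_erase _ _ (Finset.mem_univ i),
      smul_mul_assoc] at hω
    rw [eq_neg_of_add_eq_zero_left hω]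
    refine neg_mem (sum_mem fun j hj ↦ ?_)
    rw [smul_mul_assoc]
    refine Submodule.smul_mem_smul (Ideal.mul_mem_left _ _ (Ideal.mem_of_dvd _
      (Finset.dvd_prod_of_mem g (Finset.mem_erase.2 ⟨(Finset.ne_of_mem_erase hj).symm,
        Finset.mem_univ i⟩)) (mem_listIdeal (by simp)))) Submodule.mem_top
  have h2 := Submodule.smul_mem _ (C (a i : F)⁻¹) h1
  rwa [smul_smul, ← mul_assoc, ← map_natCast (C : F →+* PolyRing F n), ← map_mul,
    inv_mul_cancel₀ (ha i), map_one, one_mul] at h2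

theorem exists_sum_clearedThetaOmega (hgh : ∀ i, (g i).IsHomogeneous (dg i))
    (hCI : ∀ s : Finset (Fin r), s.Nonempty → IsSmoothCI (fun i : s ↦ g i))
    {a : Fin r → ℕ} (ha : ∀ i, (a i : F) ≠ 0) {δ : ℕ} (hδ : (δ : F) ≠ 0)
    (hh : (∏ i, g i ^ a i).IsHomogeneous δ) {k d : ℕ} (hk : k < n) {ω : FormAlgebra F n}
    (hω : IsHomogeneousForm k d ω) (hZ : dform (∏ i, g i ^ a i) * ω = 0) :
    ∃ β : Finset (Fin r) → FormAlgebra F n,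
      ω = ∑ s, clearedThetaOmega g a (fun _ ↦ 1) s * β s := by
  have ha' : ∀ i, 0 < a i := fun i ↦ Nat.pos_of_ne_zero fun h ↦ ha i (by simp [h])
  have hg0 := ne_zero_of_isSmoothCI (by omega : 0 < n) hCI
  set P := ∏ i, g i ^ (a i - 1) with hP
  set G := ∏ i, g i with hG
  have hP0 : P ≠ 0 := Finset.prod_ne_zero_iff.2 fun i _ ↦ pow_ne_zero _ (hg0 i)
  have hG0 : G ≠ 0 := Finset.prod_ne_zero_iff.2 fun i _ ↦ hg0 i
  have hPG : ∏ i, g i ^ a i = P * G := by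
    rw [hP, hG, ← Finset.prod_mul_distrib]
    exact Finset.prod_congr rfl fun i _ ↦ by rw [← pow_succ, Nat.sub_add_cancel (ha' i)]
  have hdP := dform_prod_pow (g := g) ha' Finset.univ
  have hΘω : thetaForm g a Finset.univ * ω = 0 := by
    refine eq_of_smul_eq hP0 ?_
    rw [← smul_mul_assoc, ← hdP, hZ, smul_zero]
  set ξ := truncation (PolyRing F n) (Fin n → PolyRing F n) k (eulerContraction F n ω) with hξ
  have hΘ : ∀ y : FormAlgebra F n, truncation _ _ (k + 1) (thetaForm g a Finset.univ * y) =
      thetaForm g a Finset.univ * truncation _ _ k y := by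
    intro y
    rw [thetaForm, Finset.sum_mul, Finset.sum_mul, map_sum]
    refine Finset.sum_congr rfl fun i _ ↦ ?_
    rw [smul_mul_assoc, smul_mul_assoc, map_smul, dform_eq_ι_pderivVec, truncation_ι_mul]
  have hωξ : ((δ : PolyRing F n) * G) • ω = thetaForm g a Finset.univ * ξ := by
    have h1 := eulerContraction_dform_mul hh ω
    rw [hZ, map_zero, eq_comm, sub_eq_zero, hdP, hPG, mul_left_comm, mul_smul,
      smul_mul_assoc] at h1
    have h2 := congrArg (truncation (PolyRing F n) (Fin n → PolyRing F n) (k + 1))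
      (eq_of_smul_eq hP0 h1)
    rwa [map_smul, truncation_of_isHomogeneousForm hω, hΘ] at h2
  have hξi : ∀ i, ξ ∈ vectorIdeal (listIdeal g [i]) (pderivVec g) [i] := by
    intro i
    rcases Nat.eq_zero_or_pos k with rfl | hk0
    · rw [hξ, truncation_zero]; exact zero_mem _
    have h1 := dform_mul_mem_of_thetaForm_mul_eq_zero (by omega) hgh hCI ha hΘω i
    have h2 := map_mem_smul_top (eulerContraction F n) h1
    rw [eulerContraction_dform_mul (hgh i)] at h2
    have h3 : ((dg i : PolyRing F n) * g i) • ω ∈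
        listIdeal g [i] • (⊤ : Submodule (PolyRing F n) (FormAlgebra F n)) :=
      Submodule.smul_mem_smul (Ideal.mul_mem_left _ _ (mem_listIdeal (by simp))) Submodule.mem_top
    have h4 := sub_mem h3 h2
    rw [sub_sub_cancel] at h4
    have h5 := map_mem_smul_top (truncation _ _ (k + 1)) h4
    rw [dform_eq_ι_pderivVec, truncation_ι_mul] at h5
    exact mem_vectorIdeal_pderivVec hgh hCI [i] k ξ (by simp) (by simp) (by simp; omega)
      (truncation_truncation _ _) (by simpa using h5)
  have hmix : ξ ∈ mixedSubmodule g (pderivVec g) (List.finRange r) := by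
    have := mem_sup_mixedSubmodule (formBasis F n) (regularMod_listIdeal hgh hCI)
      (mem_vectorIdeal_pderivVec hgh hCI) (S := List.finRange r) (T := [])
      (by simpa using List.nodup_finRange r) (truncation_truncation k _) (by simpa using hk)
      fun i _ ↦ hξi i
    simpa [listIdeal] using this
  obtain ⟨β, hβ⟩ := exists_eq_sum_of_mem_mixedSubmodule (List.pairwise_lt_finRange r) hmix
  have hδ0 : (δ : PolyRing F n) * C (δ : F)⁻¹ = 1 := by
    rw [← map_natCast (C : F →+* PolyRing F n), ← map_mul, mul_inv_cancel₀ hδ, map_one]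
  have hδ1 : (δ : PolyRing F n) ≠ 0 := left_ne_zero_of_mul_eq_one hδ0
  refine ⟨fun s ↦ (C (δ : F)⁻¹ : PolyRing F n) • β s, eq_of_smul_eq (mul_ne_zero hδ1 hG0) ?_⟩
  rw [hωξ, hβ, Finset.mul_sum, Finset.smul_sum]
  refine Finset.sum_congr (by simp) fun s _ ↦ ?_
  have h1 := congrArg (· * β s) (thetaForm_mul_dWedge (g := g) a s)
  simp only [smul_mul_assoc, mul_assoc] at h1
  rw [mul_smul_comm, mul_smul_comm, smul_smul, mul_right_comm, hδ0, one_mul,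
    List.toFinset_finRange, ← Finset.compl_eq_univ_sdiff, h1]

end Euler

/-- Proposition 5.4: under the hypotheses of Theorem 1.18, every homogeneous k-form ω
(k < n) with df^{(δ)} ∧ ω = 0 can be written, over the localization R[1/(f_1⋯f_r)], as
ω = Θ ∧ (Σ_{l=0}^{k-1} Σ_{i_1<⋯<i_l} Ω_{i_1⋯i_l} ∧ α_{i_1⋯i_l}); here all denominators
are cleared: Θ ∧ Ω_{i_1⋯i_l} is the polynomial form clearedThetaOmega g a 1 s, and the
equality (between polynomial forms) is equivalent to the localized one since
localization at f_1⋯f_r ≠ 0 is injective. -/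
theorem proposition_5_4 {F : Type} [Field F] [Fintype F] {p n : ℕ} [CharP F p] (hp : p.Prime)
    (f : MvPolynomial (Fin n) F) (δ δ' : ℕ)
    (hdeg : f.totalDegree = δ) (hδ'1 : 1 ≤ δ') (hδ'2 : δ' ≤ δ - 1)
    (hmid : ∀ j, δ' < j → j < δ → MvPolynomial.homogeneousComponent j f = 0)
    {r : ℕ} (g : Fin r → MvPolynomial (Fin n) F) (a : Fin r → ℕ) (dg : Fin r → ℕ)
    (hgh : ∀ i, (g i).IsHomogeneous (dg i)) (ha : ∀ i, 0 < a i)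
    (hfact : MvPolynomial.homogeneousComponent δ f = ∏ i, g i ^ a i)
    (hCI1 : ∀ s : Finset (Fin r), s.Nonempty → IsSmoothCI (fun i : s => g i))
    (hCI2 : ∀ s : Finset (Fin r), (2 ≤ s.card ∨ ∃ i ∈ s, s.card = 1 ∧ 1 < a i) →
      IsSmoothCI (fun i : Option s =>
        i.elim (MvPolynomial.homogeneousComponent δ' f) (fun j => g j)))
    (hpdiv : ¬ (p ∣ δ * δ' * ∏ i, a i))
    (k : ℕ) (hk : k < n) (dω : ℕ) (ω : FormAlgebra F n)
    (hω : IsHomogeneousForm k dω ω)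
    (hZ : dform (MvPolynomial.homogeneousComponent δ f) * ω = 0) :
    ∃ α : Finset (Fin r) → FormAlgebra F n,
      (∀ s : Finset (Fin r), ∃ e, IsHomogeneousForm (k - 1 - s.card) e (α s)) ∧
      ω = ∑ s ∈ Finset.univ.powerset.filter (fun s : Finset (Fin r) => s.card < k),
        clearedThetaOmega g a (fun _ => 1) s * α s := by
  have hδF : (δ : F) ≠ 0 := fun h ↦ hpdiv
    (((CharP.cast_eq_zero_iff F p δ).1 h).mul_right δ' |>.mul_right _)
  have haF : ∀ i, (a i : F) ≠ 0 := fun i h ↦ hpdiv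
    (((CharP.cast_eq_zero_iff F p (a i)).1 h).trans
      (Finset.dvd_prod_of_mem a (Finset.mem_univ i)) |>.mul_left _)
  rw [hfact] at hZ
  obtain ⟨β, hβ⟩ := exists_sum_clearedThetaOmega hgh hCI1 haF hδF
    (hfact ▸ homogeneousComponent_isHomogeneous δ f) hk hω hZ
  let D (s : Finset (Fin r)) : ℕ := ∑ i, dg i - (s.card + 1)
  refine ⟨fun s ↦ if D s ≤ dω then formProj F n (k - 1 - s.card) (dω - D s) (β s) else 0,
    fun s ↦ ?_, ?_⟩
  · by_cases h : D s ≤ dω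
    · exact ⟨dω - D s, by simpa only [if_pos h] using isHomogeneousForm_formProj _ _ _⟩
    · exact ⟨0, by
        beta_reduce
        rw [if_neg h]
        exact AddSubgroup.zero_mem _⟩
  · rw [← hω.formProj_eq, hβ, map_sum, Finset.powerset_univ, Finset.sum_filter]
    refine Finset.sum_congr rfl fun s _ ↦ ?_
    rw [shiftsBidegree_clearedThetaOmega hgh a s]
    beta_reduce
    by_cases h1 : s.card < k <;> by_cases h2 : D s ≤ dω
    · rw [if_pos ⟨h1, h2⟩, if_pos h1, if_pos h2, Nat.sub_sub, add_comm 1]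
    · rw [if_neg (fun h ↦ h2 h.2), if_pos h1, if_neg h2, mul_zero]
    · rw [if_neg (fun h ↦ h1 h.1), if_neg h1]
    · rw [if_neg (fun h ↦ h1 h.1), if_neg h1]
end

section
/- (Lemma 5.9) Let 𝔽_q be a finite field of characteristic p, and let f_{i_1},…,f_{i_l} (l ≥ 1) and g be homogeneous polynomials in 𝔽_q[x_1,…,x_n] with p ∤ deg g, such that f_{i_1} = ⋯ = f_{i_l} = 0 defines a smooth complete intersection of codimension l in P^{n-1} and g = f_{i_1} = ⋯ = f_{i_l} = 0 defines a smooth complete intersection of codimension l+1 in P^{n-1}. Let β ∈ Ω^m be a homogeneous m-form with m ≤ n-l-1 such that dg ∧ df_{i_1} ∧ ⋯ ∧ df_{i_l} ∧ β ≡ 0 modulo the ideal (f_{i_1},…,f_{i_l}) (i.e. each coefficient of this (m+l+1)-form lies in that ideal). Then there exist homogeneous (m-1)-forms β_0, β_1, …, β_l and homogeneous m-forms β'_1, …, β'_l such that β = dg ∧ β_0 + Σ_{j=1}^l df_{i_j} ∧ β_j + Σ_{j=1}^l f_{i_j} β'_j. -/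
set_option synthInstance.maxHeartbeats 1000000
set_option maxHeartbeats 1000000
open MvPolynomial

section RegularSequences

variable {A : Type*} [CommRing A]

/-- `h` is a nonzerodivisor modulo the ideal `K`. -/
def RegMod (K : Ideal A) (h : A) : Prop := ∀ x, h * x ∈ K → x ∈ K

/-- `J` contains a sequence of length `r` that is weakly regular modulo `K`. -/
def HasRegSeq (J : Ideal A) : ℕ → Ideal A → Prop
  | 0, _ => True
  | r + 1, K => ∃ h ∈ J, RegMod K h ∧ HasRegSeq J r (K ⊔ Ideal.span {h})

/-- For every sequence `y` of length `< r` that is weakly regular modulo `K`, the ideal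
`K + (y)` equals its colon ideal by `I`. -/
def ColonTrivial (I : Ideal A) : ℕ → Ideal A → Prop
  | 0, _ => True
  | r + 1, K => (∀ z, (∀ i ∈ I, i * z ∈ K) → z ∈ K) ∧
      ∀ y, RegMod K y → ColonTrivial I r (K ⊔ Ideal.span {y})

theorem HasRegSeq.mono {J J' : Ideal A} (hJ : J ≤ J') {r : ℕ} {K : Ideal A}
    (h : HasRegSeq J r K) : HasRegSeq J' r K := by
  induction r generalizing K with
  | zero => trivial
  | succ r ih =>
    obtain ⟨x, hx, hreg, hs⟩ := h
    exact ⟨x, hJ hx, hreg, ih hs⟩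

theorem ColonTrivial.mono {I I' : Ideal A} {r : ℕ} {K : Ideal A} (hI : I ≤ I' ⊔ K)
    (h : ColonTrivial I r K) : ColonTrivial I' r K := by
  induction r generalizing K with
  | zero => trivial
  | succ r ih =>
    refine ⟨fun z hz => h.1 z fun i hi => ?_, fun y hy => ih ?_ (h.2 y hy)⟩
    · obtain ⟨a, ha, b, hb, rfl⟩ := Submodule.mem_sup.1 (hI hi)
      rw [add_mul]
      exact K.add_mem (hz a ha) (K.mul_mem_right _ hb)
    · exact hI.trans (sup_le_sup_left le_sup_left _)

/-- Prime avoidance for the coset `t + I`. -/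
theorem exists_add_notMem_of_primes {s : Set (Ideal A)} (hs : s.Finite)
    (hprime : ∀ P ∈ s, P.IsPrime) {I : Ideal A} {t : A} (h : ∀ P ∈ s, I ≤ P → t ∉ P) :
    ∃ b ∈ I, ∀ P ∈ s, t + b ∉ P := by
  have hTfin : {P | Maximal (· ∈ s) P}.Finite := hs.subset fun P hP => hP.1
  suffices ∃ b ∈ I, ∀ P, Maximal (· ∈ s) P → t + b ∉ P by
    obtain ⟨b, hb, hbT⟩ := this
    refine ⟨b, hb, fun P hP hmem => ?_⟩
    obtain ⟨Q, hPQ, hQ⟩ := hs.exists_le_maximal hP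
    exact hbT Q hQ (hPQ hmem)
  have h₁ : {P | Maximal (· ∈ s) P ∧ t ∈ P}.Finite := hTfin.subset fun P hP => hP.1
  have h₂ : {P | Maximal (· ∈ s) P ∧ t ∉ P}.Finite := hTfin.subset fun P hP => hP.1
  obtain ⟨J, hJ, hJle⟩ : ∃ J : Ideal A,
      (∀ P : Ideal A, P.IsPrime → J ≤ P → ∃ Q, (Maximal (· ∈ s) Q ∧ t ∉ Q) ∧ Q ≤ P) ∧
      ∀ P, Maximal (· ∈ s) P ∧ t ∉ P → J ≤ P := by
    refine ⟨∏ P ∈ h₂.toFinset, P, fun P hP hle => ?_, fun P hP => ?_⟩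
    · obtain ⟨Q, hQ, hQP⟩ := (Ideal.IsPrime.prod_le (f := fun P : Ideal A => P) hP).1 hle
      exact ⟨Q, h₂.mem_toFinset.1 hQ, hQP⟩
    · exact Ideal.le_of_dvd (Finset.dvd_prod_of_mem (fun P : Ideal A => P) (h₂.mem_toFinset.2 hP))
  have hb : ¬ ((I * J : Ideal A) : Set A) ⊆
      ⋃ P ∈ {P | Maximal (· ∈ s) P ∧ t ∈ P}, ((id P : Ideal A) : Set A) := by
    intro hsub
    obtain ⟨P, hP, hle⟩ := (Ideal.subset_union_prime_finite h₁ (f := id) ⊤ ⊤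
      fun P hP _ _ => hprime P hP.1.1).1 hsub
    have hPp := hprime P hP.1.1
    rcases hPp.mul_le.1 hle with hIP | hprod
    · exact h P hP.1.1 hIP hP.2
    · obtain ⟨Q, hQ, hQP⟩ := hJ P hPp hprod
      have : P = Q := le_antisymm (hQ.1.2 hP.1.1 hQP) hQP
      exact hQ.2 (this ▸ hP.2)
  obtain ⟨b, hbI, hbT⟩ := Set.not_subset.1 hb
  rw [SetLike.mem_coe] at hbI
  refine ⟨b, Ideal.mul_le_left hbI, fun P hP hmem => ?_⟩
  by_cases htP : t ∈ P
  · exact hbT (Set.mem_biUnion (x := P) ⟨hP, htP⟩ ((P.add_mem_iff_right htP).1 hmem))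
  · exact htP ((P.add_mem_iff_left (hJle P ⟨hP, htP⟩ (Ideal.mul_le_right hbI))).1 hmem)

theorem exists_forall_mem_iff_mul_mem [IsNoetherianRing A] {K P : Ideal A}
    (hP : P ∈ associatedPrimes A (A ⧸ K)) : ∃ z, ∀ i, i ∈ P ↔ i * z ∈ K := by
  obtain ⟨-, x, hx⟩ := isAssociatedPrime_iff.1 hP
  obtain ⟨z, rfl⟩ := Submodule.Quotient.mk_surjective K x
  refine ⟨z, fun i => ?_⟩
  rw [hx, Submodule.mem_colon_singleton, Submodule.mem_bot, ← Submodule.Quotient.mk_smul,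
    Submodule.Quotient.mk_eq_zero, smul_eq_mul]

theorem regMod_of_notMem_associatedPrimes [IsNoetherianRing A] {K : Ideal A} {c : A}
    (hc : ∀ P ∈ associatedPrimes A (A ⧸ K), c ∉ P) : RegMod K c := by
  intro x hx
  by_contra hxK
  have hmem : c ∈ ⋃ P ∈ associatedPrimes A (A ⧸ K), (P : Set A) := by
    rw [biUnion_associatedPrimes_eq_zero_divisors]
    refine ⟨Submodule.Quotient.mk x, fun h0 => hxK ((Submodule.Quotient.mk_eq_zero K).1 h0), ?_⟩
    rw [← Submodule.Quotient.mk_smul, Submodule.Quotient.mk_eq_zero, smul_eq_mul]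
    exact hx
  obtain ⟨P, hP, hcP⟩ := Set.mem_iUnion₂.1 hmem
  exact hc P hP hcP

theorem exists_regMod_add [IsNoetherianRing A] {I K : Ideal A} {t : A}
    (h : ∀ z, (∀ i ∈ I ⊔ Ideal.span {t}, i * z ∈ K) → z ∈ K) :
    ∃ b ∈ I, RegMod K (t + b) := by
  obtain ⟨b, hb, hbP⟩ := exists_add_notMem_of_primes (I := I) (t := t)
    (associatedPrimes.finite A (A ⧸ K)) (fun P hP => hP.isPrime) (by
      intro P hP hIP htP
      obtain ⟨z, hz⟩ := exists_forall_mem_iff_mul_mem hP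
      have hle : I ⊔ Ideal.span {t} ≤ P :=
        sup_le hIP ((Ideal.span_singleton_le_iff_mem _).2 htP)
      refine hP.isPrime.ne_top ((Ideal.eq_top_iff_one _).2 ((hz 1).2 ?_))
      rw [one_mul]
      exact h z fun i hi => (hz i).1 (hle hi))
  exact ⟨b, hb, regMod_of_notMem_associatedPrimes hbP⟩

/-- Dropping one generator `t` of `I + (t)` lowers the depth by at most one. -/
theorem ColonTrivial.drop_generator [IsNoetherianRing A] [IsLocalRing A] {I : Ideal A} {t : A}
    (hI : I ≤ IsLocalRing.maximalIdeal A) (ht : t ∈ IsLocalRing.maximalIdeal A) {r : ℕ}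
    {K : Ideal A} (h : ColonTrivial (I ⊔ Ideal.span {t}) (r + 1) K) : ColonTrivial I r K := by
  induction r generalizing K with
  | zero => trivial
  | succ r ih =>
    refine ⟨?_, fun y hy => ih (h.2 y hy)⟩
    obtain ⟨b, hb, hreg⟩ := exists_regMod_add h.1
    have h' := (h.2 _ hreg).1
    set H : Ideal A := K.colon (I : Set A) with hH
    have hmemH : ∀ z, z ∈ H ↔ ∀ i ∈ I, i * z ∈ K := by
      intro z
      simp [hH, Submodule.mem_colon, mul_comm]
    have hle : H ≤ K ⊔ IsLocalRing.maximalIdeal A • H := by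
      intro z hz
      have hz' := (hmemH z).1 hz
      have hz2 : z ∈ K ⊔ Ideal.span {t + b} := by
        refine h' z fun i hi => ?_
        obtain ⟨a, ha, c, hc, rfl⟩ := Submodule.mem_sup.1 hi
        obtain ⟨u, rfl⟩ := Ideal.mem_span_singleton'.1 hc
        have : (a + u * t) * z = (a * z - u * (b * z)) + u * z * (t + b) := by ring
        rw [this]
        exact Submodule.add_mem_sup (K.sub_mem (hz' a ha) (K.mul_mem_left _ (hz' b hb)))
          (Ideal.mul_mem_left _ _ (Ideal.mem_span_singleton_self _))
      obtain ⟨k, hk, c, hc, rfl⟩ := Submodule.mem_sup.1 hz2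
      obtain ⟨u, rfl⟩ := Ideal.mem_span_singleton'.1 hc
      refine Submodule.add_mem_sup hk ?_
      rw [mul_comm]
      refine Submodule.smul_mem_smul (Ideal.add_mem _ ht (hI hb)) ((hmemH u).2 fun i hi => ?_)
      refine hreg _ ?_
      have := K.sub_mem (hz' i hi) (K.mul_mem_left i hk)
      convert this using 1
      ring
    have := Submodule.le_of_le_smul_of_le_jacobson_bot (IsNoetherian.noetherian H)
      (IsLocalRing.maximalIdeal_le_jacobson _) hle
    exact fun z hz => this ((hmemH z).2 hz)

/-- Dividing out the ideal generated by `fs` lowers the depth by at most the length of `fs`,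
provided `fs` generates an ideal of large enough depth. -/
theorem ColonTrivial.sup_span_list [IsNoetherianRing A] {I : Ideal A} {r : ℕ} (fs : List A)
    {K : Ideal A} (hI : ColonTrivial I (fs.length + r) K)
    (hfs : ColonTrivial (Ideal.span {x | x ∈ fs}) fs.length K) :
    ColonTrivial I r (K ⊔ Ideal.span {x | x ∈ fs}) := by
  induction fs generalizing K with
  | nil => simpa using hI
  | cons f fs ih =>
    have hspan : Ideal.span {x | x ∈ f :: fs} = Ideal.span {x | x ∈ fs} ⊔ Ideal.span {f} := by
      rw [← Ideal.span_union]
      congr 1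
      ext x
      simp
    rw [hspan] at hfs ⊢
    obtain ⟨b, hb, hreg⟩ := exists_regMod_add hfs.1
    have hle : Ideal.span {x | x ∈ fs} ⊔ Ideal.span {f} ≤
        Ideal.span {x | x ∈ fs} ⊔ (K ⊔ Ideal.span {f + b}) := by
      refine sup_le le_sup_left ((Ideal.span_singleton_le_iff_mem _).2 ?_)
      have := Submodule.add_mem_sup (neg_mem hb)
        ((le_sup_right : _ ≤ K ⊔ _) (Ideal.mem_span_singleton_self (f + b)))
      simpa using this
    have h2 := ih (K := K ⊔ Ideal.span {f + b}) ?_ ((hfs.2 _ hreg).mono hle)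
    · convert h2 using 1
      refine le_antisymm (sup_le (le_sup_left.trans le_sup_left) ?_)
        (sup_le (sup_le le_sup_left ?_) ?_)
      · rw [sup_comm (K ⊔ _)]
        exact hle
      · rw [Ideal.span_singleton_le_iff_mem]
        refine Submodule.mem_sup_right (Ideal.add_mem _ (Submodule.mem_sup_right ?_)
          (Submodule.mem_sup_left hb))
        exact Ideal.mem_span_singleton_self _
      · exact le_sup_left.trans le_sup_right
    · have : (f :: fs).length + r = (fs.length + r) + 1 := by simp; ring
      rw [this] at hI
      exact hI.2 _ hreg

theorem mem_of_forall_pow_mul_mem {I K : Ideal A} (h : ∀ z, (∀ i ∈ I, i * z ∈ K) → z ∈ K)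
    (N : ℕ) {z : A} (hz : ∀ i ∈ I ^ N, i * z ∈ K) : z ∈ K := by
  induction N generalizing z with
  | zero => simpa using hz 1 (by simp)
  | succ N ih =>
    refine ih fun i hi => h _ fun j hj => ?_
    rw [← mul_assoc]
    exact hz _ (by rw [pow_succ']; exact Ideal.mul_mem_mul hj hi)

theorem ColonTrivial.hasRegSeq [IsNoetherianRing A] {I J : Ideal A} {r : ℕ} {K : Ideal A}
    (h : ColonTrivial I r K) (hIJ : I ≤ (J ⊔ K).radical) : HasRegSeq J r K := by
  induction r generalizing K with
  | zero => trivial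
  | succ r ih =>
    obtain ⟨N, hN⟩ := Ideal.exists_pow_le_of_le_radical_of_fg hIJ (IsNoetherian.noetherian I)
    obtain ⟨b, hb, hreg⟩ := exists_regMod_add (I := J) (K := K) (t := 0) (fun z hz => by
      refine mem_of_forall_pow_mul_mem h.1 N fun i hi => ?_
      obtain ⟨a, ha, c, hc, rfl⟩ := Submodule.mem_sup.1 (hN hi)
      rw [add_mul]
      exact K.add_mem (hz a (Submodule.mem_sup_left ha)) (K.mul_mem_right _ hc))
    rw [zero_add] at hreg
    exact ⟨b, hb, hreg, ih (h.2 b hreg)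
      (hIJ.trans (Ideal.radical_mono (sup_le_sup_left le_sup_left _)))⟩

section Flat

variable {B : Type*} [CommRing B]

theorem mem_map_colon_of_flat {φ : A →+* B} (hφ : φ.Flat) {K : Ideal A} {h : A} {x : B}
    (hx : φ h * x ∈ K.map φ) : x ∈ (K.colon {h}).map φ := by
  algebraize [φ]
  obtain ⟨ι, _, k, c, hk, hsum⟩ : ∃ (ι : Type) (_ : Fintype ι) (k : ι → A) (c : ι → B),
      (∀ i, k i ∈ K) ∧ φ h * x = ∑ i, φ (k i) * c i := by
    refine Submodule.span_induction (p := fun y _ => ∃ (ι : Type) (_ : Fintype ι) (k : ι → A)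
      (c : ι → B), (∀ i, k i ∈ K) ∧ y = ∑ i, φ (k i) * c i) ?_ ?_ ?_ ?_ hx
    · rintro _ ⟨a, ha, rfl⟩
      exact ⟨Unit, inferInstance, fun _ => a, fun _ => 1, fun _ => ha, by simp⟩
    · exact ⟨Empty, inferInstance, nofun, nofun, nofun, by simp⟩
    · rintro _ _ _ _ ⟨ι, _, k, c, hk, rfl⟩ ⟨ι', _, k', c', hk', rfl⟩
      exact ⟨ι ⊕ ι', inferInstance, Sum.elim k k', Sum.elim c c',
        Sum.rec hk hk', by simp⟩
    · rintro b _ _ ⟨ι, _, k, c, hk, rfl⟩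
      refine ⟨ι, inferInstance, k, fun i => b * c i, hk, ?_⟩
      rw [smul_eq_mul, Finset.mul_sum]
      exact Finset.sum_congr rfl fun i _ => by ring
  obtain ⟨N, a, y, hy, ha⟩ := Module.Flat.isTrivialRelation_of_sum_smul_eq_zero
    (R := A) (M := B) (f := fun o : Option ι => o.elim h k)
    (x := fun o : Option ι => o.elim x fun i => -c i) (by
      simp [Fintype.sum_option, Algebra.smul_def, RingHom.algebraMap_toAlgebra, hsum])
  have hx' := hy none
  simp only [Option.elim_none] at hx'
  rw [hx']
  refine Ideal.sum_mem _ fun j _ => ?_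
  rw [Algebra.smul_def]
  refine Ideal.mul_mem_right _ _ (Ideal.mem_map_of_mem φ (Submodule.mem_colon_singleton.2 ?_))
  have := ha j
  rw [Fintype.sum_option] at this
  simp only [Option.elim_none, Option.elim_some] at this
  rw [smul_eq_mul, mul_comm, eq_neg_of_add_eq_zero_left this]
  exact neg_mem (Ideal.sum_mem _ fun i _ => K.mul_mem_right _ (hk i))

theorem RegMod.map {φ : A →+* B} (hφ : φ.Flat) {K : Ideal A} {h : A} (hK : RegMod K h) :
    RegMod (K.map φ) (φ h) := by
  intro x hx
  refine Ideal.map_mono (fun a ha => hK a ?_) (mem_map_colon_of_flat hφ hx)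
  rw [mul_comm]
  exact Submodule.mem_colon_singleton.1 ha

theorem Ideal.map_sup_span_singleton (φ : A →+* B) (K : Ideal A) (h : A) :
    (K ⊔ Ideal.span {h}).map φ = K.map φ ⊔ Ideal.span {φ h} := by
  rw [Ideal.map_sup, Ideal.map_span, Set.image_singleton]

theorem HasRegSeq.map {φ : A →+* B} (hφ : φ.Flat) {J : Ideal A} {r : ℕ} {K : Ideal A}
    (h : HasRegSeq J r K) : HasRegSeq (J.map φ) r (K.map φ) := by
  induction r generalizing K with
  | zero => trivial
  | succ r ih =>
    obtain ⟨x, hx, hreg, hs⟩ := h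
    refine ⟨φ x, Ideal.mem_map_of_mem φ hx, hreg.map hφ, ?_⟩
    rw [← Ideal.map_sup_span_singleton]
    exact ih hs

end Flat

end RegularSequences

section SmulTop

variable {A : Type*} [CommRing A] {V V' : Type*} [AddCommGroup V] [Module A V] [AddCommGroup V']
  [Module A V']

theorem LinearMap.map_mem_smul_top (f : V →ₗ[A] V') {K : Ideal A} {x : V}
    (hx : x ∈ K • (⊤ : Submodule A V)) : f x ∈ K • (⊤ : Submodule A V') := by
  have := Submodule.mem_map_of_mem (f := f) hx
  rw [Submodule.map_smul''] at this
  exact Submodule.smul_mono le_rfl le_top this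

theorem RegMod.mem_smul_top [Module.Free A V] {K : Ideal A} {h : A} (hh : RegMod K h) {x : V}
    (hx : h • x ∈ K • (⊤ : Submodule A V)) : x ∈ K • (⊤ : Submodule A V) := by
  let b := Module.Free.chooseBasis A V
  rw [← b.linearCombination_repr x, Finsupp.linearCombination_apply]
  refine Submodule.sum_mem _ fun i _ => Submodule.smul_mem_smul (hh _ ?_) trivial
  have := (b.coord i).map_mem_smul_top hx
  simpa using this

theorem mem_sup_span_singleton_smul_top {K : Ideal A} {y : A} {x : V} :
    x ∈ (K ⊔ Ideal.span {y}) • (⊤ : Submodule A V) ↔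
      ∃ v, x - y • v ∈ K • (⊤ : Submodule A V) := by
  rw [Submodule.sup_smul, Submodule.mem_sup]
  constructor
  · rintro ⟨a, ha, b, hb, rfl⟩
    rw [Submodule.ideal_span_singleton_smul] at hb
    obtain ⟨v, -, rfl⟩ := Submodule.mem_smul_pointwise_iff_exists _ _ _ |>.1 hb
    exact ⟨v, by simpa using ha⟩
  · rintro ⟨v, hv⟩
    exact ⟨_, hv, y • v, Submodule.smul_mem_smul (Ideal.mem_span_singleton_self y) trivial,
      by simp⟩

end SmulTop

namespace ExteriorAlgebra

variable {A : Type*} [CommRing A] {M : Type*} [AddCommGroup M] [Module A M]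

theorem mul_mem_smul_top (a : ExteriorAlgebra A M) {K : Ideal A} {x : ExteriorAlgebra A M}
    (hx : x ∈ K • (⊤ : Submodule A (ExteriorAlgebra A M))) :
    a * x ∈ K • (⊤ : Submodule A (ExteriorAlgebra A M)) :=
  (LinearMap.mulLeft A a).map_mem_smul_top hx

/-- Projection to the part of degree `i`. -/
noncomputable def degreeProj (i : ℕ) : ExteriorAlgebra A M →ₗ[A] ExteriorAlgebra A M :=
  GradedAlgebra.proj (fun i : ℕ => ⋀[A]^i M) i

theorem ι_mem_exteriorPower_one (v : M) : ι A v ∈ ⋀[A]^1 M := by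
  simpa only [pow_one] using LinearMap.mem_range_self _ v

theorem degreeProj_succ_ι_mul (i : ℕ) (v : M) (η : ExteriorAlgebra A M) :
    degreeProj (i + 1) (ι A v * η) = ι A v * degreeProj i η := by
  rw [add_comm]
  exact DirectSum.coe_decompose_mul_add_of_left_mem (fun i : ℕ => ⋀[A]^i M)
    (ι_mem_exteriorPower_one v)

theorem degreeProj_zero_ι_mul (v : M) (η : ExteriorAlgebra A M) :
    degreeProj 0 (ι A v * η) = 0 :=
  DirectSum.coe_decompose_mul_of_left_mem_of_not_le (fun i : ℕ => ⋀[A]^i M)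
    (ι_mem_exteriorPower_one v) (by simp)

theorem degreeProj_of_mem {i : ℕ} {x : ExteriorAlgebra A M} (hx : x ∈ ⋀[A]^i M) :
    degreeProj i x = x :=
  DirectSum.decompose_of_mem_same (fun i : ℕ => ⋀[A]^i M) hx

theorem degreeProj_of_mem_of_ne {i j : ℕ} (hij : i ≠ j) {x : ExteriorAlgebra A M}
    (hx : x ∈ ⋀[A]^i M) : degreeProj j x = 0 :=
  DirectSum.decompose_of_mem_ne (fun i : ℕ => ⋀[A]^i M) hx hij

theorem degreeProj_mem (i : ℕ) (x : ExteriorAlgebra A M) : degreeProj i x ∈ ⋀[A]^i M :=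
  (DirectSum.decompose (fun i : ℕ => ⋀[A]^i M) x i).2

/-- Projection to the part of degree `< r`. -/
noncomputable def trunc (r : ℕ) : ExteriorAlgebra A M →ₗ[A] ExteriorAlgebra A M :=
  ∑ i ∈ Finset.range r, degreeProj i

theorem trunc_apply (r : ℕ) (x : ExteriorAlgebra A M) :
    trunc r x = ∑ i ∈ Finset.range r, degreeProj i x := by
  simp [trunc]

theorem trunc_succ_ι_mul (r : ℕ) (v : M) (η : ExteriorAlgebra A M) :
    trunc (r + 1) (ι A v * η) = ι A v * trunc r η := by
  simp [trunc_apply, Finset.sum_range_succ', degreeProj_succ_ι_mul, degreeProj_zero_ι_mul,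
    Finset.mul_sum]

theorem trunc_of_mem {i r : ℕ} (hi : i < r) {x : ExteriorAlgebra A M} (hx : x ∈ ⋀[A]^i M) :
    trunc r x = x := by
  rw [trunc_apply, Finset.sum_eq_single_of_mem i (Finset.mem_range.2 hi), degreeProj_of_mem hx]
  exact fun j _ hj => degreeProj_of_mem_of_ne hj.symm hx

theorem trunc_trunc {r s : ℕ} (hrs : r ≤ s) (x : ExteriorAlgebra A M) :
    trunc s (trunc r x) = trunc r x := by
  rw [trunc_apply r, map_sum]
  exact Finset.sum_congr rfl fun i hi =>
    trunc_of_mem ((Finset.mem_range.1 hi).trans_le hrs) (degreeProj_mem i x)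

theorem trunc_eq_of_le {r s : ℕ} (hrs : r ≤ s) {x : ExteriorAlgebra A M} (hx : trunc r x = x) :
    trunc s x = x := by
  rw [← hx, trunc_trunc hrs]

theorem exists_trunc_ι_mul (r : ℕ) (v : M) (η : ExteriorAlgebra A M) :
    ∃ ζ, trunc r ζ = ζ ∧ trunc r (ι A v * η) = ι A v * ζ := by
  cases r with
  | zero => exact ⟨0, by simp, by simp [trunc_apply]⟩
  | succ r => exact ⟨trunc r η, trunc_trunc r.le_succ η, trunc_succ_ι_mul r v η⟩

section Division

variable {k : ℕ} (w : Fin k → M)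

/-- The product of the `w i`, for `i` running through a list. -/
noncomputable def wedgeList (L : List (Fin k)) : ExteriorAlgebra A M :=
  (L.map fun i => ι A (w i)).prod

theorem wedgeList_append (L L' : List (Fin k)) :
    wedgeList (A := A) w (L ++ L') = wedgeList w L * wedgeList w L' := by
  simp [wedgeList]

theorem wedgeList_cons (i : Fin k) (L : List (Fin k)) :
    wedgeList (A := A) w (i :: L) = ι A (w i) * wedgeList w L := by
  simp [wedgeList]

theorem wedgeList_perm {L L' : List (Fin k)} (h : L.Perm L') :
    wedgeList (A := A) w L = wedgeList w L' ∨ wedgeList (A := A) w L = -wedgeList w L' := by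
  induction h with
  | nil => exact Or.inl rfl
  | cons i _ ih =>
    simp only [wedgeList_cons]
    rcases ih with h | h
    · exact Or.inl (by rw [h])
    · exact Or.inr (by rw [h, mul_neg])
  | swap i j L =>
    right
    simp only [wedgeList_cons, ← mul_assoc]
    rw [eq_neg_of_add_eq_zero_left (ι_add_mul_swap (R := A) (w j) (w i)), neg_mul]
  | trans _ _ ih₁ ih₂ =>
    rcases ih₁ with h | h <;> rcases ih₂ with h' | h' <;> simp [h, h']

theorem wedgeList_eq_zero {L : List (Fin k)} (h : ¬ L.Nodup) : wedgeList (A := A) w L = 0 := by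
  have : wedgeList (A := A) w L = ιMulti A L.length fun i => w (L.get i) := by
    rw [ιMulti_apply, wedgeList]
    congr 1
    conv_lhs => rw [← List.ofFn_get L, List.map_ofFn]
    rfl
  rw [this]
  refine ιMulti_eq_zero_of_not_inj fun hinj => h (List.nodup_iff_injective_get.2 ?_)
  exact Function.Injective.of_comp (f := w) hinj

/-- The submodule `Σ w i ∧ Λ`. -/
def wedgeSpan : Submodule A (ExteriorAlgebra A M) :=
  Submodule.span A {x | ∃ i η, x = ι A (w i) * η}

theorem exists_sum_of_mem_wedgeSpan {x : ExteriorAlgebra A M} (hx : x ∈ wedgeSpan (A := A) w) :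
    ∃ η : Fin k → ExteriorAlgebra A M, x = ∑ i, ι A (w i) * η i := by
  refine Submodule.span_induction (p := fun x _ => ∃ η : Fin k → ExteriorAlgebra A M,
    x = ∑ i, ι A (w i) * η i) ?_ ?_ ?_ ?_ hx
  · rintro _ ⟨i, η, rfl⟩
    exact ⟨Pi.single i η, by simp [Pi.single_apply]⟩
  · exact ⟨0, by simp⟩
  · rintro _ _ _ _ ⟨η, rfl⟩ ⟨η', rfl⟩
    exact ⟨η + η', by simp [mul_add, Finset.sum_add_distrib]⟩
  · rintro c _ _ ⟨η, rfl⟩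
    exact ⟨c • η, by simp [Finset.smul_sum]⟩

/-- The ideal of all `c` with `c ω ∈ Σ w i ∧ Λ + K Λ` whenever
`w 0 ∧ ⋯ ∧ w (k - 1) ∧ ω ∈ K Λ`. -/
def divisionIdeal : Ideal A where
  carrier := {c | ∀ (K : Ideal A) (ω : ExteriorAlgebra A M),
    wedgeList w (List.finRange k) * ω ∈ K • (⊤ : Submodule A (ExteriorAlgebra A M)) →
    c • ω ∈ wedgeSpan (A := A) w ⊔ K • ⊤}
  add_mem' ha hb K ω h := by
    rw [add_smul]
    exact Submodule.add_mem _ (ha K ω h) (hb K ω h)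
  zero_mem' K ω _ := by simp
  smul_mem' c x hx K ω h := by
    rw [smul_assoc]
    exact Submodule.smul_mem _ _ (hx K ω h)

/-- The span of the `w i₁ ∧ ⋯ ∧ w iₛ ∧ ξ` with `ξ` of degree `< r`. -/
def wedgeFiltration (s r : ℕ) : Submodule A (ExteriorAlgebra A M) :=
  Submodule.span A {x | ∃ (L : List (Fin k)) (ξ : ExteriorAlgebra A M),
    L.length = s ∧ trunc r ξ = ξ ∧ x = wedgeList w L * ξ}

theorem wedgeFiltration_eq_bot (r : ℕ) {s : ℕ} (hs : k < s) :
    wedgeFiltration (A := A) w s r = ⊥ := by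
  rw [wedgeFiltration, Submodule.span_eq_bot]
  rintro _ ⟨L, ξ, hL, -, rfl⟩
  rw [wedgeList_eq_zero, zero_mul]
  intro hnd
  have := hnd.length_le_card
  simp at this
  omega

theorem exists_sum_of_mem_wedgeFiltration {s r : ℕ} {x : ExteriorAlgebra A M}
    (hx : x ∈ wedgeFiltration (A := A) w s r) :
    ∃ ξ : Finset (Fin k) → ExteriorAlgebra A M, (∀ S, trunc r (ξ S) = ξ S) ∧
      x = ∑ S ∈ Finset.univ.powersetCard s, wedgeList w S.toList * ξ S := by
  refine Submodule.span_induction (p := fun x _ => ∃ ξ : Finset (Fin k) → ExteriorAlgebra A M,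
    (∀ S, trunc r (ξ S) = ξ S) ∧
      x = ∑ S ∈ Finset.univ.powersetCard s, wedgeList w S.toList * ξ S) ?_ ?_ ?_ ?_ hx
  · rintro _ ⟨L, ξ, hL, hξ, rfl⟩
    by_cases hnd : L.Nodup
    · have hp : L.Perm L.toFinset.toList := by
        refine (List.perm_ext_iff_of_nodup hnd (Finset.nodup_toList _)).2 fun a => ?_
        simp
      have hmem : L.toFinset ∈ (Finset.univ : Finset (Fin k)).powersetCard s := by
        simp [Finset.mem_powersetCard, List.toFinset_card_of_nodup hnd, hL]
      rcases wedgeList_perm (A := A) w hp with h | h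
      · refine ⟨Pi.single L.toFinset ξ, fun S => ?_, ?_⟩
        · by_cases hS : S = L.toFinset
          · subst hS; simpa using hξ
          · simp [hS]
        · rw [Finset.sum_eq_single_of_mem _ hmem, h]
          · simp
          · intro S _ hS; simp [hS]
      · refine ⟨Pi.single L.toFinset (-ξ), fun S => ?_, ?_⟩
        · by_cases hS : S = L.toFinset
          · subst hS; simpa using hξ
          · simp [hS]
        · rw [Finset.sum_eq_single_of_mem _ hmem, h]
          · simp
          · intro S _ hS; simp [hS]
    · exact ⟨0, by simp, by simp [wedgeList_eq_zero (A := A) w hnd]⟩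
  · exact ⟨0, by simp, by simp⟩
  · rintro _ _ _ _ ⟨ξ, h, rfl⟩ ⟨ξ', h', rfl⟩
    exact ⟨ξ + ξ', fun S => by simp [h, h'], by simp [mul_add, Finset.sum_add_distrib]⟩
  · rintro c _ _ ⟨ξ, h, rfl⟩
    exact ⟨c • ξ, fun S => by simp [h], by simp [Finset.smul_sum]⟩

theorem wedgeList_mul_mem_smul_wedgeSpan {K : Ideal A} {L : List (Fin k)} (hL : L ≠ [])
    {x : ExteriorAlgebra A M} (hx : x ∈ K • (⊤ : Submodule A (ExteriorAlgebra A M))) :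
    wedgeList w L * x ∈ K • wedgeSpan (A := A) w := by
  obtain ⟨i, L, rfl⟩ := List.exists_cons_of_ne_nil hL
  have h := Submodule.mem_map_of_mem (f := LinearMap.mulLeft A (wedgeList w (i :: L))) hx
  rw [Submodule.map_smul''] at h
  refine Submodule.smul_mono le_rfl ?_ h
  rintro _ ⟨y, -, rfl⟩
  exact Submodule.subset_span ⟨i, wedgeList w L * y, by simp [wedgeList_cons]⟩

theorem wedgeSpan_trunc {r : ℕ} {K : Ideal A} {x : ExteriorAlgebra A M} (hx : trunc r x = x)
    (h : x ∈ wedgeSpan (A := A) w ⊔ K • ⊤) :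
    ∃ ζ : Fin k → ExteriorAlgebra A M, (∀ i, trunc r (ζ i) = ζ i) ∧
      x - ∑ i, ι A (w i) * ζ i ∈ K • (⊤ : Submodule A (ExteriorAlgebra A M)) := by
  obtain ⟨a, ha, b, hb, rfl⟩ := Submodule.mem_sup.1 h
  obtain ⟨η, rfl⟩ := exists_sum_of_mem_wedgeSpan w ha
  choose ζ hζ hζ' using fun i => exists_trunc_ι_mul r (w i) (η i)
  refine ⟨ζ, hζ, ?_⟩
  rw [← hx, map_add, map_sum, Finset.sum_congr rfl fun i _ => hζ' i, add_sub_cancel_left]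
  exact (trunc r).map_mem_smul_top hb

theorem mem_wedgeFiltration_succ {r s : ℕ} {K : Ideal A}
    (hK : ∀ ω : ExteriorAlgebra A M, trunc r ω = ω →
      wedgeList w (List.finRange k) * ω ∈ K • (⊤ : Submodule A (ExteriorAlgebra A M)) →
      ω ∈ wedgeSpan (A := A) w ⊔ K • ⊤) (hs : 1 ≤ s) {x : ExteriorAlgebra A M}
    (hx : x ∈ wedgeFiltration (A := A) w s r)
    (hxK : x ∈ K • (⊤ : Submodule A (ExteriorAlgebra A M))) :
    x ∈ wedgeFiltration (A := A) w (s + 1) r ⊔ K • wedgeSpan (A := A) w := by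
  obtain ⟨ξ, hξ, rfl⟩ := exists_sum_of_mem_wedgeFiltration w hx
  refine Submodule.sum_mem _ fun S hS => ?_
  have hcard := (Finset.mem_powersetCard.1 hS).2
  have hmul := mul_mem_smul_top (wedgeList w Sᶜ.toList) hxK
  rw [Finset.mul_sum, Finset.sum_eq_single_of_mem S hS] at hmul
  · rw [← mul_assoc, ← wedgeList_append] at hmul
    have hp : (Sᶜ.toList ++ S.toList).Perm (List.finRange k) := by
      refine (List.perm_ext_iff_of_nodup ?_ (List.nodup_finRange k)).2 fun a => ?_
      · rw [List.nodup_append']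
        refine ⟨Finset.nodup_toList _, Finset.nodup_toList _, fun a ha ha' => ?_⟩
        simp only [Finset.mem_toList, Finset.mem_compl] at ha ha'
        exact ha ha'
      · simp only [List.mem_append, Finset.mem_toList, Finset.mem_compl, List.mem_finRange,
          iff_true]
        tauto
    have hmem : ξ S ∈ wedgeSpan (A := A) w ⊔ K • ⊤ := by
      refine hK _ (hξ S) ?_
      rcases wedgeList_perm (A := A) w hp with h | h
      · rwa [h] at hmul
      · rw [h, neg_mul] at hmul
        exact (Submodule.neg_mem_iff _).1 hmul
    obtain ⟨ζ, hζ, hζ'⟩ := wedgeSpan_trunc w (hξ S) hmem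
    rw [← add_sub_cancel (∑ i, ι A (w i) * ζ i) (ξ S), mul_add, Finset.mul_sum]
    refine Submodule.add_mem_sup (Submodule.sum_mem _ fun i _ => ?_)
      (wedgeList_mul_mem_smul_wedgeSpan w ?_ hζ')
    · refine Submodule.subset_span ⟨S.toList ++ [i], ζ i, by simp [hcard], hζ i, ?_⟩
      simp [mul_assoc, wedgeList]
    · intro h0
      have := Finset.length_toList S
      rw [h0, hcard] at this
      simp at this
      omega
  · intro T hT hTS
    rw [← mul_assoc, ← wedgeList_append, wedgeList_eq_zero, zero_mul]
    intro hnd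
    refine hTS (Finset.eq_of_subset_of_card_le (fun a ha => ?_) ?_)
    · by_contra haS
      exact (List.nodup_append'.1 hnd).2.2 (show a ∈ _ by simpa using haS) (by simpa using ha)
    · rw [hcard, (Finset.mem_powersetCard.1 hT).2]

theorem mem_smul_wedgeSpan {r : ℕ} {K : Ideal A}
    (hK : ∀ ω : ExteriorAlgebra A M, trunc r ω = ω →
      wedgeList w (List.finRange k) * ω ∈ K • (⊤ : Submodule A (ExteriorAlgebra A M)) →
      ω ∈ wedgeSpan (A := A) w ⊔ K • ⊤) {x : ExteriorAlgebra A M}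
    (hx : x ∈ wedgeFiltration (A := A) w 1 r)
    (hxK : x ∈ K • (⊤ : Submodule A (ExteriorAlgebra A M))) :
    x ∈ K • wedgeSpan (A := A) w := by
  have key : ∀ s, x ∈ wedgeFiltration (A := A) w (s + 1) r ⊔ K • wedgeSpan (A := A) w := by
    intro s
    induction s with
    | zero => exact Submodule.mem_sup_left hx
    | succ s ih =>
      obtain ⟨a, ha, b, hb, rfl⟩ := Submodule.mem_sup.1 ih
      refine Submodule.add_mem _ (mem_wedgeFiltration_succ w hK s.succ_pos ha ?_)
        (Submodule.mem_sup_right hb)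
      simpa using Submodule.sub_mem _ hxK (Submodule.smul_mono le_rfl le_top hb)
  have := key k
  rwa [wedgeFiltration_eq_bot w r k.lt_succ_self, bot_sup_eq] at this

/-- Saito's generalization of de Rham's division lemma. -/
theorem mem_wedgeSpan_of_hasRegSeq [Module.Free A (ExteriorAlgebra A M)] {r : ℕ} {K : Ideal A}
    (hK : HasRegSeq (divisionIdeal w) r K) {β : ExteriorAlgebra A M} (hβ : trunc r β = β)
    (h : wedgeList w (List.finRange k) * β ∈ K • (⊤ : Submodule A (ExteriorAlgebra A M))) :
    β ∈ wedgeSpan (A := A) w ⊔ K • ⊤ := by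
  induction r generalizing K β with
  | zero => rw [← hβ]; simp [trunc_apply]
  | succ r ih =>
    obtain ⟨c, hc, hreg, hseq⟩ := hK
    obtain ⟨a, ha, b, hb, hab⟩ := Submodule.mem_sup.1 (hc K β h)
    obtain ⟨η, rfl⟩ := exists_sum_of_mem_wedgeSpan w ha
    have hx : c • β = (∑ i, ι A (w i) * trunc r (η i)) + trunc (r + 1) b := by
      conv_lhs => rw [← hβ, ← map_smul, ← hab]
      simp [trunc_succ_ι_mul]
    have hb' := (trunc (r + 1)).map_mem_smul_top hb
    have hmem : (∑ i, ι A (w i) * trunc r (η i)) ∈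
        (K ⊔ Ideal.span {c}) • wedgeSpan (A := A) w := by
      refine mem_smul_wedgeSpan (r := r) w (fun ω hω h => ih hseq hω h)
        (Submodule.sum_mem _ fun i _ => ?_) (mem_sup_span_singleton_smul_top.2 ⟨β, ?_⟩)
      · exact Submodule.subset_span ⟨[i], trunc r (η i), rfl, trunc_trunc le_rfl _,
          by simp [wedgeList]⟩
      · rw [hx, sub_add_cancel_left]
        exact neg_mem hb'
    rw [Submodule.sup_smul, Submodule.mem_sup] at hmem
    obtain ⟨u, hu, v, hv, huv⟩ := hmem
    rw [Submodule.ideal_span_singleton_smul] at hv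
    obtain ⟨v', hv', rfl⟩ := (Submodule.mem_smul_pointwise_iff_exists _ _ _).1 hv
    rw [← add_sub_cancel v' β]
    refine Submodule.add_mem_sup hv' (hreg.mem_smul_top ?_)
    rw [smul_sub, hx, ← huv, add_right_comm, add_sub_cancel_right]
    exact Submodule.add_mem _ (Submodule.smul_mono le_rfl le_top hu) hb'

theorem ι_mul_contractLeft_wedgeList_mul {d : Fin k → Module.Dual A M} {i : Fin k}
    (hd : ∀ j, i ≠ j → d i (w j) = 0) {L : List (Fin k)} (hi : i ∉ L)
    (ω : ExteriorAlgebra A M) :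
    ι A (w i) * CliffordAlgebra.contractLeft (d i) (wedgeList w L * ω) =
      wedgeList w L * (ι A (w i) * CliffordAlgebra.contractLeft (d i) ω) := by
  induction L with
  | nil => simp [wedgeList]
  | cons j L ih =>
    rw [List.mem_cons, not_or] at hi
    rw [wedgeList_cons, mul_assoc, mul_assoc, ← ih hi.2, CliffordAlgebra.contractLeft_ι_mul,
      hd j hi.1, zero_smul, zero_sub, mul_neg, ← mul_assoc, ← mul_assoc,
      eq_neg_of_add_eq_zero_left (ι_add_mul_swap (R := A) (w i) (w j)), neg_mul, neg_neg]

theorem pow_smul_mem_of_wedgeList_mul_mem {d : Fin k → Module.Dual A M} {c : A}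
    (hd : ∀ i j, d i (w j) = if i = j then c else 0) {N : Submodule A (ExteriorAlgebra A M)}
    (hN : ∀ i, ∀ x ∈ N, CliffordAlgebra.contractLeft (d i) x ∈ N) {L : List (Fin k)}
    (hL : L.Nodup) {ω : ExteriorAlgebra A M} (hω : wedgeList w L * ω ∈ N) :
    c ^ L.length • ω ∈ wedgeSpan (A := A) w ⊔ N := by
  induction L generalizing ω with
  | nil => exact Submodule.mem_sup_right (by simpa [wedgeList] using hω)
  | cons i L ih =>
    rw [List.nodup_cons] at hL
    have h := hN i _ hω
    rw [wedgeList_cons, mul_assoc, CliffordAlgebra.contractLeft_ι_mul, hd, if_pos rfl,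
      ι_mul_contractLeft_wedgeList_mul w (fun j hj => by rw [hd, if_neg hj]) hL.1,
      ← mul_smul_comm, ← mul_sub] at h
    have h' := ih hL.2 h
    rw [smul_sub] at h'
    have h'' : c ^ L.length • (ι A (w i) * CliffordAlgebra.contractLeft (d i) ω) ∈
        wedgeSpan (A := A) w ⊔ N :=
      Submodule.mem_sup_left (Submodule.smul_mem _ _ (Submodule.subset_span ⟨i, _, rfl⟩))
    have := Submodule.add_mem _ h' h''
    rwa [sub_add_cancel, smul_smul, ← pow_succ] at this

theorem pow_mem_divisionIdeal {d : Fin k → Module.Dual A M} {c : A}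
    (hd : ∀ i j, d i (w j) = if i = j then c else 0) : c ^ k ∈ divisionIdeal w := by
  intro K ω hω
  have := pow_smul_mem_of_wedgeList_mul_mem w hd (N := K • ⊤)
    (fun i x hx => (CliffordAlgebra.contractLeft (d i)).map_mem_smul_top hx)
    (List.nodup_finRange k) hω
  simpa using this

end Division

theorem trunc_one_algebraMap (a : A) : trunc 1 (algebraMap A (ExteriorAlgebra A M) a) =
    algebraMap A (ExteriorAlgebra A M) a :=
  trunc_of_mem zero_lt_one (by simp)

theorem wedgeList_single (x : M) : wedgeList (A := A) (fun _ : Fin 1 => x) (List.finRange 1) =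
    ι A x := by
  simp [wedgeList, List.finRange_succ]

theorem apply_mem_divisionIdeal (x : M) (d : Module.Dual A M) :
    d x ∈ divisionIdeal (A := A) fun _ : Fin 1 => x := by
  have := pow_mem_divisionIdeal (A := A) (fun _ : Fin 1 => x) (d := fun _ => d) (c := d x)
    (fun i j => by simp [Subsingleton.elim i j])
  simpa using this

/-- If every `ω` of degree `< r` with `x ∧ ω ∈ K Λ` lies in `x ∧ Λ + K Λ`, then the depth of the
ideal of coordinates of `x` is at least `r` modulo `K`. -/
theorem colonTrivial_of_exact [Module.Free A (ExteriorAlgebra A M)] {x : M} {J : Ideal A}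
    (hJ : ∀ K : Ideal A, ∀ z, (∀ i ∈ J, i * z ∈ K) → z • x ∈ K • (⊤ : Submodule A M)) {r : ℕ}
    {K : Ideal A} (h : ∀ ω : ExteriorAlgebra A M, trunc r ω = ω →
      ι A x * ω ∈ K • (⊤ : Submodule A (ExteriorAlgebra A M)) →
      ω ∈ wedgeSpan (A := A) (fun _ : Fin 1 => x) ⊔ K • ⊤) : ColonTrivial J r K := by
  induction r generalizing K with
  | zero => trivial
  | succ r ih =>
    refine ⟨fun z hz => ?_, fun y hy => ih fun ω hω hxω => ?_⟩
    · have hmem := h (algebraMap A _ z)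
        (trunc_eq_of_le (Nat.succ_le_succ r.zero_le) (trunc_one_algebraMap z)) (by
          rw [← Algebra.commutes, ← Algebra.smul_def, ← map_smul]
          exact (ι A).map_mem_smul_top (hJ K z hz))
      obtain ⟨a, ha, b, hb, hab⟩ := Submodule.mem_sup.1 hmem
      obtain ⟨η, rfl⟩ := exists_sum_of_mem_wedgeSpan _ ha
      have hb' := (algebraMapInv (R := A) (M := M)).toLinearMap.map_mem_smul_top hb
      have hz' := congrArg (algebraMapInv (R := A) (M := M)) hab
      rw [algebraMap_leftInverse] at hz'
      rw [← hz']
      simpa [algebraMapInv] using hb'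
    · obtain ⟨σ, hσ⟩ := mem_sup_span_singleton_smul_top.1 hxω
      have hσ' := (trunc (r + 1)).map_mem_smul_top hσ
      rw [map_sub, map_smul, trunc_succ_ι_mul, hω] at hσ'
      have h1 : ι A x * trunc (r + 1) σ ∈ K • (⊤ : Submodule A (ExteriorAlgebra A M)) := by
        refine hy.mem_smul_top ?_
        have := mul_mem_smul_top (ι A x) hσ'
        rw [mul_sub, ← mul_assoc, ι_sq_zero, zero_mul, zero_sub, Submodule.neg_mem_iff,
          mul_smul_comm] at this
        exact this
      have h2 := h _ (trunc_trunc le_rfl σ) h1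
      obtain ⟨a, ha, b, hb, hab⟩ := Submodule.mem_sup.1 h2
      obtain ⟨τ, rfl⟩ := exists_sum_of_mem_wedgeSpan _ ha
      rw [Fin.sum_univ_one] at hab
      have h3 := congrArg (trunc (r + 1)) hab
      rw [map_add, trunc_succ_ι_mul, trunc_trunc le_rfl] at h3
      have hb' := (trunc (r + 1)).map_mem_smul_top hb
      have h4 := h (ω - y • trunc r (τ 0))
        (by rw [map_sub, map_smul, trunc_trunc r.le_succ, trunc_eq_of_le r.le_succ hω]) (by
          have := Submodule.add_mem _ hσ' (Submodule.smul_mem _ y hb')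
          rw [← h3, smul_add, ← sub_sub, sub_add_cancel] at this
          rwa [mul_sub, mul_smul_comm])
      rw [← sub_add_cancel ω (y • trunc r (τ 0))]
      refine Submodule.add_mem _
        (sup_le_sup_left (Submodule.smul_mono le_sup_left le_rfl) (wedgeSpan _) h4)
        (Submodule.mem_sup_right (Submodule.smul_mem_smul
          (Submodule.mem_sup_right (Ideal.mem_span_singleton_self y)) trivial))

end ExteriorAlgebra

theorem HasRegSeq.colonTrivial {A : Type*} [CommRing A] {N : ℕ} (x : Fin N → A) {r : ℕ}
    {K : Ideal A} (h : HasRegSeq (Ideal.span (Set.range x)) r K) :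
    ColonTrivial (Ideal.span (Set.range x)) r K := by
  have : Module.Free A (ExteriorAlgebra A (Fin N → A)) :=
    Module.Free.of_basis (Pi.basisFun A (Fin N)).ExteriorAlgebra
  refine ExteriorAlgebra.colonTrivial_of_exact (x := x) (fun K z hz => ?_) fun ω hω hxω => ?_
  · rw [← (Pi.basisFun A (Fin N)).sum_repr (z • x)]
    refine Submodule.sum_mem _ fun i _ => Submodule.smul_mem_smul ?_ trivial
    have := hz (x i) (Ideal.subset_span ⟨i, rfl⟩)
    rw [mul_comm] at this
    simpa using this
  · refine ExteriorAlgebra.mem_wedgeSpan_of_hasRegSeq _ (h.mono ?_) hω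
      (by rwa [ExteriorAlgebra.wedgeList_single])
    rw [Ideal.span_le]
    rintro _ ⟨i, rfl⟩
    exact ExteriorAlgebra.apply_mem_divisionIdeal x (LinearMap.proj i)

namespace MvPolynomial

theorem regMod_X_of_notMem {σ R : Type*} [CommRing R] {s : Set σ} {i : σ} (hi : i ∉ s) :
    RegMod (Ideal.span (X '' s : Set (MvPolynomial σ R))) (X i) := by
  intro p hp
  rw [mem_ideal_span_X_image] at hp ⊢
  intro m hm
  have : Finsupp.single i 1 + m ∈ (X i * p).support := by
    rw [mem_support_iff, add_comm, mul_comm, coeff_mul_X]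
    exact mem_support_iff.1 hm
  obtain ⟨j, hj, hjm⟩ := hp _ this
  refine ⟨j, hj, ?_⟩
  have hij : i ≠ j := fun h => hi (h ▸ hj)
  simpa [hij] using hjm

theorem hasRegSeq_X_aux {n : ℕ} {R : Type*} [CommRing R] (r s : ℕ) (hrs : r + s = n) :
    HasRegSeq (Ideal.span (Set.range (X : Fin n → MvPolynomial (Fin n) R))) r
      (Ideal.span (X '' {i : Fin n | i.val < s})) := by
  induction r generalizing s with
  | zero => trivial
  | succ r ih =>
    refine ⟨X ⟨s, by omega⟩, Ideal.subset_span ⟨_, rfl⟩, regMod_X_of_notMem (by simp), ?_⟩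
    have := ih (s + 1) (by omega)
    convert this using 1
    rw [← Ideal.span_union, ← Set.image_singleton, ← Set.image_union]
    congr 2
    ext i
    simp [Fin.ext_iff, le_iff_lt_or_eq]
    tauto

theorem hasRegSeq_X (n : ℕ) (R : Type*) [CommRing R] :
    HasRegSeq (Ideal.span (Set.range (X : Fin n → MvPolynomial (Fin n) R))) n ⊥ := by
  simpa using hasRegSeq_X_aux (R := R) n 0 (by simp)

theorem flat_map {σ R S : Type*} [CommRing R] [CommRing S] {f : R →+* S} (hf : f.Flat) :
    (map f : MvPolynomial σ R →+* MvPolynomial σ S).Flat := by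
  algebraize [f]
  let _ : Algebra (MvPolynomial σ R) (MvPolynomial σ S) := algebraMvPolynomial
  have : Algebra.IsPushout R (MvPolynomial σ R) S (MvPolynomial σ S) := inferInstance
  have : (algebraMap (MvPolynomial σ R) (MvPolynomial σ S)).Flat := by
    rw [RingHom.flat_algebraMap_iff]
    exact Module.Flat.isBaseChange R (MvPolynomial σ R) S (MvPolynomial σ S) (Algebra.IsPushout.out)
  exact this

section Translate

variable {σ K : Type*} [CommRing K] (a : σ → K)

/-- The translation `X i ↦ X i - C (a i)`. -/
noncomputable def translate : MvPolynomial σ K →+* MvPolynomial σ K :=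
  eval₂Hom C fun i => X i - C (a i)

theorem bijective_translate : Function.Bijective (translate a) := by
  have h : ∀ b : σ → K, (translate (-b)).comp (translate b) = RingHom.id (MvPolynomial σ K) := by
    intro b
    apply ringHom_ext <;> intro i <;> simp [translate]
  have h' := h (-a)
  rw [neg_neg] at h'
  exact Function.bijective_iff_has_inverse.2 ⟨translate (-a), fun x => DFunLike.congr_fun (h a) x,
    fun x => DFunLike.congr_fun h' x⟩

/-- The maximal ideal of polynomials vanishing at `a`. -/
noncomputable def pointIdeal : Ideal (MvPolynomial σ K) := RingHom.ker (eval a)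

theorem mem_pointIdeal {p : MvPolynomial σ K} : p ∈ pointIdeal a ↔ eval a p = 0 := Iff.rfl

theorem pointIdeal_eq_span :
    pointIdeal a = Ideal.span (Set.range fun i => X i - C (a i)) := by
  apply le_antisymm
  · intro p hp
    rw [← Ideal.Quotient.eq_zero_iff_mem]
    have : Ideal.Quotient.mk (Ideal.span (Set.range fun i => X i - C (a i))) =
        (Ideal.Quotient.mk _).comp (C.comp (eval a)) := by
      apply ringHom_ext
      · intro r
        simp
      · intro i
        simp only [RingHom.comp_apply, eval_X]
        rw [Ideal.Quotient.eq]
        exact Ideal.subset_span ⟨i, rfl⟩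
    rw [this, RingHom.comp_apply, RingHom.comp_apply, (mem_pointIdeal a).1 hp, map_zero, map_zero]
  · rw [Ideal.span_le]
    rintro _ ⟨i, rfl⟩
    simp [mem_pointIdeal]

end Translate

instance {σ K : Type*} [Field K] (a : σ → K) : (pointIdeal a).IsMaximal :=
  RingHom.ker_isMaximal_of_surjective (eval a) (fun x => ⟨C x, by simp⟩)

theorem hasRegSeq_pointIdeal {n : ℕ} {K : Type*} [CommRing K] (a : Fin n → K) :
    HasRegSeq (pointIdeal a) n ⊥ := by
  have := (hasRegSeq_X n K).map (φ := translate a)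
    (RingHom.Flat.of_bijective (bijective_translate a))
  rw [Ideal.map_bot, Ideal.map_span, ← Set.range_comp] at this
  have hX : translate a ∘ X = fun i => X i - C (a i) := by
    funext i
    simp [translate]
  rwa [hX, ← pointIdeal_eq_span] at this

theorem mem_pointIdeal_sq {n : ℕ} {K : Type*} [CommRing K] {a : Fin n → K}
    {p : MvPolynomial (Fin n) K} (hp : eval a p = 0) (hd : ∀ j, eval a (pderiv j p) = 0) :
    p ∈ pointIdeal a ^ 2 := by
  have hp' := (mem_pointIdeal a).2 hp
  rw [pointIdeal_eq_span, Ideal.mem_span_range_iff_exists_fun] at hp'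
  obtain ⟨q, hq⟩ := hp'
  have hqa : ∀ j, eval a (q j) = 0 := by
    intro j
    have := hd j
    rw [← hq] at this
    simpa [pderiv_X, Pi.single_apply, apply_ite (eval a)] using this
  rw [← hq, sq]
  refine Ideal.sum_mem _ fun i _ => Ideal.mul_mem_mul (hqa i) ?_
  simp [mem_pointIdeal]

end MvPolynomial

namespace MvPolynomial

section LocalRing

variable {n : ℕ} {K : Type*} [Field K] (a : Fin n → K)

/-- The gradient of a polynomial at a point. -/
noncomputable def gradAt (p : MvPolynomial (Fin n) K) : Fin n → K := fun j => eval a (pderiv j p)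

theorem pointIdeal_le_sup_sq {ι : Type*} [Fintype ι] {f : ι → MvPolynomial (Fin n) K}
    (hf : ∀ i, eval a (f i) = 0)
    (hspan : Submodule.span K (Set.range fun i => gradAt a (f i)) = ⊤) :
    pointIdeal a ≤ Ideal.span (Set.range f) ⊔ pointIdeal a ^ 2 := by
  conv_lhs => rw [pointIdeal_eq_span]
  rw [Ideal.span_le]
  rintro _ ⟨j, rfl⟩
  have hj : (Pi.single j 1 : Fin n → K) ∈ Submodule.span K (Set.range fun i => gradAt a (f i)) := by
    rw [hspan]
    trivial
  rw [Submodule.mem_span_range_iff_exists_fun] at hj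
  obtain ⟨c, hc⟩ := hj
  have h1 : ∑ i, C (c i) * f i ∈ Ideal.span (Set.range f) :=
    Ideal.sum_mem _ fun i _ => Ideal.mul_mem_left _ _ (Ideal.subset_span ⟨i, rfl⟩)
  have h2 : (X j - C (a j)) - ∑ i, C (c i) * f i ∈ pointIdeal a ^ 2 := by
    apply mem_pointIdeal_sq
    · simp [hf]
    · intro k
      have := congrFun hc k
      simp only [Finset.sum_apply, Pi.smul_apply, gradAt, smul_eq_mul] at this
      simp only [map_sub, map_sum, Derivation.leibniz, pderiv_C, pderiv_X, smul_eq_mul, mul_zero,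
        add_zero, sub_zero, map_mul, eval_C, this]
      rcases eq_or_ne j k with rfl | h
      · simp
      · simp [h, h.symm]
  have := Submodule.add_mem_sup h1 h2
  simpa using this

theorem colonTrivial_localization_of_span_eq_top {f : Fin n → MvPolynomial (Fin n) K}
    (hf : ∀ i, eval a (f i) = 0)
    (hspan : Submodule.span K (Set.range fun i => gradAt a (f i)) = ⊤) :
    ColonTrivial ((Ideal.span (Set.range f)).map
      (algebraMap _ (Localization.AtPrime (pointIdeal a)))) n ⊥ := by
  set φ := algebraMap (MvPolynomial (Fin n) K) (Localization.AtPrime (pointIdeal a)) with hφ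
  have hmax : (pointIdeal a).map φ = IsLocalRing.maximalIdeal _ :=
    Localization.AtPrime.map_eq_maximalIdeal
  have hle : (pointIdeal a).map φ ≤ (Ideal.span (Set.range f)).map φ := by
    refine Submodule.le_of_le_smul_of_le_jacobson_bot (I := (pointIdeal a).map φ)
      (IsNoetherian.noetherian _) ?_ ?_
    · rw [hmax]
      exact IsLocalRing.maximalIdeal_le_jacobson _
    · rw [smul_eq_mul, ← sq, ← Ideal.map_pow]
      refine (Ideal.map_mono (pointIdeal_le_sup_sq a hf hspan)).trans ?_
      rw [Ideal.map_sup]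
  have hflat : φ.Flat := by
    rw [hφ, RingHom.flat_algebraMap_iff]
    exact IsLocalization.flat _ (pointIdeal a).primeCompl
  have h := ((hasRegSeq_pointIdeal a).map hflat).mono hle
  rw [Ideal.map_bot, Ideal.map_span, ← Set.range_comp] at h
  rw [Ideal.map_span, ← Set.range_comp]
  exact HasRegSeq.colonTrivial _ h

theorem colonTrivial_localization_aux (t : ℕ) {l : ℕ} (hl : l + t = n)
    {f : Fin l → MvPolynomial (Fin n) K}
    (hf : ∀ i, eval a (f i) = 0) (hli : LinearIndependent K fun i => gradAt a (f i)) :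
    ColonTrivial ((Ideal.span (Set.range f)).map
      (algebraMap _ (Localization.AtPrime (pointIdeal a)))) l ⊥ := by
  induction t generalizing l with
  | zero =>
    obtain rfl : l = n := hl
    exact colonTrivial_localization_of_span_eq_top a hf
      (hli.span_eq_top_of_card_eq_finrank' (by simp))
  | succ t ih =>
    obtain ⟨v, hv⟩ : ∃ v, v ∉ Submodule.span K (Set.range fun i => gradAt a (f i)) := by
      by_contra! h
      have h1 := finrank_span_eq_card hli
      rw [Submodule.eq_top_iff'.2 h, finrank_top] at h1
      simp at h1
      omega
    set y : MvPolynomial (Fin n) K := ∑ j, C (v j) * (X j - C (a j)) with hy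
    have hya : eval a y = 0 := by simp [hy]
    have hyv : gradAt a y = v := by
      funext k
      simp [gradAt, hy, pderiv_X, Pi.single_apply]
    have h1 := ih (l := l + 1) (by omega) (f := Fin.cons y f) (Fin.cases (by simpa) (by simpa))
      (by
        have := hli.finCons (x := v) hv
        have h : (fun i => gradAt a (Fin.cons (α := fun _ => MvPolynomial (Fin n) K) y f i)) =
            Fin.cons v fun i => gradAt a (f i) := by
          funext i
          refine Fin.cases ?_ (fun i => ?_) i <;> simp [hyv]
        rwa [h])
    rw [Fin.range_cons, Set.insert_eq, Set.union_comm, Ideal.span_union, Ideal.map_sup,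
      Ideal.map_span _ {y}, Set.image_singleton] at h1
    have hmem : ∀ p, eval a p = 0 → algebraMap _ (Localization.AtPrime (pointIdeal a)) p ∈
        IsLocalRing.maximalIdeal (Localization.AtPrime (pointIdeal a)) := fun p hp => by
      rw [← Localization.AtPrime.map_eq_maximalIdeal]
      exact Ideal.mem_map_of_mem _ hp
    refine h1.drop_generator ?_ (hmem y hya)
    rw [Ideal.map_span, Ideal.span_le]
    rintro _ ⟨_, ⟨i, rfl⟩, rfl⟩
    exact hmem _ (hf i)

theorem colonTrivial_localization {l : ℕ} {f : Fin l → MvPolynomial (Fin n) K}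
    (hf : ∀ i, eval a (f i) = 0) (hli : LinearIndependent K fun i => gradAt a (f i)) :
    ColonTrivial ((Ideal.span (Set.range f)).map
      (algebraMap _ (Localization.AtPrime (pointIdeal a)))) l ⊥ := by
  have := hli.fintype_card_le_finrank
  simp only [Fintype.card_fin, Module.finrank_fintype_fun_eq_card] at this
  exact colonTrivial_localization_aux a (n - l) (by omega) hf hli

end LocalRing

end MvPolynomial

namespace MvPolynomial

section Global

variable {n : ℕ} {F K : Type*} [Field F] [Field K] [Algebra F K]

/-- The map from polynomials over `F` to the local ring of affine space over `K` at `a`. -/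
noncomputable def toLocalRing (a : Fin n → K) :
    MvPolynomial (Fin n) F →+* Localization.AtPrime (pointIdeal a) :=
  (algebraMap (MvPolynomial (Fin n) K) (Localization.AtPrime (pointIdeal a))).comp
    (map (algebraMap F K))

theorem flat_toLocalRing (a : Fin n → K) : (toLocalRing (F := F) a).Flat := by
  refine RingHom.Flat.comp (flat_map ?_) ?_
  · rw [RingHom.flat_algebraMap_iff]
    infer_instance
  · rw [RingHom.flat_algebraMap_iff]
    exact IsLocalization.flat _ (pointIdeal a).primeCompl

theorem toLocalRing_mem_maximalIdeal {a : Fin n → K} {p : MvPolynomial (Fin n) F}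
    (hp : aeval a p = 0) : toLocalRing a p ∈ IsLocalRing.maximalIdeal _ := by
  rw [← Localization.AtPrime.map_eq_maximalIdeal]
  have h : map (algebraMap F K) p ∈ pointIdeal a := by
    rw [mem_pointIdeal, eval_map, ← aeval_def, hp]
  exact Ideal.mem_map_of_mem _ h

theorem span_X_le_radical [IsAlgClosed K] {Q : Ideal (MvPolynomial (Fin n) F)}
    (hQ : ∀ a : Fin n → K, (∀ p ∈ Q, aeval a p = 0) → a = 0) :
    Ideal.span (Set.range X) ≤ Q.radical := by
  rw [← vanishingIdeal_zeroLocus_eq_radical (K := K) Q, Ideal.span_le]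
  rintro _ ⟨i, rfl⟩
  rw [SetLike.mem_coe, mem_vanishingIdeal_iff]
  intro a ha
  simp [hQ a ha]

theorem colonTrivial_of_toLocalRing [IsAlgClosed K] {I : Ideal (MvPolynomial (Fin n) F)}
    {r s : ℕ} (hrs : r ≤ s) {K₀ : Ideal (MvPolynomial (Fin n) F)}
    (hX : ColonTrivial (Ideal.span (Set.range X)) s K₀)
    (hloc : ∀ a : Fin n → K, a ≠ 0 → (∀ p ∈ I, aeval a p = 0) →
      ColonTrivial (I.map (toLocalRing a)) r (K₀.map (toLocalRing a))) :
    ColonTrivial I r K₀ := by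
  induction r generalizing s K₀ with
  | zero => trivial
  | succ r ih =>
    obtain ⟨s, rfl⟩ : ∃ s', s = s' + 1 := ⟨s - 1, by omega⟩
    refine ⟨fun z hz => ?_, fun y hy => ?_⟩
    · have hIQ : I ≤ K₀.colon {z} := fun i hi => by
        simpa [Submodule.mem_colon_singleton] using hz i hi
      have hrad : Ideal.span (Set.range X) ≤ (K₀.colon {z}).radical := by
        refine span_X_le_radical (K := K) fun a ha => ?_
        by_contra hne
        have h1 : toLocalRing a z * 1 ∈ K₀.map (toLocalRing a) := by
          rw [mul_one]
          refine (hloc a hne fun p hp => ha p (hIQ hp)).1 _ fun i hi => ?_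
          refine Submodule.span_induction
            (p := fun i _ => i * toLocalRing a z ∈ K₀.map (toLocalRing a))
            ?_ ?_ ?_ ?_ hi
          · rintro _ ⟨j, hj, rfl⟩
            rw [← map_mul]
            exact Ideal.mem_map_of_mem _ (hz j hj)
          · simp
          · intro x y _ _ hx hy
            rw [add_mul]
            exact add_mem hx hy
          · intro c x _ hx
            rw [smul_eq_mul, mul_assoc]
            exact Ideal.mul_mem_left _ _ hx
        have h2 := mem_map_colon_of_flat (flat_toLocalRing a) h1
        have h3 : (K₀.colon {z}).map (toLocalRing a) ≤ IsLocalRing.maximalIdeal _ :=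
          Ideal.map_le_iff_le_comap.2 fun p hp => toLocalRing_mem_maximalIdeal (ha p hp)
        exact (Ideal.ne_top_iff_one _).1 (IsLocalRing.maximalIdeal.isMaximal _).ne_top (h3 h2)
      obtain ⟨N, hN⟩ := Ideal.exists_pow_le_of_le_radical_of_fg hrad (IsNoetherian.noetherian _)
      refine mem_of_forall_pow_mul_mem hX.1 N fun i hi => ?_
      simpa [Submodule.mem_colon_singleton] using hN hi
    · refine ih (s := s) (by omega) (hX.2 y hy) fun a ha haI => ?_
      have := (hloc a ha haI).2 _ (hy.map (flat_toLocalRing a))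
      rwa [← Ideal.map_sup_span_singleton] at this

theorem gradAt_map (a : Fin n → K) (p : MvPolynomial (Fin n) F) :
    gradAt a (map (algebraMap F K) p) = fun j => aeval a (pderiv j p) := by
  funext j
  rw [gradAt, pderiv_map, eval_map, ← aeval_def]

variable {l : ℕ} {f : Fin l → MvPolynomial (Fin n) F}

theorem colonTrivial_of_smooth [IsAlgClosed K] (hl : l ≤ n)
    (hf : ∀ a : Fin n → K, a ≠ 0 → (∀ i, aeval a (f i) = 0) →
      LinearIndependent K fun i j => aeval a (pderiv j (f i))) :
    ColonTrivial (Ideal.span (Set.range f)) l ⊥ := by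
  refine colonTrivial_of_toLocalRing (K := K) hl (HasRegSeq.colonTrivial _ (hasRegSeq_X n F))
    fun a ha hI => ?_
  have hfa : ∀ i, aeval a (f i) = 0 := fun i => hI _ (Ideal.subset_span ⟨i, rfl⟩)
  have h := colonTrivial_localization a (f := fun i => map (algebraMap F K) (f i))
    (fun i => by rw [eval_map, ← aeval_def, hfa]) (by simpa only [gradAt_map] using hf a ha hfa)
  rw [Ideal.map_bot]
  convert h using 1
  rw [toLocalRing, ← Ideal.map_map, Ideal.map_span _ (Set.range f), ← Set.range_comp]
  rfl

theorem colonTrivial_X_of_smooth [IsAlgClosed K] (hl : l ≤ n)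
    (hf : ∀ a : Fin n → K, a ≠ 0 → (∀ i, aeval a (f i) = 0) →
      LinearIndependent K fun i j => aeval a (pderiv j (f i))) :
    ColonTrivial (Ideal.span (Set.range X)) (n - l) (Ideal.span (Set.range f)) := by
  have hX := HasRegSeq.colonTrivial _ (hasRegSeq_X n F)
  have hset : {x | x ∈ List.ofFn f} = Set.range f := by
    ext x
    simp [List.mem_ofFn]
  have := ColonTrivial.sup_span_list (r := n - l) (List.ofFn f)
    (by simpa [Nat.add_sub_cancel' hl] using hX)
    (by rw [hset, List.length_ofFn]; exact colonTrivial_of_smooth hl hf)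
  rwa [hset, bot_sup_eq] at this

end Global

end MvPolynomial

theorem LinearIndependent.exists_det_ne_zero {K : Type*} [Field K] {k n : ℕ}
    {M : Matrix (Fin k) (Fin n) K} (h : LinearIndependent K fun i => M i) :
    ∃ e : Fin k → Fin n, (M.submatrix id e).det ≠ 0 := by
  have hrank : M.rank = k := by simpa using LinearIndependent.rank_matrix (M := M) h
  have htop : Submodule.span K (Set.range M.col) = ⊤ := by
    apply Submodule.eq_top_of_finrank_eq
    rw [← Matrix.rank_eq_finrank_span_cols, hrank, Module.finrank_fin_fun]
  obtain ⟨κ, e, -, hspan, hli⟩ := exists_linearIndependent' K M.col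
  rw [htop] at hspan
  let b : Module.Basis κ K (Fin k → K) := Module.Basis.mk hli hspan.ge
  have : Fintype κ := FiniteDimensional.fintypeBasisIndex b
  have hcard : Fintype.card (Fin k) = Fintype.card κ := by
    rw [← Module.finrank_eq_card_basis b]
    simp
  let ε := Fintype.equivOfCardEq hcard
  refine ⟨e ∘ ε, ?_⟩
  have hli' : LinearIndependent K (M.submatrix id (e ∘ ε)).col := hli.comp ε ε.injective
  rw [Matrix.linearIndependent_cols_iff_isUnit, Matrix.isUnit_iff_isUnit_det] at hli'
  exact hli'.ne_zero

namespace ExteriorAlgebra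

theorem det_pow_mem_divisionIdeal {A : Type*} [CommRing A] {k n : ℕ} (w : Fin k → Fin n → A)
    (e : Fin k → Fin n) : ((Matrix.of w).submatrix id e).det ^ k ∈ divisionIdeal (A := A) w := by
  set N := (Matrix.of w).submatrix id e with hN
  refine pow_mem_divisionIdeal w
    (d := fun i => ∑ i', N.adjugate i' i • LinearMap.proj (e i')) fun i j => ?_
  have h := congrFun (congrFun N.mul_adjugate j) i
  rw [Matrix.mul_apply] at h
  simp only [LinearMap.sum_apply, LinearMap.smul_apply, LinearMap.proj_apply, smul_eq_mul]
  simp only [hN, Matrix.submatrix_apply, Matrix.of_apply, id, Matrix.smul_apply,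
    Matrix.one_apply, smul_eq_mul, mul_ite, mul_one, mul_zero] at h
  simp only [eq_comm (a := i) (b := j), ← h, mul_comm, hN]

end ExteriorAlgebra

namespace MvPolynomial

theorem exists_mem_divisionIdeal {n k : ℕ} {F K : Type*} [Field F] [Field K] [Algebra F K]
    (w : Fin k → Fin n → MvPolynomial (Fin n) F) {a : Fin n → K}
    (h : LinearIndependent K fun i j => aeval a (w i j)) :
    ∃ p ∈ ExteriorAlgebra.divisionIdeal (A := MvPolynomial (Fin n) F) w, aeval a p ≠ 0 := by
  obtain ⟨e, he⟩ := LinearIndependent.exists_det_ne_zero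
    (M := Matrix.of fun i j => aeval a (w i j)) h
  refine ⟨_, ExteriorAlgebra.det_pow_mem_divisionIdeal w e, ?_⟩
  rw [map_pow, AlgHom.map_det]
  exact pow_ne_zero _ he

/-- Euler's identity at a point where the gradient of `g` lies in the span of the gradients of
homogeneous polynomials vanishing there. -/
theorem aeval_eq_zero_of_gradient_mem_span {n l : ℕ} {F K : Type*} [Field F] [Field K]
    [Algebra F K] {g : MvPolynomial (Fin n) F} {f : Fin l → MvPolynomial (Fin n) F} {d : ℕ}
    {e : Fin l → ℕ} (hg : g.IsHomogeneous d) (hf : ∀ i, (f i).IsHomogeneous (e i))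
    (hd : (d : K) ≠ 0) {a : Fin n → K} (hfa : ∀ i, aeval a (f i) = 0)
    (h : (fun j => aeval a (pderiv j g)) ∈
      Submodule.span K (Set.range fun i j => aeval a (pderiv j (f i)))) :
    aeval a g = 0 := by
  have euler : ∀ {p : MvPolynomial (Fin n) F} {m : ℕ}, p.IsHomogeneous m →
      ∑ j, a j * aeval a (pderiv j p) = m * aeval a p := by
    intro p m hp
    have := congrArg (aeval a) hp.sum_X_mul_pderiv
    simpa using this
  obtain ⟨c, hc⟩ := (Submodule.mem_span_range_iff_exists_fun K).1 h
  have h0 : ∑ j, a j * aeval a (pderiv j g) = 0 := by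
    have : ∀ j, aeval a (pderiv j g) = ∑ i, c i * aeval a (pderiv j (f i)) := fun j => by
      rw [← congrFun hc j]
      simp
    simp only [this, Finset.mul_sum]
    rw [Finset.sum_comm]
    refine Finset.sum_eq_zero fun i _ => ?_
    have := euler (hf i)
    rw [hfa, mul_zero] at this
    rw [← mul_zero (c i), ← this, Finset.mul_sum]
    exact Finset.sum_congr rfl fun j _ => by ring
  rw [euler hg] at h0
  exact (mul_eq_zero.1 h0).resolve_left hd

end MvPolynomial

namespace MvPolynomial

variable {n l : ℕ} {F K : Type*} [Field F] [Field K] [Algebra F K] [IsAlgClosed K]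

theorem mem_wedgeSpan_of_smooth {f : Fin l → MvPolynomial (Fin n) F} (hl : l ≤ n)
    (hf : ∀ a : Fin n → K, a ≠ 0 → (∀ i, aeval a (f i) = 0) →
      LinearIndependent K fun i j => aeval a (pderiv j (f i)))
    {k : ℕ} (w : Fin k → Fin n → MvPolynomial (Fin n) F)
    (hw : ∀ a : Fin n → K, a ≠ 0 → (∀ i, aeval a (f i) = 0) →
      LinearIndependent K fun i j => aeval a (w i j))
    {m : ℕ} (hm : m < n - l)
    {β : ExteriorAlgebra (MvPolynomial (Fin n) F) (Fin n → MvPolynomial (Fin n) F)}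
    (hβ : β ∈ ⋀[MvPolynomial (Fin n) F]^m (Fin n → MvPolynomial (Fin n) F))
    (h : ExteriorAlgebra.wedgeList (A := MvPolynomial (Fin n) F) w (List.finRange k) * β ∈
      Ideal.span (Set.range f) •
        (⊤ : Submodule (MvPolynomial (Fin n) F)
          (ExteriorAlgebra (MvPolynomial (Fin n) F) (Fin n → MvPolynomial (Fin n) F)))) :
    β ∈ ExteriorAlgebra.wedgeSpan (A := MvPolynomial (Fin n) F) w ⊔
      Ideal.span (Set.range f) • ⊤ := by
  have : Module.Free (MvPolynomial (Fin n) F)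
      (ExteriorAlgebra (MvPolynomial (Fin n) F) (Fin n → MvPolynomial (Fin n) F)) :=
    Module.Free.of_basis (Pi.basisFun (MvPolynomial (Fin n) F) (Fin n)).ExteriorAlgebra
  refine ExteriorAlgebra.mem_wedgeSpan_of_hasRegSeq w (r := n - l) ?_
    (ExteriorAlgebra.trunc_of_mem hm hβ) h
  refine (colonTrivial_X_of_smooth hl hf).hasRegSeq (span_X_le_radical (K := K) fun a ha => ?_)
  by_contra hne
  obtain ⟨p, hp, hpa⟩ := exists_mem_divisionIdeal w
    (hw a hne fun i => ha _ (Ideal.mem_sup_right (Ideal.subset_span ⟨i, rfl⟩)))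
  exact hpa (ha p (Ideal.mem_sup_left hp))

end MvPolynomial

namespace ExteriorAlgebra

section Coefficients

variable {A : Type*} [CommRing A] {N : ℕ}

variable (A N) in
/-- The basis of wedge monomials of the exterior algebra of `A ^ N`. -/
noncomputable def wedgeBasis : Module.Basis (Finset (Fin N)) A (ExteriorAlgebra A (Fin N → A)) :=
  (Pi.basisFun A (Fin N)).ExteriorAlgebra

theorem wedgeBasis_empty : wedgeBasis A N ∅ = 1 := by
  rw [wedgeBasis, basis_apply_ofCard (s := ∅) _ Finset.card_empty]
  simp [ιMulti_family]

theorem wedgeBasis_singleton (i : Fin N) :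
    wedgeBasis A N {i} = ι A (Pi.single i (1 : A)) := by
  rw [wedgeBasis, basis_apply_ofCard (s := {i}) _ (Finset.card_singleton i)]
  have : (Set.powersetCard.ofFinEmbEquiv.symm
      (Set.powersetCard.ofCard (Finset.card_singleton i)) : Fin 1 ↪o Fin N) 0 = i := by
    have h := (Set.powersetCard.mem_range_ofFinEmbEquiv_symm_iff_mem
      (Set.powersetCard.ofCard (Finset.card_singleton i)) _).1 ⟨0, rfl⟩
    exact Finset.mem_singleton.1 h
  simp [ιMulti_family, ιMulti_apply, this]

theorem wedgeBasis_eq_prod (s : Finset (Fin N)) : ∃ e : Fin s.card → Fin N,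
    wedgeBasis A N s = (List.ofFn fun i => ι A (Pi.single (e i) (1 : A))).prod := by
  refine ⟨Set.powersetCard.ofFinEmbEquiv.symm (Set.powersetCard.ofCard rfl), ?_⟩
  rw [wedgeBasis, basis_apply_ofCard (s := s) _ rfl, ιMulti_family, ιMulti_apply]
  simp

theorem wedgeBasis_mul (s t : Finset (Fin N)) :
    wedgeBasis A N s * wedgeBasis A N t = 0 ∨
      ∃ u, wedgeBasis A N s * wedgeBasis A N t = wedgeBasis A N u ∨
        wedgeBasis A N s * wedgeBasis A N t = -wedgeBasis A N u := by
  by_cases h : Disjoint s t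
  · right
    have := basis_mul_of_disjoint (Pi.basisFun A (Fin N)) (Set.powersetCard.ofCard (s := s) rfl)
      (Set.powersetCard.ofCard (s := t) rfl) h
    refine ⟨(Set.powersetCard.disjUnion (s := Set.powersetCard.ofCard (s := s) rfl)
      (t := Set.powersetCard.ofCard (s := t) rfl) h).val, ?_⟩
    rcases Int.units_eq_one_or ((Set.powersetCard.permOfDisjoint
      (s := Set.powersetCard.ofCard (s := s) rfl)
      (t := Set.powersetCard.ofCard (s := t) rfl) h).sign) with h1 | h1
    · rw [h1, one_smul] at this
      exact Or.inl this
    · rw [h1, Units.neg_smul, one_smul] at this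
      exact Or.inr this
  · left
    exact basis_mul_of_not_disjoint (Pi.basisFun A (Fin N)) (Set.powersetCard.ofCard (s := s) rfl)
      (Set.powersetCard.ofCard (s := t) rfl) h

/-- Apply an additive map to all coefficients with respect to wedge monomials. -/
noncomputable def mapCoeff (φ : A →+ A) :
    ExteriorAlgebra A (Fin N → A) →+ ExteriorAlgebra A (Fin N → A) where
  toFun ω := ∑ s, φ ((wedgeBasis A N).repr ω s) • wedgeBasis A N s
  map_zero' := by simp
  map_add' x y := by simp [add_smul, Finset.sum_add_distrib]

theorem mapCoeff_apply (φ : A →+ A) (ω : ExteriorAlgebra A (Fin N → A)) :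
    mapCoeff φ ω = ∑ s, φ ((wedgeBasis A N).repr ω s) • wedgeBasis A N s := rfl

theorem mapCoeff_smul_wedgeBasis (φ : A →+ A) (c : A) (s : Finset (Fin N)) :
    mapCoeff φ (c • wedgeBasis A N s) = φ c • wedgeBasis A N s := by
  rw [mapCoeff_apply, Finset.sum_eq_single s]
  · simp
  · intro t _ hts
    simp [hts.symm]
  · simp

theorem mapCoeff_smul {φ ψ : A →+ A} {f : A} (h : ∀ c, φ (f * c) = f * ψ c)
    (κ : ExteriorAlgebra A (Fin N → A)) : mapCoeff φ (f • κ) = f • mapCoeff ψ κ := by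
  simp [mapCoeff_apply, h, Finset.smul_sum, mul_smul]

theorem mapCoeff_wedgeBasis_mul (φ : A →+ A) (s : Finset (Fin N))
    (η : ExteriorAlgebra A (Fin N → A)) :
    mapCoeff φ (wedgeBasis A N s * η) = wedgeBasis A N s * mapCoeff φ η := by
  rw [mapCoeff_apply φ η]
  conv_lhs => rw [← (wedgeBasis A N).sum_repr η]
  rw [Finset.mul_sum, map_sum, Finset.mul_sum]
  refine Finset.sum_congr rfl fun t _ => ?_
  rw [mul_smul_comm, mul_smul_comm]
  rcases wedgeBasis_mul (A := A) s t with h | ⟨u, h | h⟩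
  · simp [h]
  · rw [h, mapCoeff_smul_wedgeBasis]
  · rw [h, smul_neg, map_neg, mapCoeff_smul_wedgeBasis, smul_neg]

theorem mapCoeff_ι_mul {φ ψ : A →+ A} {v : Fin N → A} (h : ∀ j c, φ (v j * c) = v j * ψ c)
    (η : ExteriorAlgebra A (Fin N → A)) :
    mapCoeff φ (ι A v * η) = ι A v * mapCoeff ψ η := by
  have hv : ι A v = ∑ j, v j • wedgeBasis A N {j} := by
    conv_lhs => rw [pi_eq_sum_univ' v]
    simp [wedgeBasis_singleton]
  rw [hv, Finset.sum_mul, Finset.sum_mul, map_sum]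
  refine Finset.sum_congr rfl fun j _ => ?_
  rw [smul_mul_assoc, smul_mul_assoc, mapCoeff_smul (h j), mapCoeff_wedgeBasis_mul]

theorem mapCoeff_smul_prod (φ : A →+ A) (c : A) (L : List (Fin N)) :
    mapCoeff φ (c • (L.map fun i => ι A (Pi.single i (1 : A))).prod) =
      φ c • (L.map fun i => ι A (Pi.single i (1 : A))).prod := by
  have h : ∀ η, mapCoeff φ ((L.map fun i => ι A (Pi.single i (1 : A))).prod * η) =
      (L.map fun i => ι A (Pi.single i (1 : A))).prod * mapCoeff φ η := by
    induction L with
    | nil => simp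
    | cons i L ih =>
      intro η
      rw [List.map_cons, List.prod_cons, mul_assoc, ← wedgeBasis_singleton,
        mapCoeff_wedgeBasis_mul, ih, mul_assoc]
  have h1 := h (c • 1)
  rw [← wedgeBasis_empty, mapCoeff_smul_wedgeBasis] at h1
  simpa [wedgeBasis_empty] using h1

end Coefficients

end ExteriorAlgebra

namespace MvPolynomial

/-- Extraction of the homogeneous component of degree `d - e`, which is zero if `d < e`. -/
noncomputable def componentSub {n : ℕ} {F : Type*} [CommRing F] (d e : ℕ) :
    MvPolynomial (Fin n) F →+ MvPolynomial (Fin n) F :=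
  if e ≤ d then (homogeneousComponent (d - e)).toAddMonoidHom else 0

section

attribute [local instance] gradedAlgebra

theorem homogeneousComponent_mul_eq {n : ℕ} {F : Type*} [CommRing F] {d e : ℕ}
    {f : MvPolynomial (Fin n) F} (hf : f.IsHomogeneous e) (c : MvPolynomial (Fin n) F) :
    homogeneousComponent d (f * c) = f * componentSub d e c := by
  have hf' : f ∈ homogeneousSubmodule (Fin n) F e := hf
  have hc : ∀ (p : MvPolynomial (Fin n) F) (i : ℕ), homogeneousComponent i p =
      (DirectSum.decompose (homogeneousSubmodule (Fin n) F) p i : MvPolynomial (Fin n) F) :=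
    fun p i => (decomposition.decompose'_apply p i).symm
  rw [componentSub, hc]
  split_ifs with h
  · rw [DirectSum.coe_decompose_mul_of_left_mem_of_le _ hf' h, ← hc]
    rfl
  · rw [DirectSum.coe_decompose_mul_of_left_mem_of_not_le _ hf' h]
    simp

end

theorem exists_componentSub_isHomogeneous {n : ℕ} {F : Type*} [CommRing F] (d e : ℕ) :
    ∃ k, ∀ p : MvPolynomial (Fin n) F, (componentSub d e p).IsHomogeneous k := by
  refine ⟨d - e, fun p => ?_⟩
  rw [componentSub]
  split_ifs
  · exact homogeneousComponent_isHomogeneous _ _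
  · exact isHomogeneous_zero _ _ _

end MvPolynomial

section Forms

variable {F : Type} [Field F] {n : ℕ}

theorem wedgeMonomial_mem_exteriorPower {k : ℕ} (s : Fin k → Fin n) (c : PolyRing F n) :
    wedgeMonomial k s c ∈ ⋀[PolyRing F n]^k (Fin n → PolyRing F n) :=
  Submodule.smul_mem _ _ (ExteriorAlgebra.ιMulti_range (R := PolyRing F n) k
    ⟨fun i => Pi.single (s i) (1 : PolyRing F n), rfl⟩)

theorem IsHomogeneousForm.mem_exteriorPower {k d : ℕ} {ω : FormAlgebra F n}
    (h : IsHomogeneousForm k d ω) : ω ∈ ⋀[PolyRing F n]^k (Fin n → PolyRing F n) := by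
  refine (AddSubgroup.closure_le (K := (⋀[PolyRing F n]^k (Fin n → PolyRing F n)).toAddSubgroup)).2
    ?_ h
  rintro _ ⟨s, c, -, rfl⟩
  exact wedgeMonomial_mem_exteriorPower s c

theorem mapCoeff_wedgeMonomial (φ : PolyRing F n →+ PolyRing F n) {k : ℕ} (s : Fin k → Fin n)
    (c : PolyRing F n) :
    ExteriorAlgebra.mapCoeff φ (wedgeMonomial k s c) = wedgeMonomial k s (φ c) := by
  have h := ExteriorAlgebra.mapCoeff_smul_prod φ c (List.ofFn s)
  rwa [List.map_ofFn] at h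

theorem IsHomogeneousForm.mapCoeff_eq {k d : ℕ} {ω : FormAlgebra F n}
    (h : IsHomogeneousForm k d ω) :
    ExteriorAlgebra.mapCoeff (homogeneousComponent d).toAddMonoidHom ω = ω := by
  refine (AddSubgroup.closure_le (K := (ExteriorAlgebra.mapCoeff
    (homogeneousComponent d).toAddMonoidHom).eqLocus (AddMonoidHom.id (FormAlgebra F n)))).2 ?_ h
  rintro _ ⟨s, c, hc, rfl⟩
  exact (mapCoeff_wedgeMonomial _ s c).trans
    (congrArg (wedgeMonomial k s) (homogeneousComponent_eq_self hc))

theorem isHomogeneousForm_degreeProj_mapCoeff {φ : PolyRing F n →+ PolyRing F n} {e : ℕ}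
    (hφ : ∀ p, (φ p).IsHomogeneous e) (k : ℕ) (η : FormAlgebra F n) :
    IsHomogeneousForm k e (ExteriorAlgebra.degreeProj k (ExteriorAlgebra.mapCoeff φ η)) := by
  rw [ExteriorAlgebra.mapCoeff_apply, map_sum]
  refine AddSubgroup.sum_mem _ fun s _ => ?_
  obtain ⟨i, hi⟩ := ExteriorAlgebra.wedgeBasis_eq_prod (A := PolyRing F n) s
  set c := φ ((ExteriorAlgebra.wedgeBasis (PolyRing F n) n).repr η s) with hc
  have hB : c • ExteriorAlgebra.wedgeBasis (PolyRing F n) n s = wedgeMonomial s.card i c := by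
    rw [hi, wedgeMonomial]
  rw [hB]
  by_cases hk : s.card = k
  · subst hk
    rw [ExteriorAlgebra.degreeProj_of_mem (wedgeMonomial_mem_exteriorPower i c)]
    exact AddSubgroup.subset_closure ⟨i, c, hφ _, rfl⟩
  · rw [ExteriorAlgebra.degreeProj_of_mem_of_ne hk (wedgeMonomial_mem_exteriorPower i c)]
    exact AddSubgroup.zero_mem _

theorem exists_homogeneous_dform_mul {g : PolyRing F n} {e : ℕ} (hg : g.IsHomogeneous e) (d m : ℕ)
    (η : FormAlgebra F n) :
    ∃ ζ : FormAlgebra F n, (∃ k, IsHomogeneousForm (m - 1) k ζ) ∧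
      ExteriorAlgebra.degreeProj m (ExteriorAlgebra.mapCoeff
        (homogeneousComponent d).toAddMonoidHom (dform g * η)) = dform g * ζ := by
  have h := ExteriorAlgebra.mapCoeff_ι_mul (φ := (homogeneousComponent d).toAddMonoidHom)
    (ψ := componentSub d (e - 1)) (v := fun j => pderiv j g)
    (fun j c => homogeneousComponent_mul_eq (IsHomogeneous.pderiv hg) c) η
  obtain ⟨k, hk⟩ := exists_componentSub_isHomogeneous (n := n) (F := F) d (e - 1)
  rw [dform, h]
  cases m with
  | zero =>
    exact ⟨0, ⟨0, AddSubgroup.zero_mem _⟩, by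
      rw [ExteriorAlgebra.degreeProj_zero_ι_mul, mul_zero]⟩
  | succ m =>
    exact ⟨_, ⟨k, isHomogeneousForm_degreeProj_mapCoeff hk m η⟩,
      ExteriorAlgebra.degreeProj_succ_ι_mul m _ _⟩

theorem exists_homogeneous_smul {f : PolyRing F n} {e : ℕ} (hf : f.IsHomogeneous e) (d m : ℕ)
    (κ : FormAlgebra F n) :
    ∃ ζ : FormAlgebra F n, (∃ k, IsHomogeneousForm m k ζ) ∧
      ExteriorAlgebra.degreeProj m (ExteriorAlgebra.mapCoeff
        (homogeneousComponent d).toAddMonoidHom (f • κ)) = f • ζ := by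
  have h := ExteriorAlgebra.mapCoeff_smul (φ := (homogeneousComponent d).toAddMonoidHom)
    (ψ := componentSub d e) (fun c => homogeneousComponent_mul_eq hf c) κ
  obtain ⟨k, hk⟩ := exists_componentSub_isHomogeneous (n := n) (F := F) d e
  rw [h]
  exact ⟨_, ⟨k, isHomogeneousForm_degreeProj_mapCoeff hk m κ⟩, map_smul _ _ _⟩

theorem exists_sum_smul_of_mem_span_smul_top {A V : Type*} [CommRing A] [AddCommGroup V]
    [Module A V] {l : ℕ} {f : Fin l → A} {x : V}
    (hx : x ∈ Ideal.span (Set.range f) • (⊤ : Submodule A V)) :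
    ∃ κ : Fin l → V, x = ∑ j, f j • κ j := by
  refine Submodule.smul_induction_on hx ?_ ?_
  · intro r hr v _
    obtain ⟨c, rfl⟩ := Ideal.mem_span_range_iff_exists_fun.1 hr
    refine ⟨fun j => c j • v, ?_⟩
    rw [Finset.sum_smul]
    exact Finset.sum_congr rfl fun j _ => by rw [smul_smul, mul_comm]
  · rintro _ _ ⟨κ, rfl⟩ ⟨κ', rfl⟩
    exact ⟨κ + κ', by simp [Finset.sum_add_distrib]⟩

theorem IsSmoothCI.linearIndependent {ι : Type} {g : ι → PolyRing F n} (h : IsSmoothCI g)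
    {a : Fin n → AlgebraicClosure F} (ha : a ≠ 0) (hg : ∀ i, aeval a (g i) = 0) :
    LinearIndependent (AlgebraicClosure F) fun i j => aeval a (pderiv j (g i)) := by
  by_contra hli
  refine ha (h a (fun i => ?_) ?_)
  · rw [eval_map, ← aeval_def, hg]
  · simpa only [eval_map, ← aeval_def] using hli

end Forms

/-- Lemma 5.9: if `f_{i_1} = ⋯ = f_{i_l} = 0` and `g = f_{i_1} = ⋯ = f_{i_l} = 0` define
smooth complete intersections in `P^{n-1}`, `p ∤ deg g`, and `β` is a homogeneous `m`-form
with `m ≤ n-l-1` such that every coefficient of `dg ∧ df_{i_1} ∧ ⋯ ∧ df_{i_l} ∧ β` lies in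
the ideal `(f_{i_1},…,f_{i_l})`, then
`β = dg ∧ β₀ + Σ_j df_{i_j} ∧ β_j + Σ_j f_{i_j} β'_j` with all `β_j, β'_j` homogeneous. -/
theorem lemma_5_9 {F : Type} [Field F] [Fintype F] {p n : ℕ} [CharP F p]
    (hp : p.Prime) {l : ℕ} (hl : 1 ≤ l)
    (g0 : MvPolynomial (Fin n) F) (gs : Fin l → MvPolynomial (Fin n) F)
    (d0 : ℕ) (dd : Fin l → ℕ)
    (hg0 : g0.IsHomogeneous d0) (hgs : ∀ i, (gs i).IsHomogeneous (dd i))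
    (hpd : ¬ (p ∣ d0))
    (hCI : IsSmoothCI gs)
    (hCI' : IsSmoothCI (fun i : Option (Fin l) => i.elim g0 gs))
    (m : ℕ) (hm : m + l + 1 ≤ n) (dβ : ℕ) (β : FormAlgebra F n)
    (hβ : IsHomogeneousForm m dβ β)
    (hmod : ∃ γ : Fin l → FormAlgebra F n, (∀ j, IsForm (m + l + 1) (γ j)) ∧
      dform g0 * ((List.ofFn fun j => dform (gs j)).prod * β) = ∑ j, gs j • γ j) :
    ∃ (β₀ : FormAlgebra F n) (βs β's : Fin l → FormAlgebra F n),
      (∃ e₀, IsHomogeneousForm (m - 1) e₀ β₀) ∧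
      (∀ j, ∃ e, IsHomogeneousForm (m - 1) e (βs j)) ∧
      (∀ j, ∃ e', IsHomogeneousForm m e' (β's j)) ∧
      β = dform g0 * β₀ + (∑ j, dform (gs j) * βs j) + ∑ j, gs j • β's j := by
  have hCIa := fun a ha hga => hCI.linearIndependent (a := a) ha hga
  have hd0 : (d0 : AlgebraicClosure F) ≠ 0 := by
    have := charP_of_injective_algebraMap (algebraMap F (AlgebraicClosure F)).injective p
    rwa [Ne, CharP.cast_eq_zero_iff (AlgebraicClosure F) p]
  let w : Fin (l + 1) → Fin n → PolyRing F n :=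
    Fin.cons (fun j => pderiv j g0) fun i j => pderiv j (gs i)
  have hw : ∀ a : Fin n → AlgebraicClosure F, a ≠ 0 → (∀ i, aeval a (gs i) = 0) →
      LinearIndependent (AlgebraicClosure F) fun i j => aeval a (w i j) := by
    intro a ha hga
    have hcons : (fun i j => aeval a (w i j)) =
        Fin.cons (fun j => aeval a (pderiv j g0)) fun i j => aeval a (pderiv j (gs i)) := by
      funext i
      refine Fin.cases ?_ (fun i => ?_) i <;> rfl
    rw [hcons]
    refine (hCIa a ha hga).finCons fun hmem => ?_
    have h0 := aeval_eq_zero_of_gradient_mem_span hg0 hgs hd0 hga hmem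
    have hli := hCI'.linearIndependent ha (by rintro (_ | i) <;> simp [h0, hga])
    exact (linearIndependent_option.1 hli).2 hmem
  have hwedge : dform g0 * (List.ofFn fun j => dform (gs j)).prod =
      ExteriorAlgebra.wedgeList (A := PolyRing F n) w (List.finRange (l + 1)) := by
    rw [List.finRange_succ, ExteriorAlgebra.wedgeList_cons, ExteriorAlgebra.wedgeList,
      List.map_map, ← List.ofFn_eq_map]
    rfl
  have hmem : ExteriorAlgebra.wedgeList (A := PolyRing F n) w (List.finRange (l + 1)) * β ∈
      Ideal.span (Set.range gs) • (⊤ : Submodule (PolyRing F n) (FormAlgebra F n)) := by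
    obtain ⟨γ, -, hγ⟩ := hmod
    rw [← hwedge, mul_assoc, hγ]
    exact Submodule.sum_mem _ fun j _ =>
      Submodule.smul_mem_smul (Ideal.subset_span ⟨j, rfl⟩) trivial
  obtain ⟨x, hx, y, hy, hxy⟩ := Submodule.mem_sup.1
    (mem_wedgeSpan_of_smooth (by omega) hCIa w hw (by omega) hβ.mem_exteriorPower hmem)
  obtain ⟨η, rfl⟩ := ExteriorAlgebra.exists_sum_of_mem_wedgeSpan w hx
  obtain ⟨κ, rfl⟩ := exists_sum_smul_of_mem_span_smul_top hy
  obtain ⟨β₀, hβ₀, h0⟩ := exists_homogeneous_dform_mul hg0 dβ m (η 0)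
  choose βs hβs h1 using fun j : Fin l => exists_homogeneous_dform_mul (hgs j) dβ m (η j.succ)
  choose β's hβ's h2 using fun j => exists_homogeneous_smul (hgs j) dβ m (κ j)
  refine ⟨β₀, βs, β's, hβ₀, hβs, hβ's, ?_⟩
  have hβ' : ExteriorAlgebra.degreeProj m (ExteriorAlgebra.mapCoeff
      (homogeneousComponent dβ).toAddMonoidHom β) = β := by
    rw [hβ.mapCoeff_eq, ExteriorAlgebra.degreeProj_of_mem hβ.mem_exteriorPower]
  rw [← hβ', ← hxy, Fin.sum_univ_succ]
  simp only [map_add, map_sum, ← h0, ← h1, ← h2]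
  rfl
end
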